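/- arXiv:0810.1474 — 3 statements merged into one kernel-verified Lean document; each statement's English description precedes it below -/
import Mathlib

section
/- There exists a real polynomial g of degree 3 with g([0,1]) ⊆ [0,1] and g(0) = 0, having exactly two critical points c_1 < c_2, both lying in (0,1), such that: (i) g(c_1) = 1, g(1) = 1 and |g'(1)| > 1, so c_1 is a non-recurrent critical point; (ii) the critical point c_2 is recurrent, i.e. c_2 ∈ ω(c_2); (iii) c_2 is not Collet–Eckmann: there exist no constants C > 0 and λ > 1 with |(g^n)'(g(c_2))| > C·λ^n for all n ≥ 0 (indeed |(g^p)'(g(c_2))| < 1 for infinitely many p), hence g does not satisfy the Recurrent Collet–Eckmann condition; and (iv) g satisfies the Exponential Shrinking of components condition at every point of [0,1] (the interval [0,1] is contained in the Julia set of g): there exist λ > 1 and r > 0 such that for every z ∈ [0,1], every n ≥ 0 and every connected component W ⊆ ℂ of g^{-n}(B(z,r)) (g viewed as a polynomial map of ℂ), diam W < λ^{-n}. -/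
open Set Metric

noncomputable section

/-- The critical point `c` is recurrent: `c` belongs to the set of accumulation points of its
forward orbit `(f^n c)_{n ≥ 1}`. -/
def Recurrent (f : ℝ → ℝ) (c : ℝ) : Prop :=
  ∀ ε > (0:ℝ), ∀ N : ℕ, ∃ n : ℕ, N ≤ n ∧ 1 ≤ n ∧ |f^[n] c - c| < ε

/-- The Collet–Eckmann condition at the critical point `c`. -/
def ColletEckmann (f : ℝ → ℝ) (c : ℝ) : Prop :=
  ∃ C > (0:ℝ), ∃ lam > (1:ℝ), ∀ n : ℕ, C * lam ^ n < |deriv (f^[n]) (f c)|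

def FC (c : ℝ) (u : ℂ) : ℂ := (u^3 - (1 - (c:ℂ)) * u) / c

lemma FC_sub (c q : ℝ) (hq : 3*q^2 = 1 - c) (u u' : ℂ) :
    FC c u - FC c u' = (u - u') * (u^2 + u*u' + u'^2 - 3*(q:ℂ)^2) / c := by
  have h : (3*(q:ℂ)^2) = 1 - c := by exact_mod_cast congrArg (fun t : ℝ => (t:ℂ)) hq
  unfold FC
  rw [h]; ring

lemma FC_sub_norm (c q : ℝ) (hc : 0 < c) (hq : 3*q^2 = 1 - c) (u u' : ℂ) :
    ‖FC c u - FC c u'‖ = ‖u - u'‖ * ‖u^2 + u*u' + u'^2 - 3*(q:ℂ)^2‖ / c := by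
  rw [FC_sub c q hq, norm_div, norm_mul, Complex.norm_real, Real.norm_of_nonneg hc.le]

/-- two-point derivative near a real point `p`. -/
lemma twopt_near (p q x : ℝ) (hp : |p| ≤ 1) (hx : x ≤ |p^2-q^2| / 1000) (hpq : |p^2-q^2| ≤ 1)
    (u u' : ℂ) (hu : ‖u - p‖ ≤ x) (hu' : ‖u' - p‖ ≤ x) :
    ‖u^2 + u*u' + u'^2 - 3*(q:ℂ)^2‖ ≤ 1.01 * (3*|p^2-q^2|) ∧
    0.99 * (3*|p^2-q^2|) ≤ ‖u^2 + u*u' + u'^2 - 3*(q:ℂ)^2‖ := by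
  obtain ⟨s, rfl⟩ : ∃ s, u = p + s := ⟨u - p, by ring⟩
  obtain ⟨t, rfl⟩ : ∃ s, u' = p + s := ⟨u' - p, by ring⟩
  simp only [add_sub_cancel_left] at hu hu'
  have hx0 : 0 ≤ x := (norm_nonneg _).trans hu
  have hx1 : x ≤ 1 := by linarith
  set a : ℂ := 3*((p^2-q^2 : ℝ):ℂ) with ha
  have hna : ‖a‖ = 3*|p^2-q^2| := by
    rw [ha, norm_mul, Complex.norm_real, Real.norm_eq_abs]; norm_num
  have hE : ((p:ℂ)+s)^2 + (p+s)*(p+t) + (p+t)^2 - 3*(q:ℂ)^2 = a + (3*p*s + 3*p*t + s^2 + s*t + t^2) := by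
    rw [ha]; push_cast; ring
  have hP : ‖(p:ℂ)‖ ≤ 1 := by simpa using hp
  have hs0 := norm_nonneg s
  have ht0 := norm_nonneg t
  have hp0 := norm_nonneg (p:ℂ)
  have hb : ‖3*(p:ℂ)*s + 3*p*t + s^2 + s*t + t^2‖ ≤ 9*x := by
    have h1 : ‖3*(p:ℂ)*s‖ ≤ 3*x := by
      rw [norm_mul, norm_mul]; norm_num; nlinarith
    have h2 : ‖3*(p:ℂ)*t‖ ≤ 3*x := by
      rw [norm_mul, norm_mul]; norm_num; nlinarith
    have h3 : ‖s^2‖ ≤ x := by rw [norm_pow]; nlinarith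
    have h4 : ‖s*t‖ ≤ x := by rw [norm_mul]; nlinarith
    have h5 : ‖t^2‖ ≤ x := by rw [norm_pow]; nlinarith
    calc _ ≤ ‖3*(p:ℂ)*s‖ + ‖3*(p:ℂ)*t‖ + ‖s^2‖ + ‖s*t‖ + ‖t^2‖ := by
          refine (norm_add_le _ _).trans ?_
          gcongr
          refine (norm_add_le _ _).trans ?_
          gcongr
          refine (norm_add_le _ _).trans ?_
          gcongr
          exact norm_add_le _ _
      _ ≤ _ := by linarith
  rw [hE]
  have h1 := norm_add_le a (3*(p:ℂ)*s + 3*p*t + s^2 + s*t + t^2)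
  have h2 := norm_sub_norm_le a (-(3*(p:ℂ)*s + 3*p*t + s^2 + s*t + t^2))
  rw [norm_neg, sub_neg_eq_add] at h2
  constructor <;> linarith

/-- Connected sets: existence of points at prescribed distance. -/
lemma exists_pt_at_dist {K : Set ℂ} (hK : IsPreconnected K) {s t : ℂ} (hs : s ∈ K) (ht : t ∈ K)
    {d : ℝ} (hd0 : 0 ≤ d) (hd : d ≤ ‖t - s‖) : ∃ t' ∈ K, ‖t' - s‖ = d := by
  have h := hK.intermediate_value hs ht (f := fun z => ‖z - s‖) (by fun_prop)
  have : d ∈ Icc (‖s - s‖) (‖t - s‖) := by simp [hd0, hd]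
  obtain ⟨t', h1, h2⟩ := h this
  exact ⟨t', h1, h2⟩

/-- Preimages of small connected sets are small (cubic). -/
lemma FC_small (c q : ℝ) (hc : 0 < c) (hc' : c ≤ 1) (hq : 3*q^2 = 1 - c) {K : Set ℂ} (hK : IsPreconnected K)
    (e : ℝ) (h : ∀ u ∈ K, ∀ u' ∈ K, ‖FC c u - FC c u'‖ ≤ e)
    (u u' : ℂ) (hu : u ∈ K) (hu' : u' ∈ K) : ‖u - u'‖^3 ≤ 512 * e := by
  set l := ‖u - u'‖ with hl
  have hl0 : 0 ≤ l := norm_nonneg _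
  -- roots of the quadratic
  obtain ⟨D, hD⟩ : ∃ D : ℂ, D^2 = 12*(q:ℂ)^2 - 3*u'^2 := IsSquare.exists_sq _ (by
    obtain ⟨z, hz⟩ := IsAlgClosed.exists_pow_nat_eq (12*(q:ℂ)^2 - 3*u'^2) (n := 2) (by norm_num)
    exact ⟨z, by rw [← hz]; ring⟩) |>.imp fun _ h => h.symm
  set r1 := (-u' + D)/2
  set r2 := (-u' - D)/2
  have hfac : ∀ z : ℂ, z^2 + z*u' + u'^2 - 3*(q:ℂ)^2 = (z - r1)*(z - r2) := by
    intro z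
    simp only [r1, r2]
    linear_combination (1/4)*hD
  have key : ∃ d, 0 ≤ d ∧ d ≤ l ∧ l/8 ≤ d ∧ l/8 ≤ |d - ‖r1 - u'‖| ∧ l/8 ≤ |d - ‖r2 - u'‖| := by
    by_contra hcon
    push Not at hcon
    have a1 := hcon (l/3) (by positivity) (by linarith) (by linarith)
    have a2 := hcon (2*l/3) (by positivity) (by linarith) (by linarith)
    have a3 := hcon l (by positivity) (by linarith) (by linarith)
    have hlpos : 0 < l := by
      by_contra h0
      have h0 : l = 0 := le_antisymm (not_lt.1 h0) hl0
      have := a1 (by rw [h0]; simp)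
      rw [h0] at this
      simp at this
      exact absurd (norm_nonneg (r2 - u')) (not_le.2 this)
    generalize ‖r1 - u'‖ = A at *
    generalize ‖r2 - u'‖ = B at *
    have b : ∀ d, (l/8 ≤ |d - A| → |d - B| < l/8) → (A - l/8 < d ∧ d < A + l/8) ∨ (B - l/8 < d ∧ d < B + l/8) := by
      intro d hd
      by_cases h' : l/8 ≤ |d - A|
      · right; have := abs_lt.1 (hd h'); constructor <;> linarith
      · left; have := abs_lt.1 (not_le.1 h'); constructor <;> linarith
    rcases b _ a1 with h1 | h1 <;> rcases b _ a2 with h2 | h2 <;> rcases b _ a3 with h3 | h3 <;>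
      linarith [h1.1, h1.2, h2.1, h2.2, h3.1, h3.2]
  obtain ⟨d, hd0, hdl, h1, h2, h3⟩ := key
  obtain ⟨t, htK, ht⟩ := exists_pt_at_dist hK hu' hu hd0 hdl
  have hh := h t htK u' hu'
  rw [FC_sub_norm c q hc hq, hfac, norm_mul, ht] at hh
  have n1 : l/8 ≤ ‖t - r1‖ := by
    refine h2.trans ?_
    have := abs_norm_sub_norm_le (t - u') (r1 - u')
    rw [ht] at this
    simpa using this
  have n2 : l/8 ≤ ‖t - r2‖ := by
    refine h3.trans ?_
    have := abs_norm_sub_norm_le (t - u') (r2 - u')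
    rw [ht] at this
    simpa using this
  have hl8 : 0 ≤ l/8 := by positivity
  have : l/8*((l/8)*(l/8)) ≤ d * (‖t - r1‖ * ‖t - r2‖) := by gcongr
  have h4 : d * (‖t - r1‖ * ‖t - r2‖) ≤ e*c := by
    rwa [div_le_iff₀ hc] at hh
  have he : 0 ≤ e := (norm_nonneg _).trans (h u hu u hu)
  nlinarith

/-- Preimages of small connected sets are small (quadratic). -/
lemma sq_small {K : Set ℂ} (hK : IsPreconnected K)
    (e : ℝ) (h : ∀ u ∈ K, ∀ u' ∈ K, ‖u^2 - u'^2‖ ≤ e)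
    (u u' : ℂ) (hu : u ∈ K) (hu' : u' ∈ K) : ‖u - u'‖^2 ≤ 64 * e := by
  set l := ‖u - u'‖ with hl
  have hl0 : 0 ≤ l := norm_nonneg _
  have key : ∃ d, 0 ≤ d ∧ d ≤ l ∧ l/8 ≤ d ∧ l/8 ≤ |d - ‖-u' - u'‖| := by
    by_cases h1 : l/8 ≤ |l/2 - ‖-u' - u'‖|
    · exact ⟨l/2, by positivity, by linarith, by linarith, h1⟩
    · refine ⟨l, hl0, le_rfl, by linarith, ?_⟩
      have := abs_lt.1 (not_le.1 h1)
      rw [abs_of_nonneg (by linarith)]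
      linarith
  obtain ⟨d, hd0, hdl, h1, h2⟩ := key
  obtain ⟨t, htK, ht⟩ := exists_pt_at_dist hK hu' hu hd0 hdl
  have hh := h t htK u' hu'
  rw [show t^2 - u'^2 = (t - u')*(t - -u') by ring, norm_mul, ht] at hh
  have n1 : l/8 ≤ ‖t - -u'‖ := by
    refine h2.trans ?_
    have := abs_norm_sub_norm_le (t - u') (-u' - u')
    rw [ht] at this
    simpa using this
  have hl8 : 0 ≤ l/8 := by positivity
  have : l/8*(l/8) ≤ d * ‖t - -u'‖ := by gcongr
  nlinarith

structure Setup (c q : ℝ) (v A : ℕ → ℝ) : Prop where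
  hc1 : 1/4 ≤ c
  hc2 : c ≤ 1/4 + 1/10^23
  hq : 3*q^2 = 1 - c
  hq0 : 0 < q
  v0 : v 0 = 2*q^3/c
  vs : ∀ n, v (n+1) = ((v n)^3 - (1-c)*v n)/c
  hv : ∀ n, |v n| ≤ 1
  A0 : A 0 = 1/(8*10^11)
  Apos : ∀ n, 0 < A n
  As : ∀ n, A (n+1) * (3*|(v n)^2 - q^2|/c) = 6/5 * A n
  hA : ∀ n, 8 * A n ≤ (|(v n)^2 - q^2|/1000)^3

def PP (v A : ℕ → ℝ) (K : Set ℂ) (M : ℝ) : Prop :=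
  (∀ y : ℝ, (∀ u ∈ K, ‖u^2 - 1‖ ≤ y) → ∀ u ∈ K, ∀ u' ∈ K, ‖u - u'‖^4 ≤ M * y^3) ∧
  (∀ n, ∀ p : ℝ, (p = v n ∨ p = - v n) → ∀ x : ℝ, (∀ u ∈ K, ‖u - p‖ ≤ x) →
    ∀ u ∈ K, ∀ u' ∈ K, ‖u - u'‖^4 * A n ≤ M * x^3)

lemma Setup.q_bounds {c q : ℝ} {v A : ℕ → ℝ} (S : Setup c q v A) :
    0.49 ≤ q ∧ q ≤ 0.5 ∧ q^2 ≤ 1/4 ∧ 1/4 - 1/10^23 ≤ q^2 := by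
  have h1 := S.hc1
  have h2 := S.hc2
  have h3 := S.hq
  have h4 := S.hq0
  refine ⟨?_, ?_, ?_, ?_⟩
  · norm_num at *; nlinarith
  · norm_num at *; nlinarith
  · linarith
  · linarith

lemma FC_real (c x : ℝ) : FC c (x:ℂ) = (((x^3 - (1-c)*x)/c : ℝ) : ℂ) := by
  unfold FC; push_cast; ring

lemma stepA {c q : ℝ} {v A : ℕ → ℝ} (S : Setup c q v A) (K : Set ℂ) (M : ℝ) (hM : 0 ≤ M)
    (h : PP v A (FC c '' K) M) (n : ℕ) (p : ℝ) (hp : p = v n ∨ p = - v n) (x : ℝ)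
    (hx : ∀ u ∈ K, ‖u - p‖ ≤ x) (hxs : x ≤ |p^2 - q^2|/1000)
    (u u' : ℂ) (hu : u ∈ K) (hu' : u' ∈ K) : ‖u - u'‖^4 * A n ≤ M/1.1 * x^3 := by
  have hc : 0 < c := by linarith [S.hc1]
  have hp2 : p^2 = (v n)^2 := by rcases hp with rfl | rfl <;> ring
  have hp1 : |p| ≤ 1 := by
    rcases hp with rfl | rfl
    · exact S.hv n
    · rw [abs_neg]; exact S.hv n
  obtain ⟨q1, q2, q3, q4⟩ := S.q_bounds
  have hpq : |p^2 - q^2| ≤ 1 := by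
    have := (sq_le_one_iff_abs_le_one p).2 hp1
    rw [abs_le]; constructor <;> nlinarith
  have hx0 : 0 ≤ x := (norm_nonneg _).trans (hx u hu)
  set L := 3*|p^2 - q^2|/c with hL
  have hpp : 0 < |p^2 - q^2| := by
    have h1 := S.hA n
    have h2 := S.Apos n
    rw [← hp2] at h1
    by_contra hcon
    have : |p^2-q^2| = 0 := le_antisymm (not_lt.1 hcon) (abs_nonneg _)
    rw [this] at h1
    norm_num at h1
    linarith
  have hLpos : 0 < L := by positivity
  -- image ball
  have hpn : ‖(p:ℂ) - p‖ ≤ x := by simpa using hx0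
  have hFp : ∃ p' : ℝ, (p' = v (n+1) ∨ p' = - v (n+1)) ∧ FC c p = p' := by
    refine ⟨_, ?_, FC_real c p⟩
    rcases hp with rfl | rfl
    · left; rw [S.vs]
    · right; rw [S.vs]; ring
  obtain ⟨p', hp', hFp'⟩ := hFp
  have hball : ∀ z ∈ FC c '' K, ‖z - p'‖ ≤ 1.01 * L * x := by
    rintro _ ⟨z, hz, rfl⟩
    rw [← hFp', FC_sub_norm c q hc S.hq]
    have := (twopt_near p q x hp1 hxs hpq z p (hx z hz) hpn).1
    rw [hL, div_le_iff₀ hc]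
    calc _ ≤ x * (1.01*(3*|p^2-q^2|)) := by
          gcongr
          exact hx z hz
      _ = _ := by field_simp
  have h2 := h.2 (n+1) p' hp' _ hball _ (mem_image_of_mem _ hu) _ (mem_image_of_mem _ hu')
  have hlow : 0.99 * L * ‖u - u'‖ ≤ ‖FC c u - FC c u'‖ := by
    rw [FC_sub_norm c q hc S.hq]
    have := (twopt_near p q x hp1 hxs hpq u u' (hx u hu) (hx u' hu')).2
    rw [hL, le_div_iff₀ hc]
    calc _ = ‖u-u'‖ * (0.99*(3*|p^2-q^2|)) := by field_simp
      _ ≤ _ := by gcongr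
  have hA' := S.As n
  rw [← hp2, ← hL] at hA'
  have hd : 0 ≤ ‖u - u'‖ := norm_nonneg _
  have h3 : (0.99 * L * ‖u - u'‖)^4 * A (n+1) ≤ M * (1.01*L*x)^3 := by
    refine le_trans ?_ h2
    have := (S.Apos (n+1)).le
    gcongr
  have h4 : L^3 * (0.99^4 * 1.2 * (‖u - u'‖^4 * A n)) ≤ L^3 * (1.01^3 * (M * x^3)) := by
    have e1 : (0.99 * L * ‖u - u'‖)^4 * A (n+1) = 0.99^4 * L^3 * ‖u-u'‖^4 * (A (n+1) * L) := by ring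
    rw [e1, hA'] at h3
    nlinarith [h3]
  have h5 := le_of_mul_le_mul_left h4 (by positivity)
  have h6 : 0 ≤ M * x^3 := by positivity
  norm_num at h5 ⊢
  nlinarith

lemma one_sub_FC_sq (c : ℝ) (hc : c ≠ 0) (u : ℂ) :
    (FC c u)^2 - 1 = (u^2 - 1) * (((u^2 - 1/4 + ((c - 1/4 : ℝ):ℂ))^2 + ((c-1/4 : ℝ):ℂ)) / c^2) := by
  have : (c:ℂ) ≠ 0 := by exact_mod_cast hc
  unfold FC
  push_cast
  field_simp
  ring

lemma stepB1 {c q : ℝ} {v A : ℕ → ℝ} (S : Setup c q v A) (K : Set ℂ) (M : ℝ) (hM : 0 ≤ M)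
    (hD : ∀ u ∈ K, ‖u^2 - 1/4‖ ≤ 1) (hd : ∀ u ∈ K, ∀ u' ∈ K, ‖u - u'‖ ≤ 1/10^13)
    (h : PP v A (FC c '' K) M) (y : ℝ) (hy : ∀ u ∈ K, ‖u^2 - 1‖ ≤ y)
    (u1 : ℂ) (hu1 : u1 ∈ K) (hfar : 1/10^10 ≤ ‖u1^2 - q^2‖)
    (u u' : ℂ) (hu : u ∈ K) (hu' : u' ∈ K) : ‖u - u'‖^4 ≤ M/1.1 * y^3 := by
  have hc : 0 < c := by linarith [S.hc1]
  have hc1 := S.hc1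
  have hc2 := S.hc2
  obtain ⟨q1, q2, q3, q4⟩ := S.q_bounds
  have hy0 : 0 ≤ y := (norm_nonneg _).trans (hy u hu)
  set t := ‖u1^2 - 1/4‖ with ht
  have ht1 : t ≤ 1 := hD u1 hu1
  have hqq : ‖(1/4 : ℂ) - (q:ℂ)^2‖ ≤ 1/10^23 := by
    rw [show (1/4 : ℂ) - (q:ℂ)^2 = ((1/4 - q^2 : ℝ) : ℂ) by push_cast; ring, Complex.norm_real,
      Real.norm_eq_abs, abs_le]
    constructor <;> linarith
  have ht2 : 0.99/10^10 ≤ t := by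
    have : ‖u1^2 - (q:ℂ)^2‖ ≤ t + ‖(1/4 : ℂ) - (q:ℂ)^2‖ := by
      rw [ht]; refine le_trans (le_of_eq ?_) (norm_add_le _ _); congr 1; ring
    norm_num at *
    linarith
  have hu1n : ‖u1‖ ≤ 1.2 := by
    have : ‖u1^2‖ ≤ t + ‖(1/4:ℂ)‖ := by
      rw [ht]; refine le_trans (le_of_eq ?_) (norm_add_le _ _); congr 1; ring
    rw [norm_pow] at this
    norm_num at this ⊢
    nlinarith [norm_nonneg u1]
  -- two-point lower bound
  have hlow : 11 * t * ‖u - u'‖ ≤ ‖FC c u - FC c u'‖ := by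
    rw [FC_sub_norm c q hc S.hq, le_div_iff₀ hc]
    suffices hT : 2.98 * t ≤ ‖u^2 + u*u' + u'^2 - 3*(q:ℂ)^2‖ by
      calc 11 * t * ‖u-u'‖ * c = ‖u-u'‖ * (11 * c * t) := by ring
        _ ≤ ‖u-u'‖ * (2.98 * t) := by
          gcongr; norm_num at *; linarith
        _ ≤ _ := by gcongr
    have hs := hd u hu u1 hu1
    have hs' := hd u' hu' u1 hu1
    obtain ⟨s, hs1⟩ : ∃ s, u = u1 + s := ⟨u - u1, by ring⟩
    obtain ⟨s', hs1'⟩ : ∃ s, u' = u1 + s := ⟨u' - u1, by ring⟩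
    rw [hs1] at hs ⊢
    rw [hs1'] at hs' ⊢
    rw [add_sub_cancel_left] at hs hs'
    have e : 3*(u1^2 - 1/4) = ((u1+s)^2 + (u1+s)*(u1+s') + (u1+s')^2 - 3*(q:ℂ)^2)
        - (3*(1/4 - (q:ℂ)^2) + (3*u1*(s+s') + (s^2 + s*s' + s'^2))) := by ring
    have n1 : ‖3*(u1^2 - 1/4)‖ = 3*t := by rw [norm_mul, ht]; norm_num
    have n2 : ‖3*(1/4 - (q:ℂ)^2)‖ ≤ 3/10^23 := by rw [norm_mul]; norm_num at *; linarith
    have n3 : ‖s + s'‖ ≤ 2/10^13 := (norm_add_le _ _).trans (by linarith)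
    have n4 : ‖3*u1*(s+s')‖ ≤ 7.2/10^13 := by
      rw [norm_mul, norm_mul]
      calc _ ≤ 3 * 1.2 * (2/10^13 : ℝ) := by
            gcongr; norm_num
        _ ≤ _ := by norm_num
    have n5 : ‖s^2 + s*s' + s'^2‖ ≤ 3/10^26 := by
      refine (norm_add_le _ _).trans ?_
      have a1 := norm_add_le (s^2) (s*s')
      have a2 : ‖s^2‖ ≤ (1/10^13)*(1/10^13) := by rw [norm_pow, sq]; gcongr
      have a3 : ‖s*s'‖ ≤ (1/10^13)*(1/10^13) := by rw [norm_mul]; gcongr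
      have a4 : ‖s'^2‖ ≤ (1/10^13)*(1/10^13) := by rw [norm_pow, sq]; gcongr
      norm_num at *
      linarith
    have n6 := norm_sub_le ((u1+s)^2 + (u1+s)*(u1+s') + (u1+s')^2 - 3*(q:ℂ)^2)
        (3*(1/4 - (q:ℂ)^2) + (3*u1*(s+s') + (s^2 + s*s' + s'^2)))
    rw [← e, n1] at n6
    have n7 := norm_add_le (3*(1/4 - (q:ℂ)^2)) (3*u1*(s+s') + (s^2 + s*s' + s'^2))
    have n8 := norm_add_le (3*u1*(s+s')) (s^2 + s*s' + s'^2)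
    generalize ‖(u1+s)^2 + (u1+s)*(u1+s') + (u1+s')^2 - 3*(q:ℂ)^2‖ = T at *
    norm_num at *
    linarith
  have hup : ∀ z ∈ FC c '' K, ‖z^2 - 1‖ ≤ 17 * t^2 * y := by
    rintro _ ⟨z, hz, rfl⟩
    rw [one_sub_FC_sq c hc.ne', norm_mul, norm_div]
    have he : ‖((c - 1/4 : ℝ):ℂ)‖ ≤ 1/10^23 := by
      rw [Complex.norm_real, Real.norm_eq_abs, abs_le]; constructor <;> linarith
    have m1 : ‖z^2 - 1/4 + ((c - 1/4 : ℝ):ℂ)‖ ≤ 1.01 * t := by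
      have hs := hd z hz u1 hu1
      obtain ⟨s, hs1⟩ : ∃ s, z = u1 + s := ⟨z - u1, by ring⟩
      rw [hs1] at hs ⊢
      rw [add_sub_cancel_left] at hs
      have e : (u1+s)^2 - 1/4 + ((c - 1/4 : ℝ):ℂ) = (u1^2 - 1/4) + (s*(2*u1 + s) + ((c - 1/4 : ℝ):ℂ)) := by ring
      have b1 : ‖2*u1 + s‖ ≤ 2.5 := by
        refine (norm_add_le _ _).trans ?_
        rw [norm_mul]; norm_num at *; linarith
      have b2 : ‖s*(2*u1+s)‖ ≤ 1/10^13 * 2.5 := by rw [norm_mul]; gcongr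
      rw [e]
      have b3 := norm_add_le (u1^2 - 1/4) (s*(2*u1 + s) + ((c - 1/4 : ℝ):ℂ))
      have b4 := norm_add_le (s*(2*u1 + s)) ((c - 1/4 : ℝ):ℂ)
      generalize ‖u1 ^ 2 - 1 / 4 + (s * (2 * u1 + s) + ((c - 1/4 : ℝ):ℂ))‖ = T at *
      generalize ‖s * (2 * u1 + s) + ((c - 1/4 : ℝ):ℂ)‖ = T' at *
      generalize ‖((c - 1/4 : ℝ):ℂ)‖ = T'' at *
      rw [← ht] at b3
      norm_num at *
      linarith
    have m2 : ‖(z^2 - 1/4 + ((c - 1/4 : ℝ):ℂ))^2 + ((c-1/4 : ℝ):ℂ)‖ ≤ 1.04 * t^2 := by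
      refine (norm_add_le _ _).trans ?_
      rw [norm_pow]
      have : ‖z^2 - 1/4 + ((c - 1/4 : ℝ):ℂ)‖^2 ≤ (1.01*t)^2 := by gcongr
      have ht22 : (0.99/10^10)^2 ≤ t^2 := by gcongr
      generalize ‖z^2 - 1/4 + ((c - 1/4 : ℝ):ℂ)‖^2 = T at *
      generalize ‖((c - 1/4 : ℝ):ℂ)‖ = T' at *
      norm_num at *
      nlinarith
    have m3 : ‖(c:ℂ)^2‖ = c^2 := by rw [norm_pow, Complex.norm_real, Real.norm_of_nonneg hc.le]
    rw [m3]
    have m4 : ‖(z^2 - 1/4 + ((c - 1/4 : ℝ):ℂ))^2 + ((c-1/4 : ℝ):ℂ)‖ / c^2 ≤ 17*t^2 := by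
      rw [div_le_iff₀ (by positivity)]
      refine m2.trans ?_
      have : (1/16:ℝ) ≤ c^2 := by nlinarith
      nlinarith [sq_nonneg t]
    calc _ ≤ y * (17*t^2) := by
          gcongr
          exact hy z hz
      _ = _ := by ring
  have h1 := h.1 _ hup _ (mem_image_of_mem _ hu) _ (mem_image_of_mem _ hu')
  have htpos : 0 < t := lt_of_lt_of_le (by norm_num) ht2
  have h3 : (11 * t * ‖u - u'‖)^4 ≤ M * (17*t^2*y)^3 := by
    refine le_trans ?_ h1
    gcongr
  have h4 : t^4 * (11^4 * ‖u - u'‖^4) ≤ t^4 * (17^3 * t^2 * (M * y^3)) := by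
    nlinarith [h3]
  have h5 := le_of_mul_le_mul_left h4 (by positivity)
  have h6 : 0 ≤ M * y^3 := by positivity
  have h7 : t^2 ≤ 1 := by nlinarith
  norm_num at h5 ⊢
  nlinarith

lemma FC_crit (c q p : ℝ) (hc : 0 < c) (hq : 3*q^2 = 1 - c) (hp : p^2 = q^2) (u : ℂ) :
    ‖FC c u - FC c p‖ = ‖u - p‖^2 * ‖u + 2*p‖ / c := by
  rw [FC_sub_norm c q hc hq]
  have h : (p:ℂ)^2 = (q:ℂ)^2 := by exact_mod_cast congrArg (fun t : ℝ => (t:ℂ)) hp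
  rw [show u^2 + u*p + (p:ℂ)^2 - 3*(q:ℂ)^2 = (u - p)*(u + 2*p) by rw [← h]; ring, norm_mul]
  ring

lemma two_pt_crit (c q p : ℝ) (hc : 0 < c) (hc' : c ≤ 0.26) (hq : 3*q^2 = 1 - c) (hp : p^2 = q^2)
    (hq1 : 0.49 ≤ |p|) (a b : ℝ) (ha0 : 0 < a) (ha : a ≤ 1/10^9) (hb : a/4 ≤ b)
    (s t : ℂ) (hs : ‖s - p‖ ≤ 2*a) (ht : ‖t - p‖ ≤ 2*a) (hst : b ≤ ‖(s - p) + (t - p)‖) :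
    ‖s - t‖ * (5*b) ≤ ‖FC c s - FC c t‖ := by
  rw [FC_sub_norm c q hc hq, le_div_iff₀ hc]
  have h : (p:ℂ)^2 = (q:ℂ)^2 := by exact_mod_cast congrArg (fun t : ℝ => (t:ℂ)) hp
  obtain ⟨x, rfl⟩ : ∃ x, s = p + x := ⟨s - p, by ring⟩
  obtain ⟨y, rfl⟩ : ∃ x, t = p + x := ⟨t - p, by ring⟩
  simp only [add_sub_cancel_left] at hs ht hst
  have e : 3*(p:ℂ)*(x+y) = (((p:ℂ)+x)^2 + (p+x)*(p+y) + (p+y)^2 - 3*(q:ℂ)^2) - (x^2 + x*y + y^2) := by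
    rw [← h]; ring
  have n1 : 3*0.49*b ≤ ‖3*(p:ℂ)*(x+y)‖ := by
    rw [norm_mul, norm_mul, Complex.norm_real, Real.norm_eq_abs]
    have hb0 : 0 ≤ b := by linarith
    have : ‖(3:ℂ)‖ = 3 := by norm_num
    rw [this]
    gcongr
  have n2 : ‖x^2 + x*y + y^2‖ ≤ 12*a^2 := by
    have a1 := norm_add_le (x^2 + x*y) (y^2)
    have a0 := norm_add_le (x^2) (x*y)
    have a2 : ‖x^2‖ ≤ (2*a)*(2*a) := by rw [norm_pow, sq]; gcongr
    have a3 : ‖x*y‖ ≤ (2*a)*(2*a) := by rw [norm_mul]; gcongr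
    have a4 : ‖y^2‖ ≤ (2*a)*(2*a) := by rw [norm_pow, sq]; gcongr
    nlinarith
  have n3 := norm_sub_le (((p:ℂ)+x)^2 + (p+x)*(p+y) + (p+y)^2 - 3*(q:ℂ)^2) (x^2 + x*y + y^2)
  rw [← e] at n3
  have n4 : 12*a^2 ≤ 0.01 * b := by
    norm_num at *
    nlinarith
  have n5 : 5*b*c ≤ ‖((p:ℂ)+x)^2 + (p+x)*(p+y) + (p+y)^2 - 3*(q:ℂ)^2‖ := by
    norm_num at *
    nlinarith
  calc _ = ‖((p:ℂ)+x) - (p+y)‖ * (5*b*c) := by ring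
    _ ≤ _ := by gcongr

lemma stepB2 {c q : ℝ} {v A : ℕ → ℝ} (S : Setup c q v A) (K : Set ℂ) (hK : IsPreconnected K) (M : ℝ) (hM : 0 ≤ M)
    (hd : ∀ u ∈ K, ∀ u' ∈ K, ‖u - u'‖ ≤ 1/10^13)
    (h : PP v A (FC c '' K) M) (y : ℝ) (hy : ∀ u ∈ K, ‖u^2 - 1‖ ≤ y)
    (hnear : ∀ u ∈ K, ‖u^2 - q^2‖ < 1/10^10)
    (u u' : ℂ) (hu : u ∈ K) (hu' : u' ∈ K) : ‖u - u'‖^4 ≤ M/1.1 * y^3 := by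
  have hc : 0 < c := by linarith [S.hc1]
  have hc1 := S.hc1
  have hc2 := S.hc2
  have hc3 : c ≤ 0.26 := by norm_num at *; linarith
  obtain ⟨q1, q2, q3, q4⟩ := S.q_bounds
  have hy1 : 1/2 ≤ y := by
    have := hy u hu
    have h2 := hnear u hu
    have h3 : ‖(1 - (q:ℂ)^2)‖ ≤ ‖u^2 - (q:ℂ)^2‖ + ‖u^2 - 1‖ := by
      rw [show 1 - (q:ℂ)^2 = (u^2 - (q:ℂ)^2) - (u^2 - 1) by ring]
      exact norm_sub_le _ _
    rw [show 1 - (q:ℂ)^2 = ((1 - q^2 : ℝ) : ℂ) by push_cast; ring, Complex.norm_real, Real.norm_eq_abs,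
      abs_of_nonneg (by linarith)] at h3
    norm_num at *
    linarith
  have hpex : ∃ p : ℝ, (p = q ∨ p = -q) ∧ ∀ z ∈ K, ‖z - p‖ ≤ 3/10^10 := by
    have hprod : ‖u - q‖ * ‖u + q‖ < 1/10^10 := by
      rw [← norm_mul, show (u - q)*(u + q) = u^2 - (q:ℂ)^2 by ring]; exact hnear u hu
    have hsum : 0.98 ≤ ‖u - q‖ + ‖u + q‖ := by
      have : ‖(2*q : ℂ)‖ ≤ ‖u - q‖ + ‖u + q‖ := by
        rw [show (2*q : ℂ) = -(u - q) + (u + q) by ring, ← norm_neg (u - q)]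
        exact norm_add_le _ _
      rw [norm_mul, Complex.norm_real, Real.norm_of_nonneg S.hq0.le] at this
      norm_num at *
      linarith
    have h0 := norm_nonneg (u - q)
    have h0' := norm_nonneg (u + q)
    rcases le_total ‖u - q‖ ‖u + q‖ with hle | hle
    · refine ⟨q, Or.inl rfl, fun z hz => ?_⟩
      have h1 : ‖u - q‖ ≤ 2.1/10^10 := by
        have : 0.49 ≤ ‖u+q‖ := by norm_num at *; linarith
        norm_num at *
        nlinarith
      have h2 := norm_add_le (z - u) (u - q)
      have h3 := hd z hz u hu
      rw [sub_add_sub_cancel] at h2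
      norm_num at *
      linarith
    · refine ⟨-q, Or.inr rfl, fun z hz => ?_⟩
      have h1 : ‖u + q‖ ≤ 2.1/10^10 := by
        have : 0.49 ≤ ‖u-q‖ := by norm_num at *; linarith
        norm_num at *
        nlinarith
      have h2 := norm_add_le (z - u) (u + q)
      have h3 := hd z hz u hu
      rw [show z - u + (u + (q:ℂ)) = z + q by ring] at h2
      push_cast
      rw [sub_neg_eq_add]
      norm_num at *
      linarith
  obtain ⟨p, hp, hpK⟩ := hpex
  have hp2 : p^2 = q^2 := by rcases hp with rfl | rfl <;> ring
  have hpabs : |p| = q := by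
    rcases hp with rfl | rfl
    · exact abs_of_pos S.hq0
    · rw [abs_neg]; exact abs_of_pos S.hq0
  have hMy : 0 ≤ M * y^3 := by positivity
  -- almost farthest point
  by_cases hall : ∀ z ∈ K, z = p
  · rw [hall u hu, hall u' hu']; simp; norm_num; nlinarith
  push Not at hall
  obtain ⟨z0, hz0, hz0p⟩ := hall
  have hsex : ∃ s ∈ K, 0 < ‖s - p‖ ∧ ∀ z ∈ K, ‖z - p‖ ≤ 2*‖s - p‖ := by
    set I := (fun z : ℂ => ‖z - p‖) '' K
    have hbd : BddAbove I := ⟨3/10^10, by rintro _ ⟨z, hz, rfl⟩; exact hpK z hz⟩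
    have hpos : 0 < sSup I := lt_of_lt_of_le (norm_pos_iff.2 (sub_ne_zero.2 hz0p)) (le_csSup hbd ⟨z0, hz0, rfl⟩)
    obtain ⟨_, ⟨s, hs, rfl⟩, hs2⟩ := exists_lt_of_lt_csSup (s := I) ⟨_, mem_image_of_mem _ hz0⟩ (half_lt_self hpos)
    simp only at hs2
    refine ⟨s, hs, by linarith, fun z hz => ?_⟩
    have := le_csSup hbd ⟨z, hz, rfl⟩
    simp only at this
    linarith
  obtain ⟨s, hs, hspos, hsK⟩ := hsex
  set a := ‖s - p‖ with ha
  have ha1 : a ≤ 3/10^10 := hpK s hs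
  have ha2 : a ≤ 1/10^9 := by norm_num at *; linarith
  set l := ‖u - u'‖ with hl
  have hl0 : 0 ≤ l := norm_nonneg _
  have hl4 : l ≤ 4*a := by
    have h1 := hsK u hu
    have h2 := hsK u' hu'
    have := norm_sub_le (u - p) (u' - p)
    rw [sub_sub_sub_cancel_right] at this
    linarith
  have hpair : ∃ z ∈ K, ∃ z' ∈ K, l*a/2 ≤ ‖FC c z - FC c z'‖ := by
    have : ∃ t ∈ K, l/2 ≤ ‖s - t‖ := by
      by_contra hcon
      push Not at hcon
      have h1 := hcon u hu
      have h2 := hcon u' hu'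
      have := norm_sub_le (s - u') (s - u)
      rw [sub_sub_sub_cancel_left] at this
      linarith
    obtain ⟨t, ht, htl⟩ := this
    by_cases hcase : a/4 ≤ ‖(s - p) + (t - p)‖
    · refine ⟨s, hs, t, ht, ?_⟩
      have := two_pt_crit c q p hc hc3 S.hq hp2 (by rw [hpabs]; exact q1) a (a/4) hspos ha2 le_rfl s t
        (hsK s hs) (hsK t ht) hcase
      nlinarith
    · push Not at hcase
      have hts : a/2 ≤ ‖t - s‖ := by
        have h1 : ‖2*(s - p)‖ ≤ ‖(s-p)+(t-p)‖ + ‖t - s‖ := by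
          rw [show 2*(s - (p:ℂ)) = ((s-p)+(t-p)) - (t - s) by ring]
          exact norm_sub_le _ _
        rw [norm_mul, ← ha] at h1
        norm_num at h1
        linarith
      obtain ⟨t', ht', htd⟩ := exists_pt_at_dist hK hs ht (by positivity) hts
      refine ⟨s, hs, t', ht', ?_⟩
      have hb : a ≤ ‖(s - p) + (t' - p)‖ := by
        have h1 : ‖2*(s - p)‖ ≤ ‖(s-p)+(t'-p)‖ + ‖t' - s‖ := by
          rw [show 2*(s - (p:ℂ)) = ((s-p)+(t'-p)) - (t' - s) by ring]
          exact norm_sub_le _ _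
        rw [norm_mul, ← ha] at h1
        norm_num at h1
        linarith
      have := two_pt_crit c q p hc hc3 S.hq hp2 (by rw [hpabs]; exact q1) a a hspos ha2 (by linarith) s t'
        (hsK s hs) (hsK t' ht') hb
      rw [norm_sub_rev s t', htd] at this
      nlinarith
  obtain ⟨z, hz, z', hz', hzz⟩ := hpair
  have hFp : ∃ p' : ℝ, (p' = v 0 ∨ p' = - v 0) ∧ FC c p = p' := by
    refine ⟨_, ?_, FC_real c p⟩
    rcases hp with rfl | rfl
    · right; rw [S.v0, ← S.hq]; ring
    · left; rw [S.v0, ← S.hq]; ring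
  obtain ⟨p', hp', hFp'⟩ := hFp
  have hball : ∀ z ∈ FC c '' K, ‖z - p'‖ ≤ 28 * a^2 := by
    rintro _ ⟨z, hz, rfl⟩
    rw [← hFp', FC_crit c q p hc S.hq hp2, div_le_iff₀ hc]
    have h1 := hsK z hz
    have h2 : ‖z + 2*p‖ ≤ 1.6 := by
      have := norm_add_le (z - p) (3*p)
      rw [norm_mul, Complex.norm_real, Real.norm_eq_abs, hpabs, show z - p + 3*(p:ℂ) = z + 2*p by ring] at this
      norm_num at *
      linarith
    calc _ ≤ (2*a)^2 * 1.6 := by gcongr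
      _ ≤ _ := by nlinarith
  have h2 := h.2 0 p' hp' _ hball _ (mem_image_of_mem _ hz) _ (mem_image_of_mem _ hz')
  have h3 : (l*a/2)^4 * A 0 ≤ M * (28*a^2)^3 := by
    refine le_trans ?_ h2
    have := (S.Apos 0).le
    gcongr
  rw [S.A0] at h3
  have h4 : a^4 * l^4 ≤ a^4 * (16*8*10^11*28^3 * a^2 * M) := by
    norm_num at h3 ⊢
    nlinarith
  have h5 := le_of_mul_le_mul_left h4 (by positivity)
  have h6 : a^2 ≤ (3/10^10)^2 := by gcongr
  have h7 : 16*8*10^11*28^3 * a^2 * M ≤ 16*8*10^11*28^3 * (3/10^10)^2 * M := by gcongr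
  have h8 : M/1.1 * (1/2)^3 ≤ M/1.1 * y^3 := by gcongr
  refine h5.trans (h7.trans (le_trans ?_ h8))
  norm_num
  nlinarith

lemma norm_sq_bound {u : ℂ} (hu : ‖u^2 - 1/4‖ ≤ 1) : ‖u‖ ≤ 1.2 ∧ ‖u^2 - 1‖ ≤ 2 := by
  constructor
  · have : ‖u^2‖ ≤ ‖u^2 - 1/4‖ + ‖(1/4:ℂ)‖ := by
      refine le_trans (le_of_eq ?_) (norm_add_le _ _); congr 1; ring
    rw [norm_pow] at this
    norm_num at *
    nlinarith [norm_nonneg u]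
  · have : ‖u^2 - 1‖ ≤ ‖u^2 - 1/4‖ + ‖(3/4:ℂ)‖ := by
      refine le_trans (le_of_eq ?_) (norm_sub_le _ _); congr 1; ring
    norm_num at *
    linarith

lemma onestep {c q : ℝ} {v A : ℕ → ℝ} (S : Setup c q v A) (K : Set ℂ) (hK : IsPreconnected K) (M : ℝ) (hM : 0 ≤ M)
    (hD : ∀ u ∈ K, ‖u^2 - 1/4‖ ≤ 1)
    (hd : ∀ u ∈ K, ∀ u' ∈ K, ‖u - u'‖ ≤ 1/10^13)
    (h : PP v A (FC c '' K) M) : PP v A K (M/1.1) := by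
  have base : ∀ y : ℝ, (∀ u ∈ K, ‖u^2 - 1‖ ≤ y) → ∀ u ∈ K, ∀ u' ∈ K, ‖u - u'‖^4 ≤ M/1.1 * y^3 := by
    intro y hy u hu u' hu'
    by_cases hex : ∃ u1 ∈ K, 1/10^10 ≤ ‖u1^2 - q^2‖
    · obtain ⟨u1, h1, h2⟩ := hex
      exact stepB1 S K M hM hD hd h y hy u1 h1 h2 u u' hu hu'
    · push Not at hex
      exact stepB2 S K hK M hM hd h y hy hex u u' hu hu'
  refine ⟨base, ?_⟩
  intro n p hp x hx u hu u' hu'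
  have hx0 : 0 ≤ x := (norm_nonneg _).trans (hx u hu)
  by_cases hbig : 8 * A n ≤ x^3
  · have h1 := base 2 (fun u hu => (norm_sq_bound (hD u hu)).2) u hu u' hu'
    have h2 : ‖u - u'‖^4 * A n ≤ M/1.1*2^3 * A n := by
      have := (S.Apos n).le
      gcongr
    have h3 : M/1.1 * (8 * A n) ≤ M/1.1 * x^3 := by gcongr
    linarith
  · push Not at hbig
    refine stepA S K M hM h n p hp x hx ?_ u u' hu hu'
    have hp2 : p^2 = (v n)^2 := by rcases hp with rfl | rfl <;> ring
    rw [hp2]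
    have := hbig.trans_le (S.hA n)
    exact (lt_of_pow_lt_pow_left₀ 3 (by positivity) this).le

lemma FC_dom {c : ℝ} (hc1 : 1/4 ≤ c) (hc2 : c ≤ 1/4 + 1/10^23) (u : ℂ) (h : ‖(FC c u)^2 - 1/4‖ ≤ 1) :
    ‖u^2 - 1/4‖ ≤ 1 := by
  have hc : 0 < c := by linarith
  by_contra hcon
  push Not at hcon
  have h1 := (norm_sq_bound h).2
  have he : ‖((c - 1/4 : ℝ):ℂ)‖ ≤ 1/10^23 := by
    rw [Complex.norm_real, Real.norm_eq_abs, abs_le]; constructor <;> linarith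
  rw [one_sub_FC_sq c hc.ne', norm_mul, norm_div] at h1
  have m3 : ‖(c:ℂ)^2‖ = c^2 := by rw [norm_pow, Complex.norm_real, Real.norm_of_nonneg hc.le]
  rw [m3] at h1
  set e := ((c - 1/4 : ℝ):ℂ)
  have a1 : 1/4 ≤ ‖u^2 - 1‖ := by
    have : ‖u^2 - 1/4‖ ≤ ‖u^2 - 1‖ + ‖(3/4:ℂ)‖ := by
      refine le_trans (le_of_eq ?_) (norm_add_le _ _); congr 1; ring
    norm_num at *
    linarith
  have a2 : 0.999 ≤ ‖u^2 - 1/4 + e‖ := by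
    have : ‖u^2 - 1/4‖ ≤ ‖u^2 - 1/4 + e‖ + ‖e‖ := by
      refine le_trans (le_of_eq ?_) (norm_sub_le _ _); congr 1; ring
    norm_num at *
    linarith
  have a3 : 0.99 ≤ ‖(u^2 - 1/4 + e)^2 + e‖ := by
    have : ‖(u^2 - 1/4 + e)^2‖ ≤ ‖(u^2 - 1/4 + e)^2 + e‖ + ‖e‖ := by
      refine le_trans (le_of_eq ?_) (norm_sub_le _ _); congr 1; ring
    rw [norm_pow] at this
    have h2 : (0.999:ℝ)^2 ≤ ‖u^2 - 1/4 + e‖^2 := by gcongr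
    norm_num at *
    linarith
  have a4 : 10 ≤ ‖(u^2 - 1/4 + e)^2 + e‖/c^2 := by
    rw [le_div_iff₀ (by positivity)]
    norm_num at *
    nlinarith
  have : 1/4 * 10 ≤ ‖u^2 - 1‖ * (‖(u^2 - 1/4 + e)^2 + e‖/c^2) := by gcongr
  linarith

lemma esc_base {c q : ℝ} {v A : ℕ → ℝ} (S : Setup c q v A) (x : ℝ) (hx : x ∈ Icc (0:ℝ) 1)
    (K : Set ℂ) (hK : IsPreconnected K) (h : ∀ u ∈ K, ‖1 - u^2 - x‖ < 1/10^172*(1/10^171)) :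
    (∀ u ∈ K, ‖u^2 - 1/4‖ ≤ 1) ∧ PP v A K (8/10^170) := by
  have hdiff : ∀ u ∈ K, ∀ u' ∈ K, ‖u^2 - u'^2‖ ≤ 2*(1/10^172*(1/10^171)) := by
    intro u hu u' hu'
    have := norm_sub_le (1 - u'^2 - x) (1 - u^2 - x)
    rw [show (1 - u'^2 - x) - (1 - u^2 - x) = u^2 - u'^2 by ring] at this
    have h1 := h u hu
    have h2 := h u' hu'
    linarith
  have hd : ∀ u ∈ K, ∀ u' ∈ K, ‖u - u'‖ ≤ 1/10^170 := by
    intro u hu u' hu'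
    have := sq_small hK _ hdiff u u' hu hu'
    refine le_of_sq_le_sq (this.trans ?_) (by positivity)
    norm_num
  have hd8 : ∀ u ∈ K, ∀ u' ∈ K, ∀ y : ℝ, ‖u-u'‖ ≤ 2*y → ‖u-u'‖^4 ≤ 8/10^170 * y^3 := by
    intro u hu u' hu' y hy
    calc ‖u-u'‖^4 = ‖u-u'‖ * ‖u-u'‖^3 := by ring
      _ ≤ 1/10^170 * (2*y)^3 := by
        gcongr
        exact hd u hu u' hu'
      _ = _ := by ring
  refine ⟨?_, ?_, ?_⟩
  · intro u hu
    have h1 := norm_sub_le ((3/4 - x : ℝ):ℂ) (1 - u^2 - x)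
    rw [show ((3/4 - x : ℝ):ℂ) - (1 - u^2 - x) = u^2 - 1/4 by push_cast; ring] at h1
    rw [Complex.norm_real, Real.norm_eq_abs] at h1
    have h2 : |3/4 - x| ≤ 3/4 := by
      rw [abs_le]; constructor <;> linarith [hx.1, hx.2]
    have h3 := h u hu
    norm_num at *
    linarith
  · intro y hy u hu u' hu'
    have hy0 : 0 ≤ y := (norm_nonneg _).trans (hy u hu)
    apply hd8 u hu u' hu'
    have h0 := hd u hu u' hu'
    by_cases hy1 : 1/4 ≤ y
    · norm_num at *
      linarith
    · push Not at hy1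
      have h1 : ‖u^2 - u'^2‖ ≤ 2*y := by
        have := norm_sub_le (u^2-1) (u'^2-1)
        rw [sub_sub_sub_cancel_right] at this
        linarith [hy u hu, hy u' hu']
      have hb : ∀ w ∈ K, 3/4 ≤ ‖w‖^2 := by
        intro w hw
        have h2 := hy w hw
        have := norm_sub_le (w^2) (w^2-1)
        rw [sub_sub_cancel, norm_pow] at this
        norm_num at *
        linarith
      have hpar := parallelogram_law_with_norm ℝ u u'
      have h3 : 1 ≤ ‖u + u'‖ := by
        have a1 := hb u hu
        have a2 := hb u' hu'
        have a3 : ‖u-u'‖ ≤ 1 := h0.trans (by norm_num)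
        have a4 : ‖u-u'‖ * ‖u-u'‖ ≤ 1 := by nlinarith [norm_nonneg (u-u')]
        nlinarith [norm_nonneg (u+u')]
      rw [show u^2-u'^2 = (u-u')*(u+u') by ring, norm_mul] at h1
      nlinarith [norm_nonneg (u-u')]
  · intro n p hp y hy u hu u' hu'
    have hy0 : 0 ≤ y := (norm_nonneg _).trans (hy u hu)
    have h1 : ‖u-u'‖ ≤ 2*y := by
      have := norm_sub_le (u-p) (u'-p)
      rw [sub_sub_sub_cancel_right] at this
      linarith [hy u hu, hy u' hu']
    have h2 := hd8 u hu u' hu' y h1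
    have h3 : A n ≤ 1 := by
      have a1 := S.hA n
      have a2 := S.hv n
      obtain ⟨q1, q2, q3, q4⟩ := S.q_bounds
      have a3 : |v n^2 - q^2| ≤ 1 := by
        have := (sq_le_one_iff_abs_le_one (v n)).2 a2
        rw [abs_le]; constructor <;> nlinarith [sq_nonneg (v n)]
      have a4 : (|v n^2-q^2|/1000)^3 ≤ 1 := by
        apply pow_le_one₀ (by positivity); linarith
      linarith
    have h4 := (S.Apos n).le
    have h5 : 0 ≤ ‖u-u'‖^4 := by positivity
    nlinarith

lemma esc_ind {c q : ℝ} {v A : ℕ → ℝ} (S : Setup c q v A) (x : ℝ) (hx : x ∈ Icc (0:ℝ) 1) (n : ℕ) :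
    ∀ K : Set ℂ, IsPreconnected K → (∀ u ∈ K, ‖1 - ((FC c)^[n] u)^2 - x‖ < 1/10^172*(1/10^171)) →
    (∀ u ∈ K, ‖u^2 - 1/4‖ ≤ 1) ∧ PP v A K (8/10^170/1.1^n) := by
  have hc : 0 < c := by linarith [S.hc1]
  have hc1 : c ≤ 1 := by have := S.hc2; norm_num at *; linarith
  induction n with
  | zero =>
    intro K hK h
    have := esc_base S x hx K hK h
    simpa using this
  | succ n ih =>
    intro K hK h
    have hcont : Continuous (FC c) := by unfold FC; fun_prop
    have hKi : IsPreconnected (FC c '' K) := hK.image _ hcont.continuousOn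
    obtain ⟨h1, h2⟩ := ih (FC c '' K) hKi (by rintro _ ⟨u, hu, rfl⟩; exact h u hu)
    have hD : ∀ u ∈ K, ‖u^2 - 1/4‖ ≤ 1 := fun u hu => FC_dom S.hc1 S.hc2 u (h1 _ (mem_image_of_mem _ hu))
    refine ⟨hD, ?_⟩
    have hpow : (1:ℝ) ≤ 1.1^n := one_le_pow₀ (by norm_num)
    have hsm : ∀ u ∈ K, ∀ u' ∈ K, ‖FC c u - FC c u'‖ ≤ 1/10^42 := by
      intro u hu u' hu'
      have := h2.1 2 (fun z hz => (norm_sq_bound (h1 z hz)).2) _ (mem_image_of_mem _ hu) _ (mem_image_of_mem _ hu')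
      have h3 : 8/10^170/1.1^n * 2^3 ≤ (1/10^42 : ℝ)^4 := by
        have : (8:ℝ)/10^170/1.1^n ≤ 8/10^170 := div_le_self (by positivity) hpow
        calc _ ≤ (8:ℝ)/10^170*2^3 := by gcongr
          _ ≤ _ := by norm_num
      exact le_of_pow_le_pow_left₀ (by norm_num) (by positivity) (this.trans h3)
    have hd : ∀ u ∈ K, ∀ u' ∈ K, ‖u - u'‖ ≤ 1/10^13 := by
      intro u hu u' hu'
      have := FC_small c q hc hc1 S.hq hK _ hsm u u' hu hu'
      refine le_of_pow_le_pow_left₀ (n := 3) (by norm_num) (by positivity) (this.trans ?_)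
      norm_num
    have := onestep S K hK _ (by positivity) hD hd h2
    have e : (8/10^170/1.1^(n+1) : ℝ) = 8/10^170/1.1^n/1.1 := by rw [pow_succ (1.1:ℝ) n, ← div_div]
    rw [e]
    exact this

lemma esc_F {c q : ℝ} {v A : ℕ → ℝ} (S : Setup c q v A) (x : ℝ) (hx : x ∈ Icc (0:ℝ) 1) (n : ℕ)
    (K : Set ℂ) (hK : IsPreconnected K) (h : ∀ u ∈ K, ‖1 - ((FC c)^[n] u)^2 - x‖ < 1/10^172*(1/10^171)) :
    ∀ u ∈ K, ∀ u' ∈ K, ‖u^2 - u'^2‖ ≤ 3/4 * (1/1.02^n) := by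
  intro u hu u' hu'
  obtain ⟨h1, h2⟩ := esc_ind S x hx n K hK h
  have h3 := h2.1 2 (fun z hz => (norm_sq_bound (h1 z hz)).2) u hu u' hu'
  have h4 : ‖u - u'‖ ≤ 1/4 * (1/1.02^n) := by
    refine le_of_pow_le_pow_left₀ (n := 4) (by norm_num) (by positivity) (h3.trans ?_)
    have e : (1/4 * (1/1.02^n) : ℝ)^4 = 1/256 * (1/(1.02^4)^n) := by
      rw [← pow_mul, mul_comm 4 n, pow_mul]; field_simp; norm_num
    rw [e]
    have : ((1.02:ℝ)^4)^n ≤ 1.1^n := by gcongr; norm_num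
    calc (8/10^170/1.1^n * 2^3 : ℝ) = 64/10^170 * (1/1.1^n) := by ring
      _ ≤ 1/256 * (1/(1.02^4)^n) := by
        apply mul_le_mul _ _ (by positivity) (by positivity)
        · norm_num
        · exact one_div_le_one_div_of_le (by positivity) this
  rw [show u^2-u'^2 = (u-u')*(u+u') by ring, norm_mul]
  have h5 : ‖u+u'‖ ≤ 3 := by
    refine (norm_add_le _ _).trans ?_
    have a1 := (norm_sq_bound (h1 u hu)).1
    have a2 := (norm_sq_bound (h1 u' hu')).1
    norm_num at *
    linarith
  calc _ ≤ (1/4 * (1/1.02^n)) * (3:ℝ) := by gcongr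
    _ = _ := by ring

def gC (c : ℝ) (z : ℂ) : ℂ := 1 + (z - c)^2 * (z - 1) / c^2

lemma gC_semi (c : ℝ) (hc : c ≠ 0) (u : ℂ) : gC c (1 - u^2) = 1 - (FC c u)^2 := by
  have : (c:ℂ) ≠ 0 := by exact_mod_cast hc
  unfold gC FC
  field_simp
  ring

lemma gC_iter (c : ℝ) (hc : c ≠ 0) (n : ℕ) (u : ℂ) : (gC c)^[n] (1 - u^2) = 1 - ((FC c)^[n] u)^2 := by
  have h : Function.Semiconj (fun u : ℂ => 1 - u^2) (FC c) (gC c) := fun u => (gC_semi c hc u).symm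
  exact ((h.iterate_right n) u).symm

lemma sq_open : IsOpenMap (fun u : ℂ => 1 - u^2) := by
  have h : AnalyticOnNhd ℂ (fun u : ℂ => 1 - u^2) univ := by
    rw [Complex.analyticOnNhd_univ_iff_differentiable]; fun_prop
  rcases h.is_constant_or_isOpenMap with ⟨w, hw⟩ | h
  · have h0 := hw 0
    have h1 := hw 1
    rw [← h0] at h1
    norm_num at h1
  · exact h

lemma lift_component (O : Set ℂ) (hO : IsOpen O) (w : ℂ) (hw : w ∈ O) :
    ∃ K : Set ℂ, IsPreconnected K ∧ (∀ u ∈ K, 1 - u^2 ∈ O) ∧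
      ∀ p ∈ connectedComponentIn O w, ∃ u ∈ K, 1 - u^2 = p := by
  set W := connectedComponentIn O w with hW
  set f : ℂ → ℂ := fun u => 1 - u^2 with hf
  have hfc : Continuous f := by fun_prop
  have hfs : ∀ p, ∃ u, f u = p := by
    intro p
    obtain ⟨z, hz⟩ := IsAlgClosed.exists_pow_nat_eq (1 - p) (n := 2) (by norm_num)
    exact ⟨z, by simp only [hf, hz]; ring⟩
  have hWo : IsOpen W := hO.connectedComponentIn
  set A := f ⁻¹' W with hA
  have hAo : IsOpen A := hWo.preimage hfc
  have hneg : ∀ C : Set ℂ, C ⊆ A → (fun z => -z) '' C ⊆ A := by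
    rintro C hC _ ⟨z, hz, rfl⟩
    have := hC hz
    simpa [hA, hf] using this
  obtain ⟨u0, hu0⟩ := hfs w
  have hwW : w ∈ W := mem_connectedComponentIn hw
  have hu0A : u0 ∈ A := by simp only [hA, mem_preimage, hu0]; exact hwW
  set K := connectedComponentIn A u0 with hK
  refine ⟨K, isPreconnected_connectedComponentIn, ?_, ?_⟩
  · intro u hu
    exact connectedComponentIn_subset O w (connectedComponentIn_subset A u0 hu)
  have hsub : W ⊆ f '' K := by
    apply (isPreconnected_connectedComponentIn : IsPreconnected W).subset_of_closure_inter_subset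
    · exact sq_open _ hAo.connectedComponentIn
    · exact ⟨w, hwW, u0, mem_connectedComponentIn hu0A, hu0⟩
    · rintro p ⟨hpc, hpW⟩
      obtain ⟨z, hz⟩ := hfs p
      have hzA : z ∈ A := by simp only [hA, mem_preimage, hz]; exact hpW
      set C := connectedComponentIn A z with hC
      have hzC : z ∈ C := mem_connectedComponentIn hzA
      have hCo : IsOpen (f '' C) := sq_open _ hAo.connectedComponentIn
      obtain ⟨_, ⟨y, hyC, rfl⟩, ⟨k, hkK, hky⟩⟩ := mem_closure_iff.1 hpc _ hCo ⟨z, hzC, hz⟩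
      have hk2 : k = y ∨ k = -y := by
        apply sq_eq_sq_iff_eq_or_eq_neg.1
        simpa [hf] using hky
      rcases hk2 with rfl | rfl
      · have e1 := connectedComponentIn_eq hkK
        have e2 := connectedComponentIn_eq hyC
        exact ⟨z, by rw [hK, e1, ← e2]; exact hzC, hz⟩
      · have e1 := connectedComponentIn_eq hkK
        have hs : (fun z => -z) '' C ⊆ connectedComponentIn A (-y) := by
          apply IsPreconnected.subset_connectedComponentIn
          · exact isPreconnected_connectedComponentIn.image _ (by fun_prop)
          · exact ⟨y, hyC, rfl⟩
          · exact hneg C (connectedComponentIn_subset _ _)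
        refine ⟨-z, ?_, ?_⟩
        · rw [hK, e1]; exact hs ⟨z, hzC, rfl⟩
        · rw [← hz]; simp [hf]
  intro p hp
  exact hsub hp

lemma esc_g {c q : ℝ} {v A : ℕ → ℝ} (S : Setup c q v A) (x : ℝ) (hx : x ∈ Icc (0:ℝ) 1) (n : ℕ) (w : ℂ)
    (hw : w ∈ (gC c)^[n] ⁻¹' Metric.ball (x : ℂ) (1/10^172*(1/10^171))) :
    Metric.diam (connectedComponentIn ((gC c)^[n] ⁻¹' Metric.ball (x : ℂ) (1/10^172*(1/10^171))) w)
      < (1.02:ℝ) ^ (-(n:ℤ)) := by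
  have hc : 0 < c := by linarith [S.hc1]
  have hcont : Continuous (gC c) := by unfold gC; fun_prop
  obtain ⟨K, hK, h1, h2⟩ := lift_component _ (isOpen_ball.preimage (hcont.iterate n)) w hw
  have h3 := esc_F S x hx n K hK (by
    intro u hu
    have := h1 u hu
    rw [mem_preimage, gC_iter c hc.ne', mem_ball, dist_eq_norm] at this
    exact this)
  have hpos : (0:ℝ) < 1/1.02^n := by positivity
  rw [zpow_neg, zpow_natCast, ← one_div]
  refine lt_of_le_of_lt (Metric.diam_le_of_forall_dist_le (C := 3/4 * (1/1.02^n)) (by positivity) ?_) (by linarith)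
  intro p hp p' hp'
  obtain ⟨u, hu, rfl⟩ := h2 p hp
  obtain ⟨u', hu', rfl⟩ := h2 p' hp'
  rw [dist_eq_norm, show (1 - u^2) - (1 - u'^2) = u'^2 - u^2 by ring]
  exact h3 u' hu' u hu

def Fr (c u : ℝ) : ℝ := (u^3 - (1-c)*u) / max c (1/4)
def qr (c : ℝ) : ℝ := √((1-c)/3)
def wr (c : ℝ) : ℝ := 2*(qr c)^3 / max c (1/4)
def V (c : ℝ) (n : ℕ) : ℝ := (Fr c)^[n] (wr c)
def DV (c : ℝ) (n : ℕ) : ℝ := ∏ j ∈ Finset.range n, 3*((V c j)^2 - (qr c)^2) / max c (1/4)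
def Ok (c : ℝ) : Prop := 1/4 ≤ c ∧ c ≤ 1/4 + 1/10^23

lemma V_succ (c : ℝ) (n : ℕ) : V c (n+1) = Fr c (V c n) := Function.iterate_succ_apply' _ _ _
lemma V_zero (c : ℝ) : V c 0 = wr c := rfl
lemma V_add (c : ℝ) (m n : ℕ) : V c (m+n) = (Fr c)^[n] (V c m) := by
  unfold V; rw [add_comm, Function.iterate_add_apply]

lemma DV_succ (c : ℝ) (n : ℕ) : DV c (n+1) = DV c n * (3*((V c n)^2 - (qr c)^2) / max c (1/4)) :=
  Finset.prod_range_succ _ _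

lemma cont_q : Continuous qr := by unfold qr; fun_prop

lemma maxpos (c : ℝ) : 0 < max c (1/4) := lt_max_of_lt_right (by norm_num)

lemma cont_w : Continuous wr := by
  unfold wr
  exact ((continuous_const.mul (cont_q.pow 3))).div (by fun_prop) (fun c => (maxpos c).ne')

lemma cont_F {X : Type*} [TopologicalSpace X] {f g : X → ℝ} (hf : Continuous f) (hg : Continuous g) :
    Continuous (fun x => Fr (f x) (g x)) := by
  unfold Fr
  exact Continuous.div (by fun_prop) (by fun_prop) (fun x => (maxpos (f x)).ne')

lemma cont_iter {X : Type*} [TopologicalSpace X] {f g : X → ℝ} (hf : Continuous f) (hg : Continuous g) (n : ℕ) :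
    Continuous (fun x => (Fr (f x))^[n] (g x)) := by
  induction n with
  | zero => exact hg
  | succ n ih => simp only [Function.iterate_succ_apply']; exact cont_F hf ih

lemma cont_V (n : ℕ) : Continuous (fun c => V c n) := cont_iter continuous_id cont_w n

lemma cont_DV (n : ℕ) : Continuous (fun c => DV c n) := by
  unfold DV
  refine continuous_finsetProd _ (fun j _ => ?_)
  exact Continuous.div (continuous_const.mul (((cont_V j).pow 2).sub (cont_q.pow 2))) (by fun_prop)
    (fun c => (maxpos c).ne')

lemma Fr_odd (c u : ℝ) : Fr c (-u) = - Fr c u := by unfold Fr; ring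

lemma iter_odd (c u : ℝ) (n : ℕ) : (Fr c)^[n] (-u) = - (Fr c)^[n] u := by
  induction n with
  | zero => rfl
  | succ n ih => rw [Function.iterate_succ_apply', ih, Fr_odd, Function.iterate_succ_apply']

lemma iter_abs (c u : ℝ) (n : ℕ) : |(Fr c)^[n] (|u|)| = |(Fr c)^[n] u| := by
  rcases abs_choice u with h | h <;> rw [h]
  rw [iter_odd, abs_neg]

lemma iter_zero (c : ℝ) (n : ℕ) : (Fr c)^[n] 0 = 0 := by
  induction n with
  | zero => rfl
  | succ n ih => rw [Function.iterate_succ_apply', ih]; unfold Fr; simp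

lemma Ok.max {c : ℝ} (hc : Ok c) : max c (1/4) = c := max_eq_left hc.1
lemma Ok.pos {c : ℝ} (hc : Ok c) : 0 < c := by linarith [hc.1]
lemma Ok.lt {c : ℝ} (hc : Ok c) : c ≤ 0.2500001 := by have := hc.2; norm_num at *; linarith
lemma Ok.q_sq {c : ℝ} (hc : Ok c) : 3*(qr c)^2 = 1 - c := by
  unfold qr; rw [Real.sq_sqrt (by linarith [hc.lt])]; ring
lemma Ok.q_nonneg {c : ℝ} (_ : Ok c) : 0 ≤ qr c := Real.sqrt_nonneg _
lemma Ok.q_low {c : ℝ} (hc : Ok c) : 0.4999 ≤ qr c := by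
  have := hc.q_sq; have := hc.lt; have := hc.q_nonneg; norm_num at *; nlinarith
lemma Ok.q_up {c : ℝ} (hc : Ok c) : qr c ≤ 0.5 := by
  have := hc.q_sq; have := hc.1; have := hc.q_nonneg; norm_num at *; nlinarith
lemma Ok.q_pos {c : ℝ} (hc : Ok c) : 0 < qr c := by have := hc.q_low; norm_num at *; linarith
lemma Ok.qsq_low {c : ℝ} (hc : Ok c) : 0.2499 ≤ (qr c)^2 := by
  have := hc.q_sq; have := hc.lt; norm_num at *; linarith
lemma Ok.qsq_up {c : ℝ} (hc : Ok c) : (qr c)^2 ≤ 0.25 := by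
  have := hc.q_sq; have := hc.1; norm_num at *; linarith
lemma Ok.w_eq {c : ℝ} (hc : Ok c) : wr c = 2*(qr c)^3/c := by unfold wr; rw [hc.max]
lemma Ok.w_low {c : ℝ} (hc : Ok c) : 0.99 ≤ wr c := by
  rw [hc.w_eq, le_div_iff₀ hc.pos]
  have h1 := hc.qsq_low; have h2 := hc.q_low; have h3 := hc.lt
  have : (0.4999:ℝ) * 0.2499 ≤ qr c * (qr c)^2 := by gcongr
  norm_num at *
  nlinarith
lemma Ok.w_up {c : ℝ} (hc : Ok c) : wr c ≤ 1 := by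
  rw [hc.w_eq, div_le_iff₀ hc.pos]
  have h1 := hc.qsq_up; have h2 := hc.q_up; have h3 := hc.1
  have h0 := hc.q_nonneg
  have : qr c * (qr c)^2 ≤ (0.5:ℝ) * 0.25 := by gcongr
  norm_num at *
  nlinarith
lemma Ok.w_lt {c : ℝ} (hc : Ok c) (h : 1/4 < c) : wr c < 1 := by
  rw [hc.w_eq, div_lt_iff₀ hc.pos]
  have h1 := hc.qsq_up; have h2 := hc.q_up
  have h0 := hc.q_nonneg
  have : qr c * (qr c)^2 ≤ (0.5:ℝ) * 0.25 := by gcongr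
  norm_num at *
  nlinarith
lemma Ok.F_eq {c : ℝ} (hc : Ok c) (u : ℝ) : Fr c u = u*(u^2 - 3*(qr c)^2)/c := by
  unfold Fr; rw [hc.max, hc.q_sq]; ring
lemma Ok.F_abs {c : ℝ} (hc : Ok c) (u : ℝ) : |Fr c u| = |u| * |u^2 - 3*(qr c)^2|/c := by
  rw [hc.F_eq, abs_div, abs_mul, abs_of_pos hc.pos]
lemma Ok.sq_le {c : ℝ} (_ : Ok c) {u : ℝ} (hu : |u| ≤ qr c) : u^2 ≤ (qr c)^2 := by
  rw [← sq_abs u]; have := abs_nonneg u; gcongr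
/-- inside the central interval -/
lemma Ok.F_abs' {c : ℝ} (hc : Ok c) {u : ℝ} (hu : |u| ≤ qr c) : |Fr c u| = |u| * (3*(qr c)^2 - |u|^2)/c := by
  have := hc.sq_le hu
  rw [hc.F_abs, abs_of_nonpos (a := u^2 - 3*(qr c)^2) (by nlinarith [sq_nonneg (qr c)]), sq_abs]; ring
lemma Ok.F_maps {c : ℝ} (hc : Ok c) {u : ℝ} (hu : |u| ≤ 1) : |Fr c u| ≤ 1 := by
  have h0 := hc.pos
  have h1 := hc.1
  have e1 : 1 - Fr c u = (1-u)*(u^2+u+c)/c := by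
    unfold Fr; rw [hc.max]; field_simp; ring
  have e2 : 1 + Fr c u = (1+u)*(u^2-u+c)/c := by
    unfold Fr; rw [hc.max]; field_simp; ring
  obtain ⟨h2, h3⟩ := abs_le.1 hu
  have a1 : 0 ≤ 1 - Fr c u := by
    rw [e1]; apply div_nonneg (mul_nonneg _ _) h0.le <;> nlinarith [sq_nonneg (u+1/2)]
  have a2 : 0 ≤ 1 + Fr c u := by
    rw [e2]; apply div_nonneg (mul_nonneg _ _) h0.le <;> nlinarith [sq_nonneg (u-1/2)]
  rw [abs_le]; constructor <;> linarith
lemma Ok.iter_maps {c : ℝ} (hc : Ok c) {u : ℝ} (hu : |u| ≤ 1) (n : ℕ) : |(Fr c)^[n] u| ≤ 1 := by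
  induction n with
  | zero => exact hu
  | succ n ih => rw [Function.iterate_succ_apply']; exact hc.F_maps ih
lemma Ok.w_abs {c : ℝ} (hc : Ok c) : |wr c| ≤ 1 := by
  have h1 := hc.w_low; have h2 := hc.w_up
  rw [abs_le]; norm_num at *; constructor <;> linarith
lemma Ok.V_le {c : ℝ} (hc : Ok c) (n : ℕ) : |V c n| ≤ 1 := hc.iter_maps hc.w_abs n
lemma Ok.F_grow {c : ℝ} (hc : Ok c) {u : ℝ} (hu : |u| ≤ qr c) : 1.9*|u| ≤ |Fr c u| := by
  have h1 := hc.sq_le hu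
  have h2 := hc.qsq_low
  have h3 := hc.lt
  rw [hc.F_abs' hu, le_div_iff₀ hc.pos, sq_abs]
  have : 1.9 * c ≤ 3*(qr c)^2 - u^2 := by norm_num at *; linarith
  nlinarith [abs_nonneg u]
lemma Ok.iter_grow {c : ℝ} (hc : Ok c) {u : ℝ} (k : ℕ) (h : ∀ l < k, |(Fr c)^[l] u| ≤ qr c) : 1.9^k*|u| ≤ |(Fr c)^[k] u| := by
  induction k with
  | zero => simp
  | succ k ih =>
    have h1 := ih (fun l hl => h l (by omega))
    have h2 := hc.F_grow (h k (by omega))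
    rw [Function.iterate_succ_apply', pow_succ]
    nlinarith
lemma Ok.F_lip {c : ℝ} (hc : Ok c) {u u' : ℝ} (hu : |u| ≤ 1) (hu' : |u'| ≤ 1) : |Fr c u - Fr c u'| ≤ 10*|u-u'| := by
  have e : Fr c u - Fr c u' = (u-u')*(u^2+u*u'+u'^2 - 3*(qr c)^2)/c := by
    rw [hc.F_eq, hc.F_eq]; ring
  rw [e, abs_div, abs_mul, abs_of_pos hc.pos, div_le_iff₀ hc.pos]
  have h1 := hc.qsq_low; have h2 := hc.qsq_up; have h3 := hc.1
  obtain ⟨a1, a2⟩ := abs_le.1 hu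
  obtain ⟨b1, b2⟩ := abs_le.1 hu'
  have : |u^2+u*u'+u'^2 - 3*(qr c)^2| ≤ 10*c := by
    rw [abs_le]
    norm_num at *
    constructor
    · nlinarith [sq_nonneg (u+u'), sq_nonneg u, sq_nonneg u']
    · nlinarith
  nlinarith [abs_nonneg (u-u')]
lemma Ok.iter_lip {c : ℝ} (hc : Ok c) {u u' : ℝ} (hu : |u| ≤ 1) (hu' : |u'| ≤ 1) (n : ℕ) :
    |(Fr c)^[n] u - (Fr c)^[n] u'| ≤ 10^n*|u-u'| := by
  induction n with
  | zero => simp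
  | succ n ih =>
    rw [Function.iterate_succ_apply', Function.iterate_succ_apply', pow_succ]
    have := hc.F_lip (hc.iter_maps hu n) (hc.iter_maps hu' n)
    linarith
lemma Ok.F_near {c : ℝ} (hc : Ok c) {u : ℝ} (hu : |u| ≤ qr c) :
    wr c - |Fr c u| = (qr c - |u|)^2*(|u| + 2*qr c)/c := by
  rw [hc.F_abs' hu, hc.w_eq]; ring
lemma Ok.F_crit {c : ℝ} (hc : Ok c) {u : ℝ} (hu : |u| = qr c) : |Fr c u| = wr c := by
  have := hc.F_near hu.le
  rw [hu] at this
  simp at this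
  linarith
lemma Ok.small_of_small {c : ℝ} (hc : Ok c) {u : ℝ} (hu : |u| ≤ qr c) (h : |Fr c u| ≤ qr c) : |u| ≤ 1/5 := by
  have h1 := hc.F_grow hu
  have h2 := hc.q_up
  have h4 := hc.lt
  have h5 := hc.qsq_low
  have h0 := abs_nonneg u
  rw [hc.F_abs' hu, div_le_iff₀ hc.pos] at h
  have h3 : |u| ≤ 0.27 := by
    rw [hc.F_abs' hu, le_div_iff₀ hc.pos] at h1
    have : 1.9 * |u| * c ≤ 0.5*c := h1.trans (h.trans (by have := hc.pos; gcongr))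
    have := le_of_mul_le_mul_right this hc.pos
    norm_num at *
    linarith
  have h6 : 0.66 ≤ 3*(qr c)^2 - |u|^2 := by
    have : |u|^2 ≤ 0.27^2 := by gcongr
    generalize |u|^2 = a at *
    norm_num at *
    linarith
  have h7 : |u| * 0.66 ≤ 0.5 * 0.2500001 := by
    have h8 : |u| * 0.66 ≤ |u| * (3*(qr c)^2 - |u|^2) := by gcongr
    refine h8.trans (h.trans ?_)
    have := hc.pos
    gcongr
  norm_num at *
  linarith
lemma Ok.small_of_sqrt {c : ℝ} (hc : Ok c) {u : ℝ} (hu : |u| ≤ qr c) (h : |Fr c u| ≤ √3 * qr c) : |u| ≤ 0.4 := by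
  by_contra hcon
  push Not at hcon
  have h2 := hc.q_up
  have h4 := hc.lt
  have h5 := hc.qsq_low
  have h3 : √3 ≤ 1.7321 := by rw [Real.sqrt_le_left (by norm_num)]; norm_num
  rw [hc.F_abs' hu, div_le_iff₀ hc.pos] at h
  have h6 : √3 * qr c * c ≤ 1.7321*0.5*0.2500001 := by
    have := hc.pos
    have := hc.q_nonneg
    gcongr
  set a := |u|
  have h7 : 0.4*(0.7497 - 0.16) ≤ a*(0.7497 - a^2) := by norm_num at *; nlinarith
  have h8 : a*(0.7497 - a^2) ≤ a * (3*(qr c)^2 - a^2) := by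
    have : 0 ≤ a := abs_nonneg u
    gcongr
    norm_num at *; linarith
  norm_num at *
  linarith

def II (c : ℝ) (n : ℕ) : Prop := 1/100*(6/5:ℝ)^n < |DV c n| * |(V c n)^2 - (qr c)^2|^3

lemma step_cstar (a b : ℝ) (hab : a < b) (hOk : ∀ c ∈ Icc a b, Ok c) (m J : ℕ) (hb : V b m = 0)
    (hJ : 1 < 1.9^J*|V a m|) :
    ∃ cs ∈ Ico a b, |V cs (m+J)| = qr cs ∧ (∀ l < J, |V cs (m+l)| < qr cs) ∧
      ∀ c ∈ Ioc cs b, ∀ l ≤ J, |V c (m+l)| < qr c := by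
  set S : Set ℝ := Icc a b ∩ ⋃ l ∈ Iic J, {c | qr c ≤ |V c (m+l)|} with hS
  have hclosed : IsClosed (⋃ l ∈ Iic J, {c | qr c ≤ |V c (m+l)|}) := by
    apply (finite_Iic J).isClosed_biUnion
    intro l _
    exact isClosed_le cont_q (cont_V _).abs
  have hScomp : IsCompact S := isCompact_Icc.inter_right hclosed
  have haS : a ∈ S := by
    refine ⟨left_mem_Icc.2 hab.le, ?_⟩
    by_contra hcon
    simp only [mem_iUnion, mem_Iic, mem_ofPred_eq, not_exists, not_le] at hcon
    have hOa := hOk a (left_mem_Icc.2 hab.le)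
    have := hOa.iter_grow (u := V a m) J (fun l hl => by rw [← V_add]; exact (hcon l hl.le).le)
    have h1 := hOa.iter_maps (hOa.V_le m) J
    linarith
  obtain ⟨cs, hcs, hmax⟩ := hScomp.exists_isGreatest ⟨a, haS⟩
  have hbS : b ∉ S := by
    rintro ⟨_, hb2⟩
    simp only [mem_iUnion, mem_Iic, mem_ofPred_eq, exists_prop] at hb2
    obtain ⟨l, _, hl⟩ := hb2
    rw [V_add, hb, iter_zero, abs_zero] at hl
    linarith [(hOk b (right_mem_Icc.2 hab.le)).q_pos]
  have hcsb : cs < b := lt_of_le_of_ne hcs.1.2 (fun h => hbS (h ▸ hcs))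
  have hOcs := hOk cs hcs.1
  have hright : ∀ c ∈ Ioc cs b, ∀ l ≤ J, |V c (m+l)| < qr c := by
    intro c hc l hl
    by_contra hcon
    push Not at hcon
    have : c ∈ S := ⟨⟨hcs.1.1.trans hc.1.le, hc.2⟩, by
      simp only [mem_iUnion, mem_Iic, mem_ofPred_eq, exists_prop]; exact ⟨l, hl, hcon⟩⟩
    exact absurd (hmax this) (not_le.2 hc.1)
  have hle : ∀ l ≤ J, |V cs (m+l)| ≤ qr cs := by
    intro l hl
    have hcl : IsClosed {c | |V c (m+l)| ≤ qr c} := isClosed_le (cont_V _).abs cont_q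
    have hsub : Ioc cs b ⊆ {c | |V c (m+l)| ≤ qr c} := fun c hc => (hright c hc l hl).le
    have := hcl.closure_subset_iff.2 hsub
    rw [closure_Ioc hcsb.ne] at this
    exact this (left_mem_Icc.2 hcsb.le)
  have hne : ∀ l < J, |V cs (m+l)| < qr cs := by
    intro l hl
    refine lt_of_le_of_ne (hle l hl.le) (fun h => ?_)
    have h1 := hOcs.F_crit h
    rw [← V_succ] at h1
    have h2 := hle (l+1) hl
    rw [← add_assoc, h1] at h2
    have h3 := hOcs.w_low
    have h4 := hOcs.q_up
    norm_num at *
    linarith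
  refine ⟨cs, ⟨hcs.1.1, hcsb⟩, ?_, hne, hright⟩
  have h2 := hcs.2
  simp only [mem_iUnion, mem_Iic, mem_ofPred_eq, exists_prop] at h2
  obtain ⟨l, hl, hl2⟩ := h2
  rcases hl.lt_or_eq with h | rfl
  · exact absurd hl2 (not_le.2 (hne l h))
  · exact le_antisymm (hle l le_rfl) hl2

lemma sqrt3_low : (1.7:ℝ) ≤ √3 := Real.le_sqrt_of_sq_le (by norm_num)
lemma sqrt3_up : √3 ≤ (1.7321:ℝ) := by rw [Real.sqrt_le_left (by norm_num)]; norm_num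

lemma step_cprime (cs b : ℝ) (hab : cs < b) (hOk : ∀ c ∈ Icc cs b, Ok c) (m J J1 : ℕ) (hb : V b m = 0)
    (hJ : J1 + 3 ≤ J) (ρ κ : ℝ) (hρ0 : 0 < ρ) (hρ1 : ρ ≤ 0.9)
    (h1 : |V cs (m+J)| = qr cs) (h2 : ∀ l < J, |V cs (m+l)| < qr cs)
    (hκ : ∀ c ∈ Icc cs b, κ ≤ |(Fr c)^[m] (wr c - ρ)|) (hκJ : 1 < 1.9^J1 * κ) :
    ∃ c' ∈ Ioc cs b, wr c' - |V c' (m+J+1)| ≤ ρ ∧ (∀ l ≤ J1, |V c' (m+J+1+(m+l))| < qr c') ∧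
      |V c' (m+J+1+(m+J1+1))| = √3 * qr c' ∧
      ∀ c ∈ Ico cs c', |V c (m+J+1+(m+J1+1))| < √3 * qr c := by
  set T : Set ℝ := Icc cs b ∩ ({c | ρ ≤ wr c - |V c (m+J+1)|} ∪ ((⋃ l ∈ Iic J1, {c | qr c ≤ |V c (m+J+1+(m+l))|})
    ∪ {c | √3 * qr c ≤ |V c (m+J+1+(m+J1+1))|})) with hT
  have hTcomp : IsCompact T := by
    refine isCompact_Icc.inter_right (IsClosed.union ?_ (IsClosed.union ?_ ?_))
    · exact isClosed_le continuous_const (cont_w.sub (cont_V _).abs)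
    · apply (finite_Iic J1).isClosed_biUnion
      intro l _
      exact isClosed_le cont_q (cont_V _).abs
    · exact isClosed_le (continuous_const.mul cont_q) (cont_V _).abs
  have hmemT : ∀ c, c ∈ T ↔ c ∈ Icc cs b ∧ (ρ ≤ wr c - |V c (m+J+1)| ∨ (∃ l ≤ J1, qr c ≤ |V c (m+J+1+(m+l))|) ∨
      √3 * qr c ≤ |V c (m+J+1+(m+J1+1))|) := by
    intro c
    simp only [hT, mem_inter_iff, mem_union, mem_iUnion, mem_Iic, mem_ofPred_eq, exists_prop]
  have hbT : b ∈ T := by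
    rw [hmemT]
    refine ⟨right_mem_Icc.2 hab.le, Or.inl ?_⟩
    rw [add_assoc, V_add, hb, iter_zero, abs_zero]
    have := (hOk b (right_mem_Icc.2 hab.le)).w_low
    norm_num at *
    linarith
  have hOcs := hOk cs (left_mem_Icc.2 hab.le)
  have hcsV : ∀ i, |V cs (m+J+1+i)| = |V cs i| := by
    intro i
    have : |V cs (m+J+1)| = |wr cs| := by
      rw [V_succ, hOcs.F_crit h1, abs_of_nonneg]
      have := hOcs.w_low; norm_num at *; linarith
    rw [V_add, ← iter_abs, this, iter_abs]; rfl
  have hcsT : cs ∉ T := by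
    rw [hmemT]
    rintro ⟨_, h | ⟨l, hl, h⟩ | h⟩
    · rw [V_succ, hOcs.F_crit h1] at h; linarith
    · rw [hcsV] at h
      linarith [h2 l (by omega)]
    · rw [hcsV] at h
      have := h2 (J1+1) (by omega)
      rw [← add_assoc] at this
      have h3 := sqrt3_low
      have h4 := hOcs.q_pos
      nlinarith
  obtain ⟨c', hc', hmin⟩ := hTcomp.exists_isLeast ⟨b, hbT⟩
  have hcc : cs < c' := lt_of_le_of_ne hc'.1.1 (fun h => hcsT (h ▸ hc'))
  have hO := hOk c' hc'.1
  have hleft : ∀ c ∈ Ico cs c', c ∉ T := fun c hc hcT => absurd (hmin hcT) (not_le.2 hc.2)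
  have hlim : ∀ P : Set ℝ, IsClosed P → Ico cs c' ⊆ P → c' ∈ P := by
    intro P hP hsub
    have := hP.closure_subset_iff.2 hsub
    rw [closure_Ico hcc.ne] at this
    exact this (right_mem_Icc.2 hcc.le)
  have hIco : ∀ c ∈ Ico cs c', c ∈ Icc cs b := fun c hc => ⟨hc.1, hc.2.le.trans hc'.1.2⟩
  have l1 : wr c' - |V c' (m+J+1)| ≤ ρ := by
    apply hlim {c | wr c - |V c (m+J+1)| ≤ ρ} (isClosed_le (cont_w.sub (cont_V _).abs) continuous_const)
    intro c hc
    by_contra hcon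
    exact hleft c hc ((hmemT c).2 ⟨hIco c hc, Or.inl (not_le.1 hcon).le⟩)
  have l2 : ∀ l ≤ J1, |V c' (m+J+1+(m+l))| ≤ qr c' := by
    intro l hl
    apply hlim {c | |V c (m+J+1+(m+l))| ≤ qr c} (isClosed_le (cont_V _).abs cont_q)
    intro c hc
    by_contra hcon
    exact hleft c hc ((hmemT c).2 ⟨hIco c hc, Or.inr (Or.inl ⟨l, hl, (not_le.1 hcon).le⟩)⟩)
  have l3s : ∀ c ∈ Ico cs c', |V c (m+J+1+(m+J1+1))| < √3 * qr c := by
    intro c hc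
    by_contra hcon
    exact hleft c hc ((hmemT c).2 ⟨hIco c hc, Or.inr (Or.inr (not_lt.1 hcon))⟩)
  have l3 : |V c' (m+J+1+(m+J1+1))| ≤ √3 * qr c' :=
    hlim {c | |V c (m+J+1+(m+J1+1))| ≤ √3 * qr c} (isClosed_le (cont_V _).abs (continuous_const.mul cont_q))
      (fun c hc => (l3s c hc).le)
  have l2s : ∀ l ≤ J1, |V c' (m+J+1+(m+l))| < qr c' := by
    intro l hl
    refine lt_of_le_of_ne (l2 l hl) (fun h => ?_)
    have e1 := hO.F_crit h
    rw [← V_succ] at e1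
    have e3 := hO.w_low
    have e4 := hO.q_up
    have e5 := sqrt3_up
    have e6 := hO.q_pos
    rcases hl.lt_or_eq with hl' | rfl
    · have e2 := l2 (l+1) hl'
      rw [← add_assoc m l 1, ← add_assoc (m+J+1), e1] at e2
      norm_num at *
      linarith
    · rw [← add_assoc (m+J+1) (m+l) 1, e1] at l3
      norm_num at *
      nlinarith
  refine ⟨c', ⟨hcc, hc'.1.2⟩, l1, l2s, ?_, l3s⟩
  rcases ((hmemT c').1 hc').2 with h | ⟨l, hl, h⟩ | h
  · exfalso
    have e : |V c' (m+J+1)| = wr c' - ρ := by linarith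
    have e1 : ∀ i, |V c' (m+J+1+(m+i))| = |(Fr c')^[i] ((Fr c')^[m] (wr c' - ρ))| := by
      intro i
      rw [V_add, ← iter_abs, e, add_comm m i, Function.iterate_add_apply]
    have := hO.iter_grow (u := (Fr c')^[m] (wr c' - ρ)) J1 (fun l hl => by rw [← e1]; exact l2 l hl.le)
    have h5 := hκ c' hc'.1
    rw [← e1] at this
    have h6 := hO.V_le (m+J+1+(m+J1))
    have h7 : (1.9:ℝ)^J1 * κ ≤ 1.9^J1 * |(Fr c')^[m] (wr c' - ρ)| := by gcongr
    linarith
  · exact absurd h (not_le.2 (l2s l hl))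
  · exact le_antisymm l3 h

lemma DV_abs_succ {c : ℝ} (hc : Ok c) (n : ℕ) :
    |DV c (n+1)| = |DV c n| * (3*|(V c n)^2 - (qr c)^2|/c) := by
  rw [DV_succ, abs_mul, hc.max, abs_div, abs_mul, abs_of_pos hc.pos]; norm_num

lemma step_II {c : ℝ} (hc : Ok c) (m J L : ℕ) (κ : ℝ) (hκ0 : 0 < κ) (hκ1 : κ ≤ 1) (hm : II c m)
    (hlt : ∀ l ≤ J, |V c (m+l)| < qr c) (hκ : ∀ i ≤ L, κ ≤ |(V c (m+J+i))^2 - (qr c)^2|)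
    (hJ : (6/5:ℝ)^(J+L) ≤ 64*2.5^J*κ^(L+3)) : ∀ n, m ≤ n → n ≤ m+J+L → II c n := by
  have hq1 := hc.qsq_low
  have hq2 := hc.qsq_up
  have hcl := hc.lt
  have hcp := hc.pos
  have hDm : 64/100*(6/5:ℝ)^m < |DV c m| := by
    unfold II at hm
    have h1 : |(V c m)^2 - (qr c)^2| ≤ 1/4 := by
      have h2 := hc.sq_le (hlt 0 (by omega)).le
      rw [add_zero] at h2
      rw [abs_le]; norm_num at *; constructor <;> nlinarith [sq_nonneg (V c m)]
    have h2 : |DV c m| * |(V c m)^2 - (qr c)^2|^3 ≤ |DV c m| * (1/4)^3 := by gcongr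
    norm_num at *
    linarith
  have hsm : ∀ l < J, |V c (m+l)| ≤ 1/5 := by
    intro l hl
    apply hc.small_of_small (hlt l hl.le).le
    rw [← V_succ]
    exact (hlt (l+1) hl).le
  have hsm2 : ∀ l < J, 0.2098 ≤ |(V c (m+l))^2 - (qr c)^2| := by
    intro l hl
    have h1 : |V c (m+l)|^2 ≤ (1/5)^2 := by have := hsm l hl; gcongr
    rw [sq_abs] at h1
    rw [abs_sub_comm]
    refine le_trans ?_ (le_abs_self _)
    norm_num at *
    linarith
  have hD1 : ∀ k ≤ J, 2.5^k * |DV c m| ≤ |DV c (m+k)| := by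
    intro k
    induction k with
    | zero => intro _; simp
    | succ k ih =>
      intro hk
      have h1 := ih (by omega)
      have h2 := hsm2 k (by omega)
      rw [← add_assoc, DV_abs_succ hc, pow_succ]
      have h3 : 2.5 ≤ 3*|(V c (m+k))^2 - (qr c)^2|/c := by
        rw [le_div_iff₀ hcp]; norm_num at *; linarith
      calc _ = (2.5^k * |DV c m|) * 2.5 := by ring
        _ ≤ _ := by gcongr
  have hD2 : ∀ i ≤ L, 2.5^J * |DV c m| * κ^i ≤ |DV c (m+J+i)| := by
    intro i
    induction i with
    | zero => intro _; simpa using hD1 J le_rfl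
    | succ i ih =>
      intro hi
      have h1 := ih (by omega)
      have h2 := hκ i (by omega)
      rw [← add_assoc, DV_abs_succ hc, pow_succ]
      have h3 : κ ≤ 3*|(V c (m+J+i))^2 - (qr c)^2|/c := by
        rw [le_div_iff₀ hcp]; norm_num at *; nlinarith
      calc _ = (2.5^J * |DV c m| * κ^i) * κ := by ring
        _ ≤ _ := by gcongr
  intro n hmn hn
  rcases hmn.lt_or_eq with hmn | rfl
  swap
  · exact hm
  by_cases hnJ : n < m + J
  · obtain ⟨k, rfl⟩ : ∃ k, n = m + (k+1) := ⟨n - m - 1, by omega⟩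
    have h1 := hD1 (k+1) (by omega)
    have h2 := hsm2 (k+1) (by omega)
    unfold II
    have h3 : (2.5:ℝ)^(k+1)*|DV c m| * 0.2098^3 ≤ |DV c (m+(k+1))| * |(V c (m+(k+1)))^2 - (qr c)^2|^3 := by gcongr
    refine lt_of_lt_of_le ?_ h3
    have h4 : (6/5:ℝ)^k ≤ 2.5^k := by gcongr; norm_num
    have h5 : (0:ℝ) < (6/5)^m := by positivity
    have h6 : (0:ℝ) < 2.5^k := by positivity
    calc 1/100*(6/5:ℝ)^(m+(k+1)) = 1/100*(6/5)*((6/5)^m * (6/5)^k) := by rw [pow_add, pow_succ]; ring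
      _ ≤ 1/100*(6/5)*((6/5)^m * 2.5^k) := by gcongr
      _ ≤ 2.5^k*2.5*(64/100*(6/5)^m)*0.2098^3 := by norm_num; nlinarith [mul_pos h5 h6]
      _ < 2.5^(k+1)*|DV c m| * 0.2098^3 := by rw [pow_succ (2.5:ℝ)]; gcongr
  · obtain ⟨i, rfl⟩ : ∃ i, n = m + J + i := ⟨n - m - J, by omega⟩
    have hi : i ≤ L := by omega
    have h1 := hD2 i hi
    have h2 := hκ i hi
    unfold II
    have h3 : 2.5^J * |DV c m| * κ^i * κ^3 ≤ |DV c (m+J+i)| * |(V c (m+J+i))^2 - (qr c)^2|^3 := by gcongr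
    refine lt_of_lt_of_le ?_ h3
    have h4 : κ^(L+3) ≤ κ^i * κ^3 := by
      rw [← pow_add]; exact pow_le_pow_of_le_one hκ0.le hκ1 (by omega)
    have h5 : (6/5:ℝ)^(J+i) ≤ (6/5)^(J+L) := pow_le_pow_right₀ (by norm_num) (by omega)
    calc 1/100*(6/5:ℝ)^(m+J+i) = 1/100*(6/5)^m*(6/5)^(J+i) := by rw [add_assoc, pow_add]; ring
      _ ≤ 1/100*(6/5)^m*(64*2.5^J*(κ^i*κ^3)) := by
        gcongr
        exact h5.trans (hJ.trans (by gcongr))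
      _ = 2.5^J*(64/100*(6/5)^m)*κ^i*κ^3 := by ring
      _ < _ := by gcongr

lemma hasDeriv_F {c : ℝ} (hc : Ok c) (u : ℝ) : HasDerivAt (Fr c) (3*(u^2 - (qr c)^2)/max c (1/4)) u := by
  have h : HasDerivAt (fun u : ℝ => (u^3 - (1-c)*u) / max c (1/4)) ((3*u^2 - (1-c)*1)/max c (1/4)) u := by
    have h1 := (((hasDerivAt_pow 3 u)).sub ((hasDerivAt_id u).const_mul (1-c))).div_const (max c (1/4))
    simpa using h1
  have e : 3*(u^2 - (qr c)^2)/max c (1/4) = (3*u^2 - (1-c)*1)/max c (1/4) := by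
    rw [← hc.q_sq]; ring
  rw [e]
  exact h

lemma hasDeriv_iter {c : ℝ} (hc : Ok c) (n : ℕ) :
    HasDerivAt ((Fr c)^[n]) (DV c n) (wr c) := by
  induction n with
  | zero => simpa [DV] using hasDerivAt_id (wr c)
  | succ n ih =>
    rw [DV_succ, Function.iterate_succ', mul_comm]
    exact (hasDeriv_F hc (V c n)).comp (wr c) ih

section
open Filter Topology

def GG (c : ℝ) (m : ℕ) : Prop := 1/4 < c ∧ c ≤ 1/4 + 1/10^23 ∧ V c m = 0 ∧ (∀ n ≤ m, II c n) ∧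
  ∃ δ > 0, ∀ c', c - δ < c' → c' < c → V c' m ≠ 0

lemma exists_low (f : ℕ → ℝ) (m : ℕ) (h : ∀ l < m, 0 < f l) :
    ∃ κ > 0, κ ≤ 1/100 ∧ ∀ l < m, κ < f l := by
  induction m with
  | zero => exact ⟨1/100, by norm_num, le_rfl, fun l hl => by omega⟩
  | succ m ih =>
    obtain ⟨κ, h0, h1, h2⟩ := ih (fun l hl => h l (by omega))
    have h3 := h m (by omega)
    refine ⟨min κ (f m/2), by positivity, (min_le_left _ _).trans h1, fun l hl => ?_⟩
    rcases Nat.lt_succ_iff_lt_or_eq.1 hl with hl | rfl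
    · exact (min_le_left _ _).trans_lt (h2 l hl)
    · exact (min_le_right _ _).trans_lt (by linarith)

lemma II.ne {c : ℝ} {n : ℕ} (h : II c n) : 0 < |DV c n| ∧ 0 < |(V c n)^2 - (qr c)^2| := by
  unfold II at h
  have h0 : (0:ℝ) < 1/100*(6/5)^n := by positivity
  have h1 := h0.trans h
  constructor
  · by_contra hcon
    have : |DV c n| = 0 := le_antisymm (not_lt.1 hcon) (abs_nonneg _)
    rw [this] at h1; simp at h1
  · by_contra hcon
    have : |(V c n)^2 - (qr c)^2| = 0 := le_antisymm (not_lt.1 hcon) (abs_nonneg _)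
    rw [this] at h1; simp at h1

lemma open_II (n : ℕ) : IsOpen {c | II c n} :=
  isOpen_lt continuous_const ((cont_DV n).abs.mul ((((cont_V n).pow 2).sub (cont_q.pow 2)).abs.pow 3))

/-- verification of the lower bounds along the last part of the orbit -/
lemma step_kappa {c : ℝ} (hc : Ok c) (m J J1 : ℕ) (κ ρ : ℝ) (hκ : κ ≤ 1/100)
    (hκ2 : κ ≤ 0.02/10^(m+J1+1)) (hJ : J1 + 3 ≤ J)
    (hlt : ∀ l ≤ J, |V c (m+l)| < qr c)
    (h1 : wr c - |V c (m+J+1)| ≤ ρ) (h2 : ∀ l ≤ J1, |V c (m+J+1+(m+l))| < qr c)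
    (h3 : |V c (m+J+1+(m+J1+1))| = √3 * qr c)
    (h4 : ∀ x, |x - wr c| ≤ ρ → ∀ l < m, κ ≤ |((Fr c)^[l] x)^2 - (qr c)^2|) :
    ∀ i ≤ m+J1+3, κ ≤ |(V c (m+J+i))^2 - (qr c)^2| := by
  have hq1 := hc.qsq_low
  have hq2 := hc.qsq_up
  have hq3 := hc.q_low
  have hq4 := hc.q_up
  have hcl := hc.1
  have hcp := hc.pos
  set s := |V c (m+J)| with hs
  have hsq : s < qr c := hlt J le_rfl
  have hs0 : 0 ≤ s := abs_nonneg _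
  set x := |V c (m+J+1)| with hx
  have hnear : wr c - x = (qr c - s)^2*(s + 2*qr c)/c := by
    rw [hx, V_succ]; exact hc.F_near hsq.le
  have hwx : 0 ≤ wr c - x := by
    rw [hnear]; have := hc.q_nonneg; positivity
  have hx1 : |x| ≤ 1 := by rw [hx, abs_abs]; exact hc.V_le _
  intro i hi
  rcases Nat.eq_zero_or_pos i with rfl | hpos
  · rw [add_zero]
    set L := m+J1+1 with hL
    have a1 := hc.iter_lip hc.w_abs hx1 L
    have a2 : |(Fr c)^[L] x| = √3 * qr c := by rw [hx, iter_abs, ← V_add]; exact h3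
    have a3 : |(Fr c)^[L] (wr c)| < qr c := by
      have := hlt (J1+1) (by omega)
      rw [← add_assoc] at this
      exact this
    have a4 : |(Fr c)^[L] x| - |(Fr c)^[L] (wr c)| ≤ |(Fr c)^[L] (wr c) - (Fr c)^[L] x| := by
      rw [abs_sub_comm]; exact abs_sub_abs_le_abs_sub _ _
    rw [abs_of_nonneg hwx] at a1
    have hp : (0:ℝ) < 10^L := by positivity
    have a5 : 0.3 ≤ 10^L * (wr c - x) := by
      have := sqrt3_low
      norm_num at *
      nlinarith
    have a6 : wr c - x ≤ 6*(qr c - s)^2 := by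
      rw [hnear, div_le_iff₀ hcp]
      have : s + 2*qr c ≤ 6*c := by norm_num at *; linarith
      nlinarith [sq_nonneg (qr c - s)]
    have a7 : 0.05 / 10^L ≤ (qr c - s)^2 := by
      rw [div_le_iff₀ hp]
      have : 10^L * (wr c - x) ≤ 10^L * (6*(qr c - s)^2) := by gcongr
      have t : 10^L * (6*(qr c - s)^2) = 6*((qr c - s)^2*10^L) := by ring
      rw [t] at this
      generalize (qr c - s)^2*10^L = y at *
      generalize 10^L * (wr c - x) = y2 at *
      norm_num at a5 ⊢
      linarith
    have a8 : |(V c (m+J))^2 - (qr c)^2| = (qr c - s)*(qr c + s) := by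
      rw [← sq_abs (V c (m+J)), ← hs, abs_of_nonpos]
      · ring
      · nlinarith
    rw [a8]
    have a9 : 0.02/10^L = 0.4*(0.05/(10:ℝ)^L) := by ring
    rw [a9] at hκ2
    refine hκ2.trans ?_
    norm_num at *
    nlinarith
  · obtain ⟨i, rfl⟩ : ∃ j, i = j + 1 := ⟨i-1, by omega⟩
    rw [show m+J+(i+1) = m+J+1+i by ring]
    by_cases him : i < m
    · have := h4 x (by rw [abs_sub_comm, abs_of_nonneg hwx]; exact h1) i him
      rwa [← sq_abs, iter_abs, ← V_add, sq_abs] at this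
    obtain ⟨l, rfl⟩ : ∃ l, i = m + l := ⟨i - m, by omega⟩
    by_cases hl : l ≤ J1
    · have b1 := h2 l hl
      have b2 : |Fr c (V c (m+J+1+(m+l)))| ≤ √3 * qr c := by
        rw [← V_succ, add_assoc (m+J+1)]
        rcases hl.lt_or_eq with hl' | rfl
        · have e := h2 (l+1) hl'
          have := sqrt3_low
          rw [← add_assoc m l 1] at e
          have := hc.q_pos
          nlinarith
        · exact h3.le
      have b3 := hc.small_of_sqrt b1.le b2
      have b4 : |V c (m+J+1+(m+l))|^2 ≤ 0.4^2 := by gcongr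
      rw [sq_abs] at b4
      rw [abs_sub_comm]
      refine le_trans ?_ (le_abs_self _)
      norm_num at *
      linarith
    have hl2 : l = J1 + 1 ∨ l = J1 + 2 := by omega
    have e3 : (√3:ℝ)^2 = 3 := Real.sq_sqrt (by norm_num)
    have e4 : (V c (m+J+1+(m+J1+1)))^2 = 3*(qr c)^2 := by
      rw [← sq_abs, h3, mul_pow, e3]
    rcases hl2 with rfl | rfl
    · rw [← add_assoc m J1 1, e4]
      refine le_trans ?_ (le_abs_self _)
      norm_num at *
      linarith
    · have e5 : V c (m+J+1+(m+(J1+2))) = 0 := by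
        rw [show m+J+1+(m+(J1+2)) = (m+J+1+(m+J1+1))+1 by ring, V_succ, hc.F_eq, e4]; simp
      rw [e5, abs_sub_comm]
      refine le_trans ?_ (le_abs_self _)
      norm_num at *
      linarith

lemma exists_J (κ v0 : ℝ) (hκ : 0 < κ) (hv : 0 < v0) (L k : ℕ) :
    ∃ J, k ≤ J ∧ 1 < 1.9^J * v0 ∧ (6/5:ℝ)^(J+L) ≤ 64*2.5^J*κ^(L+3) := by
  have t1 := (tendsto_pow_atTop_atTop_of_one_lt (r := (1.9:ℝ)) (by norm_num)).eventually_gt_atTop (1/v0)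
  have t2 := (tendsto_pow_atTop_atTop_of_one_lt (r := (2:ℝ)) (by norm_num)).eventually_gt_atTop
    ((6/5)^L/(64*κ^(L+3)))
  obtain ⟨J, h1, h2, h3⟩ := (t1.and (t2.and (eventually_ge_atTop k))).exists
  refine ⟨J, h3, ?_, ?_⟩
  · rwa [div_lt_iff₀ hv] at h1
  · rw [div_lt_iff₀ (by positivity)] at h2
    have h5 : (6/5:ℝ)^J * 2^J ≤ 2.5^J := by rw [← mul_pow]; gcongr; norm_num
    calc (6/5:ℝ)^(J+L) = (6/5)^J * (6/5)^L := pow_add _ _ _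
      _ ≤ (6/5)^J * (2^J * (64*κ^(L+3))) := by gcongr
      _ = ((6/5)^J * 2^J) * (64*κ^(L+3)) := by ring
      _ ≤ 2.5^J * (64*κ^(L+3)) := by gcongr
      _ = _ := by ring

lemma ev_ball {P : ℝ → Prop} {c : ℝ} (h : ∀ᶠ x in 𝓝 c, P x) : ∃ δ > 0, ∀ x, |x - c| < δ → P x := by
  obtain ⟨δ, h0, h1⟩ := Metric.eventually_nhds_iff.1 h
  exact ⟨δ, h0, fun x hx => h1 (by rwa [Real.dist_eq])⟩

lemma step_close {c v ρ ε : ℝ} (hc : Ok c) (hε : 0 < ε) (hs : |v| < qr c) (hρ : 0 < ρ) (hρ4 : ρ ≤ ε^2)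
    (t1 : wr c - |Fr c v| ≤ ρ) : |v^2 - (qr c)^2| < ε := by
  rw [hc.F_near hs.le, div_le_iff₀ hc.pos] at t1
  rw [← sq_abs v]
  set s := |v|
  have hs0 : 0 ≤ s := abs_nonneg _
  have hl := hc.lt
  have hql := hc.q_low
  have hqu := hc.q_up
  have r1 : (qr c - s)^2*0.9 ≤ ρ * 0.26 := by
    calc (qr c - s)^2*0.9 ≤ (qr c - s)^2*(s+2*qr c) := by
          gcongr; norm_num at hql ⊢; linarith
      _ ≤ ρ * c := t1
      _ ≤ ρ * 0.26 := by gcongr; norm_num at hl ⊢; linarith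
  have r2 : (qr c - s)^2 < ε^2 := by
    have : 0 < ε^2 := by positivity
    generalize (qr c - s)^2 = y at *
    norm_num at r1
    linarith
  have r3 : qr c - s < ε := lt_of_pow_lt_pow_left₀ 2 hε.le r2
  rw [abs_sub_comm, abs_of_nonneg (by nlinarith)]
  norm_num at hqu
  nlinarith

set_option maxHeartbeats 1000000 in
lemma step_main {c0 : ℝ} {m : ℕ} (hG : GG c0 m) {ε : ℝ} (hε : 0 < ε) (k : ℕ) :
    ∃ c' m', |c' - c0| < ε ∧ GG c' m' ∧ k ≤ m' ∧ |DV c' m * V c' m| < 1/2 ∧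
      ∃ n, k ≤ n ∧ |(V c' n)^2 - (qr c')^2| < ε := by
  obtain ⟨g1, g2, g3, g4, δG, hδG, g5⟩ := hG
  have hOk0 : Ok c0 := ⟨g1.le, g2⟩
  obtain ⟨κ0, hκ0, hκ0', hκ0l⟩ := exists_low (fun l => |(V c0 l)^2 - (qr c0)^2|) m
    (fun l hl => (g4 l hl.le).ne.2)
  have N1 : ∀ᶠ p : ℝ × ℝ in 𝓝 (c0, wr c0), ∀ l ∈ Iio m,
      κ0 < |((Fr p.1)^[l] p.2)^2 - (qr p.1)^2| := by
    rw [Filter.eventually_all_finite (finite_Iio m)]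
    intro l hl
    have hcont : Continuous (fun p : ℝ × ℝ => |((Fr p.1)^[l] p.2)^2 - (qr p.1)^2|) :=
      (((cont_iter continuous_fst continuous_snd l).pow 2).sub ((cont_q.comp continuous_fst).pow 2)).abs
    exact hcont.continuousAt.eventually (lt_mem_nhds (hκ0l l hl))
  obtain ⟨ε1, hε1, N1⟩ := Metric.eventually_nhds_iff.1 N1
  have hD : DV c0 m ≠ 0 := abs_pos.1 (g4 m le_rfl).ne.1
  have N2 := (hasDeriv_iter hOk0 m).eventually_ne hD (c := 0)
  rw [eventually_nhdsWithin_iff] at N2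
  obtain ⟨ε2, hε2, N2⟩ := ev_ball N2
  obtain ⟨ρ, hρ0, hρ1, hρ2, hρ3, hρ4⟩ : ∃ ρ : ℝ, 0 < ρ ∧ ρ ≤ ε1/4 ∧ ρ < ε2 ∧ ρ ≤ 0.9 ∧ ρ ≤ ε^2 := by
    refine ⟨min (min (ε1/4) (ε2/2)) (min 0.9 (ε^2)), ?_, ?_, ?_, ?_, ?_⟩
    · have : (0:ℝ) < 0.9 := by norm_num
      positivity
    · exact (min_le_left _ _).trans (min_le_left _ _)
    · exact ((min_le_left _ _).trans (min_le_right _ _)).trans_lt (by linarith)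
    · exact (min_le_right _ _).trans (min_le_left _ _)
    · exact (min_le_right _ _).trans (min_le_right _ _)
  have hne : (Fr c0)^[m] (wr c0 - ρ) ≠ 0 := by
    apply N2 (wr c0 - ρ)
    · rw [sub_sub_cancel_left, abs_neg, abs_of_pos hρ0]; exact hρ2
    · simp [hρ0.ne']
  set κ' := |(Fr c0)^[m] (wr c0 - ρ)|/2 with hκ'
  have hκ'0 : 0 < κ' := by have := abs_pos.2 hne; positivity
  have E1 : ∀ᶠ c in 𝓝 c0, κ' < |(Fr c)^[m] (wr c - ρ)| := by
    have hcont : Continuous (fun c => |(Fr c)^[m] (wr c - ρ)|) :=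
      (cont_iter continuous_id (cont_w.sub continuous_const) m).abs
    exact hcont.continuousAt.eventually (lt_mem_nhds (by rw [hκ']; linarith [abs_pos.2 hne]))
  have E2 : ∀ᶠ c in 𝓝 c0, |wr c - wr c0| < ε1/4 := by
    have hcont : Continuous (fun c => |wr c - wr c0|) := (cont_w.sub continuous_const).abs
    exact hcont.continuousAt.eventually (gt_mem_nhds (by simp; linarith))
  have E3 : ∀ᶠ c in 𝓝 c0, ∀ n ∈ Iic m, II c n := by
    rw [Filter.eventually_all_finite (finite_Iic m)]
    intro n hn
    exact (open_II n).mem_nhds (g4 n hn)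
  have E4 : ∀ᶠ c in 𝓝 c0, |DV c m * V c m| < 1/2 := by
    have hcont : Continuous (fun c => |DV c m * V c m|) := ((cont_DV m).mul (cont_V m)).abs
    exact hcont.continuousAt.eventually (gt_mem_nhds (by simp [g3]))
  obtain ⟨δ1, hδ1, E⟩ := ev_ball (E1.and (E2.and (E3.and E4)))
  obtain ⟨δ, hδ0, d1, d2, d3, d4, d5⟩ : ∃ δ : ℝ, 0 < δ ∧ δ < δ1 ∧ δ < ε ∧ δ < δG ∧ δ < c0 - 1/4 ∧ δ < ε1 := by
    have hc : 0 < c0 - 1/4 := by linarith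
    obtain ⟨δ, h0, h1⟩ := exists_between (show 0 < min δ1 (min ε (min δG (min (c0-1/4) ε1))) by positivity)
    simp only [lt_min_iff] at h1
    exact ⟨δ, h0, h1.1, h1.2.1, h1.2.2.1, h1.2.2.2.1, h1.2.2.2.2⟩
  have near : ∀ c ∈ Icc (c0-δ) c0, |c - c0| ≤ δ := by
    intro c hc
    rw [abs_le]; constructor <;> linarith [hc.1, hc.2]
  have hOk : ∀ c ∈ Icc (c0-δ) c0, Ok c := fun c hc => ⟨by linarith [hc.1], hc.2.trans g2⟩
  obtain ⟨J1, -, hJ1, -⟩ := exists_J 1 κ' one_pos hκ'0 0 0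
  set κ := min κ0 (0.02/10^(m+J1+1)) with hκ
  have hκpos : 0 < κ := lt_min hκ0 (by positivity)
  have hva : 0 < |V (c0-δ) m| := abs_pos.2 (g5 _ (by linarith) (by linarith))
  obtain ⟨J, hJa, hJb, hJc⟩ := exists_J κ _ hκpos hva (m+J1+3) (max k (J1+3))
  have hJk : k ≤ J := (le_max_left _ _).trans hJa
  have hJJ : J1 + 3 ≤ J := (le_max_right _ _).trans hJa
  obtain ⟨cs, hcs, s1, s2, s3⟩ := step_cstar (c0-δ) c0 (by linarith) hOk m J g3 hJb
  obtain ⟨c', hc', t1, t2, t3, t4⟩ := step_cprime cs c0 hcs.2 (fun c hc => hOk c ⟨hcs.1.trans hc.1, hc.2⟩) m J J1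
    g3 hJJ ρ κ' hρ0 hρ3 s1 s2
    (fun c hc => (E c ((near c ⟨hcs.1.trans hc.1, hc.2⟩).trans_lt d1)).1.le) hJ1
  have hc'I : c' ∈ Icc (c0-δ) c0 := ⟨hcs.1.trans hc'.1.le, hc'.2⟩
  have hc'n := near c' hc'I
  have hOk' := hOk c' hc'I
  obtain ⟨e1, e2, e3, e4⟩ := E c' (hc'n.trans_lt d1)
  have hlt := s3 c' hc'
  have hκ1 : κ ≤ 1/100 := (min_le_left _ _).trans hκ0'
  have hkap := step_kappa hOk' m J J1 κ ρ hκ1 (min_le_right _ _) hJJ hlt t1 t2 t3 (by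
    intro x hx l hl
    refine (min_le_left _ _).trans (N1 (y := (c', x)) ?_ l hl).le
    rw [Prod.dist_eq]
    refine max_lt ?_ ?_
    · rw [Real.dist_eq]; exact hc'n.trans_lt d5
    · rw [Real.dist_eq]
      calc |x - wr c0| ≤ |x - wr c'| + |wr c' - wr c0| := abs_sub_le _ _ _
        _ < ε1 := by linarith)
  have hII := step_II hOk' m J (m+J1+3) κ hκpos (by linarith) (e3 m self_mem_Iic) hlt hkap hJc
  set M := m+J+1+(m+J1+1) with hM
  have hMe : m+J+(m+J1+3) = M + 1 := by rw [hM]; ring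
  have e33 : (√3:ℝ)^2 = 3 := Real.sq_sqrt (by norm_num)
  have hq := hOk'.q_pos
  refine ⟨c', M+1, hc'n.trans_lt d2, ⟨by linarith [hc'I.1], hOk'.2, ?_, ?_, ?_⟩, by omega, e4, m+J, by omega, ?_⟩
  · rw [V_succ, hOk'.F_eq, ← sq_abs (V c' M), t3, mul_pow, e33]; simp
  · intro n hn
    rcases le_total n m with h | h
    · exact e3 n h
    · exact hII n h (by omega)
  · have hnz : V c' M ≠ 0 := by
      apply abs_pos.1; rw [t3]
      have := sqrt3_low
      positivity
    obtain ⟨δ2, hδ2, h2⟩ := ev_ball ((cont_V M).continuousAt.eventually_ne hnz)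
    refine ⟨min δ2 (c' - cs), lt_min hδ2 (by linarith [hc'.1]), fun c h3 h4 => ?_⟩
    have h5 : c' - δ2 < c := lt_of_le_of_lt (by linarith [min_le_left δ2 (c'-cs)]) h3
    have h6 : cs < c := lt_of_le_of_lt (by linarith [min_le_right δ2 (c'-cs)]) h3
    have h7 := h2 c (by rw [abs_lt]; constructor <;> linarith)
    have h8 := t4 c ⟨h6.le, h4⟩
    have hOkc := hOk c ⟨hcs.1.trans h6.le, h4.le.trans hc'.2⟩
    rw [V_succ, hOkc.F_eq]
    have h9 : (V c M)^2 < 3*(qr c)^2 := by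
      rw [← sq_abs, ← e33, ← mul_pow]
      gcongr
    have hp := hOkc.pos
    exact div_ne_zero (mul_ne_zero h7 (by linarith [h9] |> fun h : (V c M)^2 - 3*(qr c)^2 < 0 => h.ne)) hp.ne'
  · exact step_close hOk' hε (hlt J le_rfl) hρ0 hρ4 (by rw [← V_succ]; exact t1)

lemma base_sq {c u : ℝ} (hc : Ok c) (h : √3 * qr c ≤ u) : 3*(qr c)^2 ≤ u^2 ∧ 0.84 ≤ u := by
  have e33 : (√3:ℝ)^2 = 3 := Real.sq_sqrt (by norm_num)
  have h1 := hc.q_low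
  have h2 := sqrt3_low
  constructor
  · rw [← e33, ← mul_pow]
    have := hc.q_nonneg
    gcongr
  · refine le_trans ?_ h
    calc (0.84:ℝ) ≤ 1.7 * 0.4999 := by norm_num
      _ ≤ _ := by gcongr

lemma base_grow {c : ℝ} (hc : Ok c) (h : ∀ l, √3 * qr c ≤ V c l) (n : ℕ) : 5^n*(1 - wr c) ≤ 1 - V c n := by
  induction n with
  | zero => simp [V_zero]
  | succ n ih =>
    obtain ⟨h1, h2⟩ := base_sq hc (h n)
    have h3 := hc.qsq_low
    have h4 := hc.lt
    have h0 := hc.pos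
    have h5 := (abs_le.1 (hc.V_le n)).2
    have e1 : 1 - Fr c (V c n) = (1-V c n)*((V c n)^2+V c n+c)/c := by
      unfold Fr; rw [hc.max]; field_simp; ring
    rw [V_succ, e1, le_div_iff₀ h0]
    have h6 : 5*c ≤ (V c n)^2+V c n+c := by
      generalize (V c n)^2 = y at *
      norm_num at h2 h3 h4; linarith
    have h7 : (1 - V c n)*(5*c) ≤ (1-V c n)*((V c n)^2+V c n+c) :=
      mul_le_mul_of_nonneg_left h6 (by linarith)
    refine le_trans ?_ h7
    rw [pow_succ]
    nlinarith

lemma base_exists {c : ℝ} (hc : Ok c) (h : 1/4 < c) : ∃ l, V c l < √3 * qr c := by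
  by_contra hcon
  push Not at hcon
  have hw : 0 < 1 - wr c := by linarith [hc.w_lt h]
  obtain ⟨n, hn⟩ := ((tendsto_pow_atTop_atTop_of_one_lt (r := (5:ℝ)) (by norm_num)).eventually_gt_atTop (1/(1-wr c))).exists
  rw [div_lt_iff₀ hw] at hn
  have := base_grow hc hcon n
  have h2 := (base_sq hc (hcon n)).2
  norm_num at h2
  linarith

lemma base_quarter (n : ℕ) : V (1/4) n = 1 ∧ qr (1/4) = 1/2 := by
  have hq : qr (1/4) = 1/2 := by
    unfold qr
    rw [show (1 - 1/4)/3 = ((1/2:ℝ))^2 by norm_num]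
    exact Real.sqrt_sq (by norm_num)
  refine ⟨?_, hq⟩
  induction n with
  | zero => rw [V_zero]; unfold wr; rw [hq]; norm_num
  | succ n ih => rw [V_succ, ih]; unfold Fr; norm_num

lemma base_II {c : ℝ} (hc : Ok c) (l : ℕ) (h : ∀ j ≤ l, √3 * qr c ≤ V c j) (h0 : V c (l+1) = 0) :
    ∀ n ≤ l+1, II c n := by
  have hq := hc.qsq_low
  have hcl := hc.lt
  have hcp := hc.pos
  have hD : ∀ n ≤ l+1, (5:ℝ)^n ≤ |DV c n| := by
    intro n
    induction n with
    | zero => intro _; simp [DV]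
    | succ n ih =>
      intro hn
      have h1 := ih (by omega)
      have h2 := (base_sq hc (h n (by omega))).1
      rw [DV_succ, abs_mul, hc.max, pow_succ]
      gcongr
      refine le_trans ?_ (le_abs_self _)
      rw [le_div_iff₀ hcp]
      norm_num at hq hcl
      linarith
  intro n hn
  have h1 := hD n hn
  unfold II
  have h2 : (0.2499:ℝ) ≤ |(V c n)^2 - (qr c)^2| := by
    rcases Nat.lt_or_eq_of_le hn with h3 | rfl
    · have := (base_sq hc (h n (by omega))).1
      refine le_trans ?_ (le_abs_self _)
      linarith
    · rw [h0]
      rw [abs_sub_comm]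
      refine le_trans ?_ (le_abs_self _)
      linarith
  calc 1/100*(6/5:ℝ)^n ≤ 1/100*5^n := by gcongr; norm_num
    _ < 5^n*0.2499^3 := by
      have : (0:ℝ) < 5^n := by positivity
      norm_num
      linarith
    _ ≤ _ := by gcongr

lemma base_main : ∃ c m, GG c m := by
  set b : ℝ := 1/4 + 1/10^23 with hb
  have hbpos : 1/4 < b := by rw [hb]; norm_num
  have hOk : ∀ c ∈ Icc (1/4) b, Ok c := fun c hc => hc
  obtain ⟨i0, hi0⟩ := base_exists (hOk b ⟨hbpos.le, le_rfl⟩) hbpos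
  set T : Set ℝ := Icc (1/4) b ∩ ⋃ l ∈ Iic i0, {c | V c l ≤ √3 * qr c} with hT
  have hclosed : IsClosed (⋃ l ∈ Iic i0, {c | V c l ≤ √3 * qr c}) := by
    apply (finite_Iic i0).isClosed_biUnion
    intro l _
    exact isClosed_le (cont_V _) (continuous_const.mul cont_q)
  have hcomp : IsCompact T := isCompact_Icc.inter_right hclosed
  have hne : T.Nonempty := by
    refine ⟨b, ⟨hbpos.le, le_rfl⟩, ?_⟩
    simp only [mem_iUnion]
    exact ⟨i0, self_mem_Iic, hi0.le⟩
  obtain ⟨c, hcT, hmin⟩ := hcomp.exists_isLeast hne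
  obtain ⟨hcI, hcU⟩ := hcT
  simp only [mem_iUnion] at hcU
  obtain ⟨l1, hl1, hl1'⟩ := hcU
  have hex : ∃ l, V c l ≤ √3 * qr c := ⟨l1, hl1'⟩
  classical
  set l := Nat.find hex with hl
  have hl2 : V c l ≤ √3 * qr c := Nat.find_spec hex
  have hl3 : ∀ j < l, √3 * qr c < V c j := fun j hj => not_le.1 (Nat.find_min hex hj)
  have hli : l ≤ i0 := (Nat.find_min' hex hl1').trans hl1
  have hc4 : 1/4 < c := by
    refine lt_of_le_of_ne hcI.1 (fun h => ?_)
    rw [← h, (base_quarter l).1, (base_quarter l).2] at hl2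
    have := sqrt3_up
    norm_num at this
    linarith
  have hleft : ∀ c' ∈ Ico (1/4) c, √3 * qr c' < V c' l := by
    intro c' hc'
    by_contra hcon
    have : c' ∈ T := by
      refine ⟨⟨hc'.1, hc'.2.le.trans hcI.2⟩, ?_⟩
      simp only [mem_iUnion]
      exact ⟨l, hli, not_lt.1 hcon⟩
    linarith [hmin this, hc'.2]
  have heq : V c l = √3 * qr c := by
    refine le_antisymm hl2 ?_
    by_contra hcon
    push Not at hcon
    obtain ⟨δ, hδ, h⟩ := ev_ball ((isOpen_lt (cont_V l) (continuous_const.mul cont_q)).mem_nhds hcon)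
    obtain ⟨c', h1, h2⟩ := exists_between (show max (c-δ) (1/4) < c from max_lt (by linarith) hc4)
    have h3 := (le_max_left _ _).trans_lt h1
    have h4 := (le_max_right _ _).trans_lt h1
    have h5 : V c' l < √3 * qr c' := h c' (by rw [abs_lt]; constructor <;> linarith)
    linarith [hleft c' ⟨h4.le, h2⟩]
  have hOkc := hOk c hcI
  have e33 : (√3:ℝ)^2 = 3 := Real.sq_sqrt (by norm_num)
  have h0 : V c (l+1) = 0 := by
    rw [V_succ, hOkc.F_eq, heq, mul_pow, e33]; simp
  refine ⟨c, l+1, hc4, hcI.2, h0, base_II hOkc l (fun j hj => ?_) h0, c - 1/4, by linarith, fun c' h1 h2 => ?_⟩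
  · rcases Nat.lt_or_eq_of_le hj with h | rfl
    · exact (hl3 j h).le
    · exact heq.ge
  · have hI : c' ∈ Ico (1/4) c := ⟨by linarith, h2⟩
    have hO := hOk c' ⟨hI.1, h2.le.trans hcI.2⟩
    have h3 := hleft c' hI
    have h4 : 3*(qr c')^2 < (V c' l)^2 := by
      rw [← e33, ← mul_pow]
      have := hO.q_nonneg
      gcongr
    have h5 := (base_sq hO h3.le).2
    rw [V_succ, hO.F_eq]
    have hp := hO.pos
    have h6 : 0 < V c' l := lt_of_lt_of_le (by norm_num) h5
    have h7 : 0 < (V c' l)^2 - 3*(qr c')^2 := by linarith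
    positivity

def RR (k : ℕ) : Set ℝ := {c | (∀ n ∈ Iic k, II c n) ∧ (∃ p ∈ Ici k, |DV c p * V c p| < 1/2) ∧
  ∃ n ∈ Ici k, |(V c n)^2 - (qr c)^2| < 1/((k:ℝ)+1)}

lemma RR_open (k : ℕ) : IsOpen (RR k) := by
  have e : RR k = (⋂ n ∈ Iic k, {c | II c n}) ∩ ((⋃ p ∈ Ici k, {c | |DV c p * V c p| < 1/2}) ∩
      ⋃ n ∈ Ici k, {c | |(V c n)^2 - (qr c)^2| < 1/((k:ℝ)+1)}) := by
    ext c; simp [RR]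
  rw [e]
  refine ((finite_Iic k).isOpen_biInter fun n _ => open_II n).inter (IsOpen.inter ?_ ?_)
  · exact isOpen_biUnion fun p _ => isOpen_lt ((cont_DV p).mul (cont_V p)).abs continuous_const
  · exact isOpen_biUnion fun n _ => isOpen_lt (((cont_V n).pow 2).sub (cont_q.pow 2)).abs continuous_const

def SS : Set ℝ := {c | ∃ m, GG c m}

lemma RR_dense (k : ℕ) {c : ℝ} (hc : c ∈ SS) {ε : ℝ} (hε : 0 < ε) : ∃ c' ∈ SS ∩ RR k, |c' - c| < ε := by
  obtain ⟨m, hm⟩ := hc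
  obtain ⟨c1, m1, a1, a2, a3, -⟩ := step_main hm (half_pos hε) k
  have hp : (0:ℝ) < 1/((k:ℝ)+1) := by positivity
  obtain ⟨c2, m2, b1, b2, b3, b4, n, b5, b6⟩ := step_main a2 (lt_min (half_pos hε) hp) k
  refine ⟨c2, ⟨⟨m2, b2⟩, fun n hn => b2.2.2.2.1 n (le_trans hn b3), ⟨m1, a3, b4⟩, n, b5,
    b6.trans_le (min_le_right _ _)⟩, ?_⟩
  have := b1.trans_le (min_le_left _ _)
  calc |c2 - c| ≤ |c2 - c1| + |c1 - c| := abs_sub_le _ _ _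
    _ < ε := by linarith

lemma exists_param : ∃ c, Ok c ∧ ∀ k, c ∈ RR k := by
  obtain ⟨c0, m0, h0⟩ := base_main
  have hcl : IsClosed (closure SS) := isClosed_closure
  have : CompleteSpace (closure SS) := hcl.completeSpace_coe
  have hdense : Dense (⋂ k : ℕ, ((↑) ⁻¹' RR k : Set (closure SS))) := by
    apply dense_iInter_of_isOpen_nat
    · exact fun k => (RR_open k).preimage continuous_subtype_val
    · intro k x
      rw [Metric.mem_closure_iff]
      intro ε hε
      obtain ⟨s, hs, hd⟩ := Metric.mem_closure_iff.1 x.2 (ε/2) (half_pos hε)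
      obtain ⟨c', ⟨h1, h2⟩, h3⟩ := RR_dense k hs (half_pos hε)
      refine ⟨⟨c', subset_closure h1⟩, h2, ?_⟩
      rw [Subtype.dist_eq]
      have : dist s c' < ε/2 := by rw [dist_comm, Real.dist_eq]; exact h3
      calc dist (x:ℝ) c' ≤ dist (x:ℝ) s + dist s c' := dist_triangle _ _ _
        _ < ε := by linarith
  have : Nonempty (closure SS) := ⟨⟨c0, subset_closure ⟨m0, h0⟩⟩⟩
  obtain ⟨x, hx⟩ := hdense.nonempty
  refine ⟨x, ?_, fun k => mem_iInter.1 hx k⟩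
  have : closure SS ⊆ Icc (1/4) (1/4+1/10^23) :=
    closure_minimal (fun c hc => by obtain ⟨m, hm⟩ := hc; exact ⟨hm.1.le, hm.2.1⟩) isClosed_Icc
  exact this x.2

lemma setup_of {c : ℝ} (hc : Ok c) (h : ∀ n, II c n) :
    Setup c (qr c) (V c) (fun n => (1/(8*10^11))*(6/5)^n/|DV c n|) where
  hc1 := hc.1
  hc2 := hc.2
  hq := hc.q_sq
  hq0 := hc.q_pos
  v0 := by rw [V_zero, hc.w_eq]
  vs n := by rw [V_succ]; unfold Fr; rw [hc.max]
  hv n := hc.V_le n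
  A0 := by simp [DV]
  Apos n := by have := (h n).ne.1; positivity
  As n := by
    have h1 := (h n).ne.1
    have h2 := (h n).ne.2
    have hp := hc.pos
    rw [DV_succ, abs_mul, abs_div, abs_mul, hc.max, abs_of_pos hp, abs_of_pos (show (0:ℝ) < 3 by norm_num), pow_succ]
    field_simp
    ring
  hA n := by
    have h1 := (h n).ne.1
    have h3 := h n
    unfold II at h3
    rw [div_pow |V c n ^ 2 - qr c ^ 2|]
    rw [show 8*((1/(8*10^11))*(6/5:ℝ)^n/|DV c n|) = ((1/10^11)*(6/5:ℝ)^n)/|DV c n| by ring]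
    rw [div_le_iff₀ h1]
    set y := |DV c n| * |(V c n)^2 - (qr c)^2|^3
    rw [show |(V c n)^2 - (qr c)^2|^3/1000^3*|DV c n| = y/1000^3 by ring]
    norm_num
    linarith

def gR (c z : ℝ) : ℝ := 1 + (z - c)^2 * (z - 1) / c^2
def gD (c z : ℝ) : ℝ := 3*(z - c)*(z - (2+c)/3) / c^2

lemma gR_deriv (c z : ℝ) : HasDerivAt (gR c) (gD c z) z := by
  have h : HasDerivAt (gR c) ((2*(z-c)*1*(z-1) + (z-c)^2*1)/c^2) z := by
    unfold gR
    have h1 := (((hasDerivAt_id z).sub_const c).pow 2).mul ((hasDerivAt_id z).sub_const 1)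
    have h2 := (h1.div_const (c^2)).const_add 1
    simpa using h2
  convert h using 1
  unfold gD; ring

lemma gR_semi {c : ℝ} (hc : Ok c) (u : ℝ) : gR c (1 - u^2) = 1 - (Fr c u)^2 := by
  have := hc.pos.ne'
  unfold gR Fr
  rw [hc.max]
  field_simp
  ring

lemma gR_crit {c : ℝ} (hc : Ok c) : gR c ((2+c)/3) = 1 - (V c 0)^2 := by
  have h : (2+c)/3 = 1 - (qr c)^2 := by linarith [hc.q_sq]
  rw [h, gR_semi hc, V_zero, hc.F_eq, hc.w_eq]
  ring

lemma gR_iter {c : ℝ} (hc : Ok c) (n : ℕ) : (gR c)^[n] (1 - (V c 0)^2) = 1 - (V c n)^2 := by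
  induction n with
  | zero => rfl
  | succ n ih => rw [Function.iterate_succ_apply', ih, gR_semi hc, V_succ]

def gDD (c : ℝ) (n : ℕ) : ℝ := ∏ j ∈ Finset.range n, gD c (1 - (V c j)^2)

lemma gR_iter_deriv {c : ℝ} (hc : Ok c) (n : ℕ) : HasDerivAt ((gR c)^[n]) (gDD c n) (1 - (V c 0)^2) := by
  induction n with
  | zero => simpa [gDD] using hasDerivAt_id _
  | succ n ih =>
    rw [Function.iterate_succ']
    have h : gDD c (n+1) = gD c (1 - (V c n)^2) * gDD c n := by
      unfold gDD; rw [Finset.prod_range_succ, mul_comm]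
    rw [h]
    refine HasDerivAt.comp _ ?_ ih
    rw [gR_iter hc]
    exact gR_deriv c _

lemma gDD_eq {c : ℝ} (hc : Ok c) (n : ℕ) : gDD c n * V c 0 = DV c n * V c n := by
  induction n with
  | zero => simp [gDD, DV]
  | succ n ih =>
    have h : gDD c (n+1) = gDD c n * gD c (1 - (V c n)^2) := Finset.prod_range_succ _ _
    have h2 : gD c (1 - (V c n)^2) * V c n = (3*((V c n)^2 - (qr c)^2) / c) * V c (n+1) := by
      rw [V_succ]
      unfold gD Fr
      rw [hc.max]
      have hq : (qr c)^2 = (1-c)/3 := by linarith [hc.q_sq]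
      rw [hq]
      have := hc.pos.ne'
      field_simp
      ring
    rw [h, DV_succ, hc.max, mul_right_comm, ih]
    linear_combination DV c n * h2

def gP (c : ℝ) : Polynomial ℝ :=
  Polynomial.C (1/c^2) * Polynomial.X^3 + Polynomial.C (-(1+2*c)/c^2) * Polynomial.X^2 +
    Polynomial.C ((c^2+2*c)/c^2) * Polynomial.X + Polynomial.C 0

lemma gP_eval {c : ℝ} (hc : c ≠ 0) : (fun y => (gP c).eval y) = gR c := by
  funext y
  simp only [gP, gR, Polynomial.eval_add, Polynomial.eval_mul, Polynomial.eval_C, Polynomial.eval_pow, Polynomial.eval_X]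
  field_simp
  ring

lemma gP_aeval {c : ℝ} (hc : c ≠ 0) : (fun z : ℂ => Polynomial.aeval z (gP c)) = gC c := by
  funext y
  have : (c:ℂ) ≠ 0 := by exact_mod_cast hc
  simp only [gP, gC, map_add, map_mul, map_pow, Polynomial.aeval_C, Polynomial.aeval_X]
  simp only [Complex.coe_algebraMap]
  push_cast
  field_simp
  ring

lemma gP_degree {c : ℝ} (hc : c ≠ 0) : (gP c).natDegree = 3 :=
  Polynomial.natDegree_cubic (by positivity)

lemma gR_maps {c : ℝ} (hc : Ok c) {z : ℝ} (hz : z ∈ Icc (0:ℝ) 1) : gR c z ∈ Icc (0:ℝ) 1 := by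
  have hp := hc.pos
  have h1 := hc.1
  have e1 : gR c z = z*((z-(c+1/2))^2+(c-1/4))/c^2 := by
    unfold gR; field_simp; ring
  have e2 : 1 - gR c z = (z-c)^2*(1-z)/c^2 := by unfold gR; ring
  constructor
  · rw [e1]
    have a := hz.1
    have b : 0 ≤ c - 1/4 := by linarith
    positivity
  · have : 0 ≤ 1 - gR c z := by
      rw [e2]
      have : 0 ≤ 1 - z := by linarith [hz.2]
      positivity
    linarith

end

/-- Theorem A: there exists a real cubic polynomial, mapping `[0,1]` into itself, which
satisfies the Exponential Shrinking of components condition (hence TCE) at every point of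
`[0,1]`, but which has a recurrent critical point that is not Collet–Eckmann, hence is not
Recurrent Collet–Eckmann. -/
theorem tce_not_rce :
    ∃ g : Polynomial ℝ,
      g.natDegree = 3 ∧
      (∀ x ∈ Icc (0:ℝ) 1, g.eval x ∈ Icc (0:ℝ) 1) ∧
      g.eval 0 = 0 ∧
      ∃ c₁ c₂ : ℝ,
        0 < c₁ ∧ c₁ < c₂ ∧ c₂ < 1 ∧
        -- exactly two critical points, c₁ < c₂, both in (0,1)
        {x : ℝ | deriv (fun y => g.eval y) x = 0} = {c₁, c₂} ∧
        -- (i) c₁ is non-recurrent: g(c₁) = 1, g(1) = 1 and |g'(1)| > 1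
        g.eval c₁ = 1 ∧ g.eval 1 = 1 ∧ 1 < |deriv (fun y => g.eval y) 1| ∧
        ¬ Recurrent (fun y => g.eval y) c₁ ∧
        -- (ii) c₂ is recurrent
        Recurrent (fun y => g.eval y) c₂ ∧
        -- (iii) c₂ is not Collet–Eckmann; indeed |(g^p)'(g c₂)| < 1 for infinitely many p
        ¬ ColletEckmann (fun y => g.eval y) c₂ ∧
        (∀ N : ℕ, ∃ p : ℕ, N ≤ p ∧ |deriv ((fun y => g.eval y)^[p]) (g.eval c₂)| < 1) ∧
        -- (iv) Exponential Shrinking of components at every point of [0,1],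
        -- for g viewed as a polynomial map of ℂ
        ∃ lam : ℝ, 1 < lam ∧ ∃ r : ℝ, 0 < r ∧
          ∀ x ∈ Icc (0:ℝ) 1, ∀ n : ℕ, ∀ w : ℂ,
            w ∈ (fun z : ℂ => Polynomial.aeval z g)^[n] ⁻¹' Metric.ball (x : ℂ) r →
            Metric.diam
              (connectedComponentIn
                ((fun z : ℂ => Polynomial.aeval z g)^[n] ⁻¹' Metric.ball (x : ℂ) r) w)
              < lam ^ (-(n:ℤ)) := by
  obtain ⟨c, hc, hR⟩ := exists_param
  have hII : ∀ n, II c n := fun n => (hR n).1 n self_mem_Iic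
  have S := setup_of hc hII
  have hp := hc.pos
  have hl := hc.lt
  have hne := hp.ne'
  norm_num at hl
  have hcrit := gR_crit hc
  have hev : ∀ y, (gP c).eval y = gR c y := fun y => congrFun (gP_eval hne) y
  have hone : gR c 1 = 1 := by unfold gR; simp
  have hgc : gR c c = 1 := by unfold gR; simp
  have hder : ∀ z, deriv (gR c) z = gD c z := fun z => (gR_deriv c z).deriv
  have hsmall : ∀ N : ℕ, ∃ p : ℕ, N ≤ p ∧ |deriv ((gR c)^[p]) (gR c ((2+c)/3))| < 1 := by
    intro N
    obtain ⟨p, h1, h2⟩ := (hR N).2.1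
    refine ⟨p, h1, ?_⟩
    rw [hcrit, (gR_iter_deriv hc p).deriv]
    rw [← gDD_eq hc, abs_mul, V_zero] at h2
    have h3 := hc.w_low
    norm_num at h3
    have h4 := le_abs_self (wr c)
    have h5 := abs_nonneg (gDD c p)
    nlinarith
  refine ⟨gP c, gP_degree hne, ?_, ?_, c, (2+c)/3, hp, by linarith, by linarith, ?_⟩
  · intro x hx
    rw [hev]; exact gR_maps hc hx
  · simp [gP]
  simp only [gP_eval hne, gP_aeval hne, hev]
  refine ⟨?_, hgc, hone, ?_, ?_, ?_, ?_, hsmall, ?_⟩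
  · ext x
    simp only [mem_setOf_eq, mem_insert_iff, mem_singleton_iff]
    rw [hder]
    unfold gD
    rw [div_eq_zero_iff, mul_eq_zero, mul_eq_zero, sub_eq_zero, sub_eq_zero]
    simp [hne]
  · rw [hder]
    unfold gD
    refine lt_of_lt_of_le ?_ (le_abs_self _)
    rw [lt_div_iff₀ (by positivity)]
    nlinarith
  · intro h
    obtain ⟨n, -, h1, h2⟩ := h (1/2) (by norm_num) 1
    obtain ⟨n, rfl⟩ : ∃ k, n = k + 1 := ⟨n-1, by omega⟩
    rw [Function.iterate_succ_apply, hgc, Function.iterate_fixed hone, abs_of_nonneg (by linarith)] at h2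
    linarith
  · intro ε hε N
    obtain ⟨k0, hk0⟩ := exists_nat_one_div_lt hε
    obtain ⟨n, h1, h2⟩ := (hR (max N k0)).2.2
    have h1' : max N k0 ≤ n := h1
    have hN : N ≤ n := (le_max_left _ _).trans h1'
    refine ⟨n+1, by omega, by omega, ?_⟩
    rw [Function.iterate_succ_apply, hcrit, gR_iter hc]
    have e : 1 - (V c n)^2 - (2+c)/3 = -((V c n)^2 - (qr c)^2) := by linarith [hc.q_sq]
    rw [e, abs_neg]
    refine h2.trans (lt_of_le_of_lt ?_ hk0)
    have : (k0:ℝ) ≤ ((max N k0 : ℕ):ℝ) := by exact_mod_cast le_max_right _ _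
    gcongr
  · rintro ⟨C, hC, lam, hlam, h⟩
    obtain ⟨N, hN⟩ := Filter.eventually_atTop.1
      ((tendsto_pow_atTop_atTop_of_one_lt hlam).eventually_gt_atTop (1/C))
    obtain ⟨p, h1, h2⟩ := hsmall N
    have h3 := hN p h1
    rw [div_lt_iff₀ hC] at h3
    have h4 := h p
    linarith
  · refine ⟨1.02, by norm_num, 1/10^172*(1/10^171), by positivity, ?_⟩
    intro x hx n w hw
    exact esc_g S x hx n w hw
end
end

section
/- Let F : [α,β] → C^1([0,1],[0,1]) be a family of l-modal maps, γ₀ ∈ [α,β], and let r₀ be a periodic point of f_{γ₀} of period n ≥ 1 that is not neutral, i.e. |(f_{γ₀}^n)'(r₀)| ≠ 1. Then there exist a connected neighborhood J ⊆ [α,β] of γ₀ and a continuous map r : J → [0,1] with r(γ₀) = r₀ such that for every γ ∈ J, r(γ) is a periodic point of f_γ of period n with |(f_γ^n)'(r(γ))| ≠ 1. Moreover, provided r(γ) is not super-attracting for any γ ∈ J (its orbit contains no turning point of f_γ), the itinerary ι(r(γ)) is the same for all γ ∈ J. -/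
open Set Metric

noncomputable section

/-- Endpoints of the laps of an `l`-modal map with turning points `c`. -/
def lapPts (l : ℕ) (c : Fin l → ℝ) (i : Fin (l + 2)) : ℝ :=
  if h0 : (i : ℕ) = 0 then 0
  else if hl : (i : ℕ) = l + 1 then 1
  else c ⟨(i : ℕ) - 1, by have := i.isLt; omega⟩

/-- The `i`-th (closed) lap of an `l`-modal map with turning points `c`. -/
def lap (l : ℕ) (c : Fin l → ℝ) (i : Fin (l + 1)) : Set ℝ :=
  Icc (lapPts l c i.castSucc) (lapPts l c i.succ)

/-- `f` is an `l`-modal map of `[0,1]` with turning points `c 0 < … < c (l-1)`. -/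
def IsLModal (l : ℕ) (f : ℝ → ℝ) (c : Fin l → ℝ) : Prop :=
  StrictMono c ∧ (∀ i, c i ∈ Ioo (0:ℝ) 1) ∧
  MapsTo f (Icc 0 1) (Icc 0 1) ∧
  f 0 ∈ ({0, 1} : Set ℝ) ∧ f 1 ∈ ({0, 1} : Set ℝ) ∧
  ∃ s : Fin (l + 1) → Bool,
    (∀ i : Fin l, s i.castSucc ≠ s i.succ) ∧
    (∀ i, if s i then StrictMonoOn f (lap l c i) else StrictAntiOn f (lap l c i))

/-- `f` is a `C¹` `l`-modal map with turning points `c`. -/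
def IsC1LModal (l : ℕ) (f : ℝ → ℝ) (c : Fin l → ℝ) : Prop :=
  IsLModal l f c ∧ ContDiff ℝ 1 f ∧
  ∀ x ∈ Icc (0:ℝ) 1, (∀ i, x ≠ c i) → deriv f x ≠ 0

/-- Continuity of the family `γ ↦ F γ` on `[a,b]` with respect to the `C¹` topology. -/
def C1FamilyOn (F : ℝ → ℝ → ℝ) (a b : ℝ) : Prop :=
  ∀ γ₀ ∈ Icc a b, ∀ ε > (0:ℝ), ∃ δ > (0:ℝ), ∀ γ ∈ Icc a b, |γ - γ₀| < δ →
    ∀ x ∈ Icc (0:ℝ) 1, |F γ x - F γ₀ x| < ε ∧ |deriv (F γ) x - deriv (F γ₀) x| < ε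

/-- The index of the lap containing `x` (for `x` not a turning point): the number of
turning points lying below `x`. -/
def lapIdx (l : ℕ) (c : Fin l → ℝ) (x : ℝ) : ℕ :=
  (Finset.univ.filter fun i => c i < x).card

theorem aux_joint (G : ℝ → ℝ → ℝ) (a b : ℝ)
    (h : ∀ γ₀ ∈ Icc a b, ∀ ε > (0:ℝ), ∃ δ > (0:ℝ), ∀ γ ∈ Icc a b, |γ - γ₀| < δ →
      ∀ x ∈ Icc (0:ℝ) 1, |G γ x - G γ₀ x| < ε)
    (hc : ∀ γ ∈ Icc a b, Continuous (G γ)) :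
    ContinuousOn (fun p : ℝ × ℝ => G p.1 p.2) (Icc a b ×ˢ Icc (0:ℝ) 1) := by
  rw [Metric.continuousOn_iff]
  rintro ⟨γ₀, x₀⟩ ⟨hγ, hx⟩ ε hε
  obtain ⟨δ, hδ, h1⟩ := h γ₀ hγ (ε/2) (by positivity)
  obtain ⟨δ', hδ', h2⟩ := Metric.continuous_iff.1 (hc γ₀ hγ) x₀ (ε/2) (by positivity)
  refine ⟨min δ δ', lt_min hδ hδ', ?_⟩
  rintro ⟨γ, x⟩ ⟨hγ', hx'⟩ hd
  rw [Prod.dist_eq, max_lt_iff] at hd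
  have e1 := h1 γ hγ' (lt_of_lt_of_le (by simpa [Real.dist_eq] using hd.1) (min_le_left _ _)) x hx'
  have e2 := h2 x (lt_of_lt_of_le hd.2 (min_le_right _ _))
  rw [Real.dist_eq] at e2 ⊢
  have := abs_sub_le (G γ x) (G γ₀ x) (G γ₀ x₀)
  simp only
  linarith

theorem aux_iter_maps (f : ℝ → ℝ) (hf : MapsTo f (Icc 0 1) (Icc 0 1)) (m : ℕ) :
    MapsTo (f^[m]) (Icc (0:ℝ) 1) (Icc 0 1) := hf.iterate m

theorem aux_iter_cont (F : ℝ → ℝ → ℝ) (a b : ℝ)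
    (hF : ContinuousOn (fun p : ℝ × ℝ => F p.1 p.2) (Icc a b ×ˢ Icc (0:ℝ) 1))
    (hm : ∀ γ ∈ Icc a b, MapsTo (F γ) (Icc 0 1) (Icc 0 1)) (m : ℕ) :
    ContinuousOn (fun p : ℝ × ℝ => (F p.1)^[m] p.2) (Icc a b ×ˢ Icc (0:ℝ) 1) := by
  induction m with
  | zero => simpa using continuousOn_snd
  | succ k ih =>
    simp only [Function.iterate_succ_apply']
    exact hF.comp (f := fun p : ℝ × ℝ => (p.1, (F p.1)^[k] p.2)) (continuousOn_fst.prodMk ih)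
      (fun p hp => ⟨hp.1, (hm _ hp.1).iterate k hp.2⟩)

theorem aux_iter_deriv_cont (F : ℝ → ℝ → ℝ) (a b : ℝ)
    (hF : ContinuousOn (fun p : ℝ × ℝ => F p.1 p.2) (Icc a b ×ˢ Icc (0:ℝ) 1))
    (hF' : ContinuousOn (fun p : ℝ × ℝ => deriv (F p.1) p.2) (Icc a b ×ˢ Icc (0:ℝ) 1))
    (hd : ∀ γ ∈ Icc a b, Differentiable ℝ (F γ))
    (hm : ∀ γ ∈ Icc a b, MapsTo (F γ) (Icc 0 1) (Icc 0 1)) (m : ℕ) :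
    ContinuousOn (fun p : ℝ × ℝ => deriv ((F p.1)^[m]) p.2) (Icc a b ×ˢ Icc (0:ℝ) 1) := by
  induction m with
  | zero => simpa using continuousOn_const
  | succ k ih =>
    have : ContinuousOn (fun p : ℝ × ℝ => deriv (F p.1) ((F p.1)^[k] p.2) *
        deriv ((F p.1)^[k]) p.2) (Icc a b ×ˢ Icc (0:ℝ) 1) := by
      refine ContinuousOn.mul ?_ ih
      exact hF'.comp (f := fun p : ℝ × ℝ => (p.1, (F p.1)^[k] p.2))
        (continuousOn_fst.prodMk (aux_iter_cont F a b hF hm k))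
        (fun p hp => ⟨hp.1, (hm _ hp.1).iterate k hp.2⟩)
    refine this.congr ?_
    intro p hp
    simp only [Function.iterate_succ']
    rw [deriv_comp _ (hd _ hp.1 _) ((hd _ hp.1).iterate k _)]

/-- Quantitative implicit function lemma on an interval. -/
theorem aux_implicit (J : Set ℝ) (H : ℝ → ℝ → ℝ) (r₀ η κ γ₀ : ℝ) (hη : 0 < η) (hκ : 0 < κ)
    (hγ₀ : γ₀ ∈ J)
    (hcx : ∀ γ ∈ J, ContinuousOn (H γ) (Icc (r₀ - η) (r₀ + η)))
    (hcg : ∀ x ∈ Icc (r₀ - η) (r₀ + η), ContinuousOn (fun γ => H γ x) J)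
    (hmono : ∀ γ ∈ J, ∀ x ∈ Icc (r₀ - η) (r₀ + η), ∀ y ∈ Icc (r₀ - η) (r₀ + η), x ≤ y →
      κ * (y - x) ≤ H γ y - H γ x)
    (hsmall : ∀ γ ∈ J, |H γ r₀| ≤ κ * η) (h0 : H γ₀ r₀ = 0) :
    ∃ r : ℝ → ℝ, ContinuousOn r J ∧ r γ₀ = r₀ ∧
      ∀ γ ∈ J, r γ ∈ Icc (r₀ - η) (r₀ + η) ∧ H γ (r γ) = 0 := by
  have habs : ∀ γ ∈ J, ∀ x ∈ Icc (r₀ - η) (r₀ + η), ∀ y ∈ Icc (r₀ - η) (r₀ + η),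
      κ * |x - y| ≤ |H γ x - H γ y| := by
    intro γ hγ x hx y hy
    rcases le_total x y with h | h
    · rw [abs_sub_comm, abs_of_nonneg (sub_nonneg.2 h), abs_sub_comm (H γ x)]
      exact (hmono γ hγ x hx y hy h).trans (le_abs_self _)
    · rw [abs_of_nonneg (sub_nonneg.2 h)]
      exact (hmono γ hγ y hy x hx h).trans (le_abs_self _)
  have hmem : r₀ ∈ Icc (r₀ - η) (r₀ + η) := ⟨by linarith, by linarith⟩
  have hex : ∀ γ, ∃ x, γ ∈ J → x ∈ Icc (r₀ - η) (r₀ + η) ∧ H γ x = 0 := by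
    intro γ
    by_cases hγ : γ ∈ J
    · have h1 := hmono γ hγ (r₀ - η) ⟨by linarith, by linarith⟩ r₀ hmem (by linarith)
      have h2 := hmono γ hγ r₀ hmem (r₀ + η) ⟨by linarith, by linarith⟩ (by linarith)
      have h3 := abs_le.1 (hsmall γ hγ)
      have := intermediate_value_Icc (by linarith) (hcx γ hγ)
      obtain ⟨x, hx, hx0⟩ := this (show (0:ℝ) ∈ _ from ⟨by nlinarith, by nlinarith⟩)
      exact ⟨x, fun _ => ⟨hx, hx0⟩⟩
    · exact ⟨0, fun h => absurd h hγ⟩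
  choose r hr using hex
  refine ⟨r, ?_, ?_, hr⟩
  · intro γ₁ hγ₁
    have hc := (hcg (r γ₁) (hr γ₁ hγ₁).1) γ₁ hγ₁
    unfold ContinuousWithinAt at hc ⊢
    simp only [(hr γ₁ hγ₁).2] at hc
    rw [tendsto_iff_dist_tendsto_zero]
    have hc2 : Filter.Tendsto (fun γ => κ⁻¹ * |H γ (r γ₁)|) (nhdsWithin γ₁ J) (nhds 0) := by
      simpa using (hc.abs).const_mul κ⁻¹
    refine squeeze_zero' (Filter.Eventually.of_forall fun _ => dist_nonneg) ?_ hc2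
    filter_upwards [self_mem_nhdsWithin] with γ hγ
    have := habs γ hγ _ (hr γ hγ).1 _ (hr γ₁ hγ₁).1
    rw [(hr γ hγ).2, zero_sub, abs_neg] at this
    rw [Real.dist_eq, inv_mul_eq_div, le_div_iff₀ hκ]
    linarith
  · have := habs γ₀ hγ₀ _ (hr γ₀ hγ₀).1 _ hmem
    rw [(hr γ₀ hγ₀).2, h0, sub_zero, abs_zero] at this
    have h3 : |r γ₀ - r₀| ≤ 0 := by
      by_contra h
      push Not at h
      nlinarith
    exact sub_eq_zero.1 (abs_nonpos_iff.1 h3)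

theorem aux_max (g : ℝ → ℝ) (hg : Continuous g) (u w v : ℝ) (huw : u < w) (hwv : w < v)
    (h1 : g u < g w) (h2 : g v < g w) : ∃ z ∈ Ioo u v, deriv g z = 0 := by
  obtain ⟨z, hz, hmax⟩ := isCompact_Icc.exists_isMaxOn (s := Icc u v)
    ⟨w, huw.le, hwv.le⟩ hg.continuousOn
  have hw := hmax (show w ∈ Icc u v from ⟨huw.le, hwv.le⟩)
  simp only [mem_setOf_eq] at hw
  have hz' : z ∈ Ioo u v := by
    refine ⟨lt_of_le_of_ne hz.1 ?_, lt_of_le_of_ne hz.2 ?_⟩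
    · rintro rfl; linarith
    · rintro rfl; linarith
  exact ⟨z, hz', (hmax.isLocalMax (Icc_mem_nhds hz'.1 hz'.2)).deriv_eq_zero⟩

theorem aux_extr (g : ℝ → ℝ) (hg : Continuous g) (u w v : ℝ) (huw : u < w) (hwv : w < v)
    (h : (g u < g w ∧ g v < g w) ∨ (g w < g u ∧ g w < g v)) :
    ∃ z ∈ Ioo u v, deriv g z = 0 := by
  rcases h with h | h
  · exact aux_max g hg u w v huw hwv h.1 h.2
  · obtain ⟨z, hz, h0⟩ := aux_max (fun x => - g x) hg.neg u w v huw hwv (by linarith [h.1])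
      (by linarith [h.2])
    refine ⟨z, hz, ?_⟩
    have : deriv (fun x => - g x) z = - deriv g z := deriv.fun_neg
    linarith

theorem aux_lapPts_mono (l : ℕ) (c : Fin l → ℝ) (hc : StrictMono c)
    (h01 : ∀ i, c i ∈ Ioo (0:ℝ) 1) : StrictMono (lapPts l c) := by
  intro i j hij
  have hij' : (i : ℕ) < j := hij
  have hi := i.isLt
  have hj := j.isLt
  unfold lapPts
  split_ifs with h1 h2 h3 h4 h5 h6
  all_goals first | omega | skip
  · norm_num
  · exact (h01 _).1
  · exact (h01 _).2
  · apply hc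
    simp only [Fin.lt_def]
    omega

theorem aux_turn (l : ℕ) (f : ℝ → ℝ) (c : Fin l → ℝ) (hf : IsLModal l f c) (i : Fin l) :
    ∃ p q, p < c i ∧ c i < q ∧ 0 ≤ p ∧ q ≤ 1 ∧
      ((∀ u ∈ Icc p q, u ≠ c i → f u < f (c i)) ∨ (∀ u ∈ Icc p q, u ≠ c i → f (c i) < f u)) := by
  obtain ⟨hc, h01, -, -, -, s, hs, hmono⟩ := hf
  have hL := aux_lapPts_mono l c hc h01
  have hci : lapPts l c i.castSucc.succ = c i := by
    have := i.isLt
    unfold lapPts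
    rw [dif_neg (by simp), dif_neg (by simp; omega)]
    congr 1
  have hci' : lapPts l c i.succ.castSucc = c i := by
    rw [← Fin.succ_castSucc]; exact hci
  have hp : lapPts l c i.castSucc.castSucc < c i := by
    rw [← hci]; apply hL; simp [Fin.lt_def]
  have hq : c i < lapPts l c i.succ.succ := by
    rw [← hci']; apply hL; simp [Fin.lt_def]
  have h0 : lapPts l c 0 = 0 := by simp [lapPts]
  have h1 : lapPts l c (Fin.last _) = 1 := by simp [lapPts]
  refine ⟨_, _, hp, hq, ?_, ?_, ?_⟩
  · rw [← h0]; exact hL.monotone (Fin.zero_le _)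
  · rw [← h1]; exact hL.monotone (Fin.le_last _)
  have m1 := hmono i.castSucc
  have m2 := hmono i.succ
  have hs := hs i
  unfold lap at m1 m2
  rw [hci] at m1
  rw [hci'] at m2
  cases e1 : s i.castSucc <;> cases e2 : s i.succ <;> simp [e1, e2] at hs m1 m2
  · right
    intro u hu hne
    rcases lt_or_gt_of_ne hne with h | h
    · exact m1 ⟨hu.1, h.le⟩ ⟨hp.le, le_rfl⟩ h
    · exact m2 ⟨le_rfl, hq.le⟩ ⟨h.le, hu.2⟩ h
  · left
    intro u hu hne
    rcases lt_or_gt_of_ne hne with h | h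
    · exact m1 ⟨hu.1, h.le⟩ ⟨hp.le, le_rfl⟩ h
    · exact m2 ⟨le_rfl, hq.le⟩ ⟨h.le, hu.2⟩ h

theorem aux_fin_id (l : ℕ) (j : Fin l → Fin l) (hj : StrictMono j) (i : Fin l) : j i = i := by
  have : j = id := by
    have h := Subsingleton.elim (hj.orderIsoOfSurjective j
      (Finite.surjective_of_injective hj.injective)) (OrderIso.refl (Fin l))
    funext x
    exact congrArg (fun e : Fin l ≃o Fin l => e x) h
  simp [this]

theorem aux_turn_cont (l : ℕ) (F : ℝ → ℝ → ℝ) (c : ℝ → Fin l → ℝ) (a b : ℝ)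
    (hF : ContinuousOn (fun p : ℝ × ℝ => F p.1 p.2) (Icc a b ×ˢ Icc (0:ℝ) 1))
    (hmodal : ∀ γ ∈ Icc a b, IsC1LModal l (F γ) (c γ)) (i₀ : Fin l) :
    ContinuousOn (fun γ => c γ i₀) (Icc a b) := by
  intro γ₁ hγ₁
  have hM := hmodal γ₁ hγ₁
  have hcx : ∀ x ∈ Icc (0:ℝ) 1, Filter.Tendsto (fun γ => F γ x) (nhdsWithin γ₁ (Icc a b))
      (nhds (F γ₁ x)) := by
    intro x hx
    have : ContinuousOn (fun γ => F γ x) (Icc a b) :=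
      hF.comp (f := fun γ => (γ, x)) (by fun_prop) (fun γ hγ => ⟨hγ, hx⟩)
    exact this γ₁ hγ₁
  choose p q hp hq h0 h1 hext using fun i => aux_turn l (F γ₁) (c γ₁) hM.1 i
  rw [ContinuousWithinAt, Metric.tendsto_nhds]
  intro ε hε
  -- choose a small radius
  have hsm : ∀ z : ℝ, 0 < z → ∀ᶠ e in nhdsWithin (0:ℝ) (Ioi 0), e < z := fun z hz =>
    nhdsWithin_le_nhds (Iio_mem_nhds hz)
  have hE : ∀ᶠ e in nhdsWithin (0:ℝ) (Ioi 0), 0 < e ∧ e < ε ∧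
      (∀ i, e < c γ₁ i - p i) ∧ (∀ i, e < q i - c γ₁ i) ∧
      (∀ i j, i < j → e < (c γ₁ j - c γ₁ i) / 2) := by
    refine Filter.Eventually.and self_mem_nhdsWithin ((hsm ε hε).and (Filter.Eventually.and ?_
      (Filter.Eventually.and ?_ ?_)))
    · exact Filter.eventually_all.2 fun i => hsm _ (sub_pos.2 (hp i))
    · exact Filter.eventually_all.2 fun i => hsm _ (sub_pos.2 (hq i))
    · refine Filter.eventually_all.2 fun i => Filter.eventually_all.2 fun j => ?_
      by_cases hij : i < j
      · filter_upwards [hsm ((c γ₁ j - c γ₁ i) / 2)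
          (by have := hM.1.1 hij; linarith)] with e he _ using he
      · exact Filter.Eventually.of_forall fun e h => absurd h hij
  obtain ⟨e, he, heε, hep, heq, hsep⟩ := hE.exists
  have hev : ∀ᶠ γ in nhdsWithin γ₁ (Icc a b), ∀ i, 
      ∃ j, c γ j ∈ Ioo (c γ₁ i - e) (c γ₁ i + e) := by
    refine Filter.eventually_all.2 fun i => ?_
    have b1 := hep i
    have b2 := heq i
    have b3 := h0 i
    have b4 := h1 i
    have tu := hcx (c γ₁ i - e) ⟨by linarith, by linarith⟩
    have tw := hcx (c γ₁ i) ⟨by linarith, by linarith⟩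
    have tv := hcx (c γ₁ i + e) ⟨by linarith, by linarith⟩
    have mu : c γ₁ i - e ∈ Icc (p i) (q i) := ⟨by linarith, by linarith⟩
    have mv : c γ₁ i + e ∈ Icc (p i) (q i) := ⟨by linarith, by linarith⟩
    have key : ∀ᶠ γ in nhdsWithin γ₁ (Icc a b),
        (F γ (c γ₁ i - e) < F γ (c γ₁ i) ∧ F γ (c γ₁ i + e) < F γ (c γ₁ i)) ∨
        (F γ (c γ₁ i) < F γ (c γ₁ i - e) ∧ F γ (c γ₁ i) < F γ (c γ₁ i + e)) := by
      rcases hext i with h | h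
      · filter_upwards [tu.eventually_lt tw (h _ mu (by linarith)),
          tv.eventually_lt tw (h _ mv (by linarith))] with γ x1 x2 using Or.inl ⟨x1, x2⟩
      · filter_upwards [tw.eventually_lt tu (h _ mu (by linarith)),
          tw.eventually_lt tv (h _ mv (by linarith))] with γ x1 x2 using Or.inr ⟨x1, x2⟩
    filter_upwards [key, self_mem_nhdsWithin] with γ hk hγ
    have hMγ := hmodal γ hγ
    obtain ⟨z, hz, hz0⟩ := aux_extr (F γ) hMγ.2.1.continuous _ _ _ (by linarith) (by linarith) hk
    by_contra hno
    push Not at hno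
    refine hMγ.2.2 z ⟨by linarith [hz.1], by linarith [hz.2]⟩ ?_ hz0
    intro j hj
    exact hno j (hj ▸ hz)
  filter_upwards [hev, self_mem_nhdsWithin] with γ hj hγ
  choose j hj using hj
  have hjm : StrictMono j := by
    intro i i' hii
    have := hsep i i' hii
    have h1 := (hj i).2
    have h2 := (hj i').1
    exact (hmodal γ hγ).1.1.lt_iff_lt.1 (by linarith)
  have := hj i₀
  rw [aux_fin_id l j hjm i₀] at this
  rw [Real.dist_eq, abs_lt]
  exact ⟨by linarith [this.1], by linarith [this.2]⟩

/-- Persistence of the periodic point. -/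
theorem aux_persist (G : ℝ → ℝ → ℝ) (a b : ℝ)
    (hG : ContinuousOn (fun p : ℝ × ℝ => G p.1 p.2) (Icc a b ×ˢ Icc (0:ℝ) 1))
    (hG' : ContinuousOn (fun p : ℝ × ℝ => deriv (G p.1) p.2) (Icc a b ×ˢ Icc (0:ℝ) 1))
    (hd : ∀ γ ∈ Icc a b, Differentiable ℝ (G γ))
    (hend : ∀ γ ∈ Icc a b, ∀ x ∈ ({0, 1} : Set ℝ), G γ x ∈ ({0, 1} : Set ℝ))
    (γ₀ : ℝ) (hγ₀ : γ₀ ∈ Icc a b) (r₀ : ℝ) (hr₀ : r₀ ∈ Icc (0:ℝ) 1)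
    (hper : G γ₀ r₀ = r₀) (hnn : |deriv (G γ₀) r₀| ≠ 1) :
    ∃ δ > 0, ∃ r : ℝ → ℝ, ContinuousOn r (Icc a b ∩ ball γ₀ δ) ∧ r γ₀ = r₀ ∧
      ∀ γ ∈ Icc a b ∩ ball γ₀ δ, r γ ∈ Icc (0:ℝ) 1 ∧ G γ (r γ) = r γ ∧
        |deriv (G γ) (r γ)| ≠ 1 := by
  have hcx : ∀ x ∈ Icc (0:ℝ) 1, ContinuousOn (fun γ => G γ x) (Icc a b) := fun x hx =>
    hG.comp (f := fun γ => (γ, x)) (by fun_prop) (fun γ hγ => ⟨hγ, hx⟩)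
  have hD := hG' (γ₀, r₀) ⟨hγ₀, hr₀⟩
  have hDne : deriv (G γ₀) r₀ - 1 ≠ 0 := by
    intro h
    apply hnn
    rw [sub_eq_zero.1 h]; simp
  obtain ⟨σ, hσ, hσD⟩ : ∃ σ : ℝ, (σ = 1 ∨ σ = -1) ∧ 0 < σ * (deriv (G γ₀) r₀ - 1) := by
    rcases lt_or_gt_of_ne hDne with h | h
    · exact ⟨-1, Or.inr rfl, by linarith⟩
    · exact ⟨1, Or.inl rfl, by linarith⟩
  obtain ⟨κ, hκ, hκD⟩ := exists_between hσD
  have hev : ∀ᶠ p : ℝ × ℝ in nhdsWithin (γ₀, r₀) (Icc a b ×ˢ Icc (0:ℝ) 1),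
      |deriv (G p.1) p.2| ≠ 1 ∧ κ < σ * (deriv (G p.1) p.2 - 1) := by
    have h1 := hD.abs.eventually_ne hnn
    have h2 := ((hD.sub continuousWithinAt_const).const_mul σ).eventually_const_lt hκD
    exact h1.and h2
  obtain ⟨ε, hε, hball⟩ := Metric.mem_nhdsWithin_iff.1 hev
  have hball' : ∀ γ ∈ Icc a b, |γ - γ₀| < ε → ∀ x ∈ Icc (0:ℝ) 1, |x - r₀| < ε →
      |deriv (G γ) x| ≠ 1 ∧ κ < σ * (deriv (G γ) x - 1) := by
    intro γ hγ h1 x hx h2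
    exact hball (a := (γ, x)) ⟨by rw [Metric.mem_ball, Prod.dist_eq]; exact max_lt h1 h2, hγ, hx⟩
  by_cases hbd : r₀ ∈ ({0, 1} : Set ℝ)
  · -- boundary point
    obtain ⟨δ, hδ, h⟩ := Metric.continuousOn_iff.1 (hcx r₀ hr₀) γ₀ hγ₀ 1 one_pos
    refine ⟨min δ ε, lt_min hδ hε, fun _ => r₀, continuousOn_const, rfl, ?_⟩
    rintro γ ⟨hγ, hγb⟩
    have hγd : dist γ γ₀ < min δ ε := hγb
    refine ⟨hr₀, ?_, (hball' γ hγ (hγd.trans_le (min_le_right _ _)) r₀ hr₀ (by simpa using hε)).1⟩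
    have h1 := h γ hγ (hγd.trans_le (min_le_left _ _))
    have h2 := hend γ hγ r₀ hbd
    rw [hper] at h1
    rcases hbd with rfl | hbd
    · rcases h2 with h2 | h2
      · exact h2
      · rw [mem_singleton_iff] at h2; rw [h2] at h1; simp at h1
    · rw [mem_singleton_iff] at hbd
      subst hbd
      rcases h2 with h2 | h2
      · rw [h2] at h1; simp at h1
      · exact h2
  · have hlt0 : 0 < r₀ := lt_of_le_of_ne hr₀.1 (fun h => hbd (Or.inl h.symm))
    have hlt1 : r₀ < 1 := lt_of_le_of_ne hr₀.2 (fun h => hbd (Or.inr h))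
    obtain ⟨η, hη, hη'⟩ : ∃ η > 0, η < min ε (min r₀ (1 - r₀)) :=
      exists_between (lt_min hε (lt_min hlt0 (by linarith)))
    have hη1 : η < ε := hη'.trans_le (min_le_left _ _)
    have hη2 : η < r₀ := hη'.trans_le ((min_le_right _ _).trans (min_le_left _ _))
    have hη3 : η < 1 - r₀ := hη'.trans_le ((min_le_right _ _).trans (min_le_right _ _))
    obtain ⟨δ, hδ, h⟩ := Metric.continuousOn_iff.1 (hcx r₀ hr₀) γ₀ hγ₀ (κ * η) (by positivity)
    have hK : Icc (r₀ - η) (r₀ + η) ⊆ Icc (0:ℝ) 1 := fun x hx =>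
      ⟨by linarith [hx.1], by linarith [hx.2]⟩
    have hKε : ∀ x ∈ Icc (r₀ - η) (r₀ + η), |x - r₀| < ε := fun x hx =>
      abs_lt.2 ⟨by linarith [hx.1], by linarith [hx.2]⟩
    have hσ0 : σ ≠ 0 := by rcases hσ with rfl | rfl <;> norm_num
    have hσabs : |σ| = 1 := by rcases hσ with rfl | rfl <;> norm_num
    obtain ⟨r, hrc, hr0, hr⟩ := aux_implicit (Icc a b ∩ ball γ₀ (min δ ε))
      (fun γ x => σ * (G γ x - x)) r₀ η κ γ₀ hη hκ
      ⟨hγ₀, mem_ball_self (lt_min hδ hε)⟩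
      (fun γ hγ => by
        have := (hd γ hγ.1).continuous
        fun_prop)
      (fun x hx => by
        have := (hcx x (hK hx)).mono (inter_subset_left (t := ball γ₀ (min δ ε)))
        fun_prop)
      (by
        rintro γ ⟨hγ, hγb⟩ x hx y hy hxy
        have hγd : dist γ γ₀ < min δ ε := hγb
        have hdd := hd γ hγ
        have hdiff : Differentiable ℝ (fun x => σ * (G γ x - x)) := by fun_prop
        refine (convex_Icc (r₀ - η) (r₀ + η)).mul_sub_le_image_sub_of_le_deriv
          hdiff.continuous.continuousOn hdiff.differentiableOn ?_ x hx y hy hxy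
        intro z hz
        have hz := interior_subset hz
        have e : deriv (fun x => σ * (G γ x - x)) z = σ * (deriv (G γ) z - 1) :=
          (((hdd z).hasDerivAt.sub (hasDerivAt_id z)).const_mul σ).deriv
        rw [e]
        exact (hball' γ hγ (hγd.trans_le (min_le_right _ _)) z (hK hz) (hKε z hz)).2.le)
      (by
        rintro γ ⟨hγ, hγb⟩
        have hγd : dist γ γ₀ < min δ ε := hγb
        have := h γ hγ (hγd.trans_le (min_le_left _ _))
        rw [hper, Real.dist_eq] at this
        rw [abs_mul, hσabs, one_mul]
        exact this.le)
      (by simp [hper])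
    refine ⟨min δ ε, lt_min hδ hε, r, hrc, hr0, ?_⟩
    intro γ hγ
    have hγd : dist γ γ₀ < min δ ε := hγ.2
    obtain ⟨h1, h2⟩ := hr γ hγ
    refine ⟨hK h1, ?_, (hball' γ hγ.1 (hγd.trans_le (min_le_right _ _)) _ (hK h1) (hKε _ h1)).1⟩
    rcases mul_eq_zero.1 h2 with h2 | h2
    · exact absurd h2 hσ0
    · exact sub_eq_zero.1 h2

/-- Continuation of a non-neutral periodic point in a family of `l`-modal maps: it persists
on a connected neighborhood `J` of `γ₀` in `[a,b]`, continuously and staying non-neutral;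
and if it is never super-attracting on `J` then its itinerary is constant on `J`. -/
theorem periodic_point_continuation
    (l : ℕ) (F : ℝ → ℝ → ℝ) (c : ℝ → Fin l → ℝ) (a b : ℝ)
    (hfam : C1FamilyOn F a b)
    (hmodal : ∀ γ ∈ Icc a b, IsC1LModal l (F γ) (c γ))
    (γ₀ : ℝ) (hγ₀ : γ₀ ∈ Icc a b)
    (n : ℕ) (hn : 1 ≤ n) (r₀ : ℝ) (hr₀ : r₀ ∈ Icc (0:ℝ) 1)
    (hper : (F γ₀)^[n] r₀ = r₀)
    (hnn : |deriv ((F γ₀)^[n]) r₀| ≠ 1) :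
    ∃ J : Set ℝ, J ⊆ Icc a b ∧ γ₀ ∈ J ∧ J ∈ nhdsWithin γ₀ (Icc a b) ∧
      IsPreconnected J ∧
      ∃ r : ℝ → ℝ, ContinuousOn r J ∧ r γ₀ = r₀ ∧
        (∀ γ ∈ J, r γ ∈ Icc (0:ℝ) 1 ∧ (F γ)^[n] (r γ) = r γ ∧
          |deriv ((F γ)^[n]) (r γ)| ≠ 1) ∧
        ((∀ γ ∈ J, ∀ m : ℕ, ∀ i : Fin l, (F γ)^[m] (r γ) ≠ c γ i) →
          ∀ γ ∈ J, ∀ γ' ∈ J, ∀ m : ℕ,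
            lapIdx l (c γ) ((F γ)^[m] (r γ)) = lapIdx l (c γ') ((F γ')^[m] (r γ'))) := by
  have hm : ∀ γ ∈ Icc a b, MapsTo (F γ) (Icc 0 1) (Icc 0 1) := fun γ hγ => (hmodal γ hγ).1.2.2.1
  have hd : ∀ γ ∈ Icc a b, Differentiable ℝ (F γ) := fun γ hγ =>
    (hmodal γ hγ).2.1.differentiable one_ne_zero
  have hF : ContinuousOn (fun p : ℝ × ℝ => F p.1 p.2) (Icc a b ×ˢ Icc (0:ℝ) 1) := by
    refine aux_joint F a b ?_ fun γ hγ => (hmodal γ hγ).2.1.continuous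
    intro γ₁ h1 ε hε
    obtain ⟨δ, hδ, h⟩ := hfam γ₁ h1 ε hε
    exact ⟨δ, hδ, fun γ hγ hlt x hx => (h γ hγ hlt x hx).1⟩
  have hF' : ContinuousOn (fun p : ℝ × ℝ => deriv (F p.1) p.2) (Icc a b ×ˢ Icc (0:ℝ) 1) := by
    refine aux_joint (fun γ => deriv (F γ)) a b ?_
      fun γ hγ => (hmodal γ hγ).2.1.continuous_deriv le_rfl
    intro γ₁ h1 ε hε
    obtain ⟨δ, hδ, h⟩ := hfam γ₁ h1 ε hε
    exact ⟨δ, hδ, fun γ hγ hlt x hx => (h γ hγ hlt x hx).2⟩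
  have hend : ∀ γ ∈ Icc a b, MapsTo (F γ) ({0, 1} : Set ℝ) ({0, 1} : Set ℝ) := by
    intro γ hγ x hx
    obtain ⟨-, -, -, h0, h1, -⟩ := (hmodal γ hγ).1
    rcases hx with rfl | hx
    · exact h0
    · rw [mem_singleton_iff] at hx
      rw [hx]; exact h1
  obtain ⟨δ, hδ, r, hrc, hr0, hr⟩ := aux_persist (fun γ => (F γ)^[n]) a b
    (aux_iter_cont F a b hF hm n) (aux_iter_deriv_cont F a b hF hF' hd hm n)
    (fun γ hγ => (hd γ hγ).iterate n) (fun γ hγ x hx => (hend γ hγ).iterate n hx)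
    γ₀ hγ₀ r₀ hr₀ hper hnn
  have hJ : IsPreconnected (Icc a b ∩ ball γ₀ δ) :=
    ((convex_Icc a b).inter (convex_ball γ₀ δ)).isPreconnected
  refine ⟨Icc a b ∩ ball γ₀ δ, inter_subset_left, ⟨hγ₀, mem_ball_self hδ⟩,
    Filter.inter_mem self_mem_nhdsWithin (mem_nhdsWithin_of_mem_nhds (ball_mem_nhds γ₀ hδ)),
    hJ, r, hrc, hr0, hr, ?_⟩
  intro hne
  have hlt : ∀ γ ∈ Icc a b ∩ ball γ₀ δ, ∀ γ' ∈ Icc a b ∩ ball γ₀ δ, ∀ (m : ℕ) (i : Fin l),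
      c γ i < (F γ)^[m] (r γ) → c γ' i < (F γ')^[m] (r γ') := by
    intro γ hγ γ' hγ' m i h
    by_contra h'
    push Not at h'
    have c1 : ContinuousOn (fun γ => (F γ)^[m] (r γ)) (Icc a b ∩ ball γ₀ δ) :=
      (aux_iter_cont F a b hF hm m).comp (f := fun γ => (γ, r γ)) (continuousOn_id.prodMk hrc)
        (fun γ hγ => ⟨hγ.1, (hr γ hγ).1⟩)
    have c2 : ContinuousOn (fun γ => c γ i) (Icc a b ∩ ball γ₀ δ) :=
      (aux_turn_cont l F c a b hF hmodal i).mono inter_subset_left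
    obtain ⟨z, hz, hz'⟩ := hJ.intermediate_value₂ hγ' hγ c1 c2 h' h.le
    exact hne z hz m i hz'
  intro γ hγ γ' hγ' m
  unfold lapIdx
  congr 1
  ext i
  simp only [Finset.mem_filter, Finset.mem_univ, true_and]
  exact ⟨hlt γ hγ γ' hγ' m i, hlt γ' hγ' γ hγ m i⟩
end
end

section
/- Let f be a complex polynomial of degree d ≥ 2 whose filled Julia set K_f has empty interior (so K_f equals the Julia set of f) and which satisfies the Exponential Shrinking of components condition: there exist r₀ > 0 and λ₀ > 1 such that for every z ∈ K_f, every n ≥ 0 and every connected component W of f^{-n}(B(z,r₀)), diam W < λ₀^{-n}. Then for every ε > 0 there exist d' > 0 and δ > 0 such that for every complex polynomial g of degree d with |f − g| < d', every z ∈ K_g and every n ≥ 0, every connected component of g^{-n}(B(z,δ)) has diameter less than ε. -/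
open Set Metric

noncomputable section

/-- The filled Julia set of a complex polynomial: the set of points with bounded forward
orbit. -/
def filledJulia (f : Polynomial ℂ) : Set ℂ :=
  {z : ℂ | Bornology.IsBounded (Set.range fun n : ℕ => (fun w => f.eval w)^[n] z)}

/-- Uniform escape radius. -/
lemma aux_escape (d : ℕ) (hd : 2 ≤ d) (f : Polynomial ℂ) (hdeg : f.natDegree = d) :
    ∃ R₀ ≥ (1:ℝ), ∃ d' > (0:ℝ), ∀ g : Polynomial ℂ, g.natDegree = d →
      (∀ i ≤ d, ‖f.coeff i - g.coeff i‖ < d') →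
      ∀ x : ℂ, R₀ ≤ ‖x‖ → 2 * ‖x‖ ≤ ‖g.eval x‖ := by
  have hL : 0 < ‖f.coeff d‖ := by
    rw [norm_pos_iff, ← hdeg]
    have : f ≠ 0 := by
      rintro rfl
      simp at hdeg
      omega
    simpa using this
  set L := ‖f.coeff d‖ with hLdef
  set T : ℝ := ∑ i ∈ Finset.range d, (‖f.coeff i‖ + 1) with hT
  have hT0 : 0 ≤ T := Finset.sum_nonneg (fun i _ => by positivity)
  refine ⟨max 1 (2 * (T + 2) / L), le_max_left _ _, min 1 (L / 2), by positivity, ?_⟩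
  intro g hg hclose x hx
  have hx1 : 1 ≤ ‖x‖ := le_trans (le_max_left _ _) hx
  have hx2 : 2 * (T + 2) / L ≤ ‖x‖ := le_trans (le_max_right _ _) hx
  have hx3 : T + 2 ≤ L / 2 * ‖x‖ := by
    rw [div_le_iff₀ hL] at hx2
    linarith
  have hlead : L / 2 ≤ ‖g.coeff d‖ := by
    have h1 := lt_of_lt_of_le (hclose d le_rfl) (min_le_right _ _)
    have h2 := norm_sub_norm_le (f.coeff d) (g.coeff d)
    linarith
  have hcoef : ∀ i ∈ Finset.range d, ‖g.coeff i * x ^ i‖ ≤ (‖f.coeff i‖ + 1) * ‖x‖ ^ (d - 1) := by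
    intro i hi
    have hid := Finset.mem_range.1 hi
    rw [norm_mul, norm_pow]
    have h1 := lt_of_lt_of_le (hclose i hid.le) (min_le_left _ _)
    have h2 := norm_sub_norm_le (g.coeff i) (f.coeff i)
    rw [norm_sub_rev] at h2
    have h3 : ‖g.coeff i‖ ≤ ‖f.coeff i‖ + 1 := by linarith
    have h4 : ‖x‖ ^ i ≤ ‖x‖ ^ (d - 1) := pow_le_pow_right₀ hx1 (by omega)
    gcongr
  have hsum : ‖∑ i ∈ Finset.range d, g.coeff i * x ^ i‖ ≤ T * ‖x‖ ^ (d - 1) := by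
    rw [hT, Finset.sum_mul]
    exact norm_sum_le_of_le _ hcoef
  have heval : g.eval x = (∑ i ∈ Finset.range d, g.coeff i * x ^ i) + g.coeff d * x ^ d := by
    rw [Polynomial.eval_eq_sum_range, hg, Finset.sum_range_succ]
  have hpow : ‖x‖ ^ d = ‖x‖ ^ (d - 1) * ‖x‖ := by
    rw [← pow_succ]
    congr 1
    omega
  have hpow1 : ‖x‖ ≤ ‖x‖ ^ (d - 1) := le_self_pow₀ hx1 (by omega)
  have h5 : ‖g.coeff d * x ^ d‖ - T * ‖x‖ ^ (d - 1) ≤ ‖g.eval x‖ := by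
    have h6 := norm_sub_le (g.eval x) (∑ i ∈ Finset.range d, g.coeff i * x ^ i)
    have h7 : g.eval x - (∑ i ∈ Finset.range d, g.coeff i * x ^ i) = g.coeff d * x ^ d := by
      rw [heval]; ring
    rw [h7] at h6
    linarith
  have h8 : L / 2 * (‖x‖ ^ (d - 1) * ‖x‖) ≤ ‖g.coeff d * x ^ d‖ := by
    rw [norm_mul, norm_pow, hpow]
    gcongr
  have h9 : ‖x‖ ^ (d - 1) * (T + 2) ≤ ‖x‖ ^ (d - 1) * (L / 2 * ‖x‖) := by gcongr
  nlinarith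

lemma aux_cont (f : Polynomial ℂ) (n : ℕ) : Continuous ((fun y => f.eval y)^[n]) :=
  (Polynomial.continuous f).iterate n

lemma aux_unifCont (f : Polynomial ℂ) (n : ℕ) (R τ : ℝ) (hτ : 0 < τ) :
    ∃ δ > (0:ℝ), ∀ x y : ℂ, ‖x‖ ≤ R → ‖y‖ ≤ R → dist x y < δ →
      dist ((fun y => f.eval y)^[n] x) ((fun y => f.eval y)^[n] y) < τ := by
  have h := (isCompact_closedBall (0:ℂ) R).uniformContinuousOn_of_continuous
    (aux_cont f n).continuousOn
  rw [Metric.uniformContinuousOn_iff] at h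
  obtain ⟨δ, hδ, h⟩ := h τ hτ
  exact ⟨δ, hδ, fun x y hx hy hxy => h x (by simpa using hx) y (by simpa using hy) hxy⟩

lemma aux_close_one (d : ℕ) (f : Polynomial ℂ) (hdeg : f.natDegree = d) (R τ : ℝ) (hτ : 0 < τ) :
    ∃ d' > (0:ℝ), ∀ g : Polynomial ℂ, g.natDegree = d →
      (∀ i ≤ d, ‖f.coeff i - g.coeff i‖ < d') →
      ∀ x : ℂ, ‖x‖ ≤ R → dist (f.eval x) (g.eval x) < τ := by
  set S : ℝ := ∑ i ∈ Finset.range (d+1), |R| ^ i with hS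
  have hS0 : 0 ≤ S := Finset.sum_nonneg (fun i _ => by positivity)
  refine ⟨τ / (S + 1), by positivity, ?_⟩
  intro g hg hclose x hx
  have hx' : ‖x‖ ≤ |R| := hx.trans (le_abs_self R)
  rw [dist_eq_norm, Polynomial.eval_eq_sum_range, Polynomial.eval_eq_sum_range, hg, hdeg,
    ← Finset.sum_sub_distrib]
  calc ‖∑ i ∈ Finset.range (d+1), (f.coeff i * x ^ i - g.coeff i * x ^ i)‖
      ≤ ∑ i ∈ Finset.range (d+1), τ / (S + 1) * |R| ^ i := by
        refine norm_sum_le_of_le _ fun i hi => ?_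
        rw [← sub_mul, norm_mul, norm_pow]
        have := (hclose i (by simpa [Nat.lt_succ_iff] using hi)).le
        gcongr
    _ = τ * (S / (S + 1)) := by rw [← Finset.mul_sum]; ring
    _ < τ * 1 := by
        gcongr
        rw [div_lt_one (by positivity)]
        linarith
    _ = τ := mul_one _

lemma aux_close_iter (d : ℕ) (f : Polynomial ℂ) (hdeg : f.natDegree = d) (R : ℝ) (n : ℕ) :
    ∀ τ > (0:ℝ), ∃ d' > (0:ℝ), ∀ g : Polynomial ℂ, g.natDegree = d →
      (∀ i ≤ d, ‖f.coeff i - g.coeff i‖ < d') →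
      ∀ m ≤ n, ∀ x : ℂ, ‖x‖ ≤ R →
        dist ((fun y => f.eval y)^[m] x) ((fun y => g.eval y)^[m] x) < τ := by
  induction n with
  | zero =>
    intro τ hτ
    refine ⟨1, one_pos, ?_⟩
    intro g _ _ m hm x _
    obtain rfl : m = 0 := by omega
    simpa using hτ
  | succ n ih =>
    intro τ hτ
    obtain ⟨B, hB⟩ := ((isCompact_closedBall (0:ℂ) R).image (aux_cont f n)).isBounded.exists_norm_le
    obtain ⟨δ, hδ, hu⟩ := aux_unifCont f 1 (B + 1) (τ / 2) (by positivity)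
    obtain ⟨d₁, hd₁, h₁⟩ := aux_close_one d f hdeg (B + 1) (τ / 2) (by positivity)
    obtain ⟨d₂, hd₂, h₂⟩ := ih (min τ (min 1 δ)) (by positivity)
    refine ⟨min d₁ d₂, by positivity, ?_⟩
    intro g hg hclose m hm x hx
    have hc₁ : ∀ i ≤ d, ‖f.coeff i - g.coeff i‖ < d₁ :=
      fun i hi => lt_of_lt_of_le (hclose i hi) (min_le_left _ _)
    have hc₂ : ∀ i ≤ d, ‖f.coeff i - g.coeff i‖ < d₂ :=
      fun i hi => lt_of_lt_of_le (hclose i hi) (min_le_right _ _)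
    rcases Nat.lt_or_ge n m with hnm | hnm
    · obtain rfl : m = n + 1 := by omega
      have hk := h₂ g hg hc₂ n le_rfl x hx
      rw [Function.iterate_succ_apply', Function.iterate_succ_apply']
      set u := (fun y => f.eval y)^[n] x with hu'
      set v := (fun y => g.eval y)^[n] x with hv'
      have hk1 : dist u v < 1 := lt_of_lt_of_le hk ((min_le_right _ _).trans (min_le_left _ _))
      have hk2 : dist u v < δ := lt_of_lt_of_le hk ((min_le_right _ _).trans (min_le_right _ _))
      have hun : ‖u‖ ≤ B := hB u ⟨x, by simpa using hx, rfl⟩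
      have hvn : ‖v‖ ≤ B + 1 := by
        have := norm_sub_norm_le v u
        rw [dist_comm, dist_eq_norm] at hk1
        linarith
      have e1 := hu u v (by linarith) hvn hk2
      have e2 := h₁ g hg hc₁ v hvn
      simp only [Function.iterate_one] at e1
      have e3 := dist_triangle (f.eval u) (f.eval v) (g.eval v)
      show dist (f.eval u) (g.eval v) < τ
      linarith
    · exact lt_of_lt_of_le (h₂ g hg hc₂ m hnm x hx) (min_le_left _ _)

lemma aux_grow (g : Polynomial ℂ) (R₀ : ℝ)
    (hesc : ∀ x : ℂ, R₀ ≤ ‖x‖ → 2 * ‖x‖ ≤ ‖g.eval x‖) (x : ℂ) (hx : R₀ ≤ ‖x‖) (n : ℕ) :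
    2 ^ n * ‖x‖ ≤ ‖(fun y => g.eval y)^[n] x‖ := by
  induction n with
  | zero => simp
  | succ n ih =>
    rw [Function.iterate_succ_apply']
    have h1 : (1:ℝ) ≤ 2 ^ n := one_le_pow₀ (by norm_num)
    have h2 : ‖x‖ ≤ 2 ^ n * ‖x‖ := le_mul_of_one_le_left (norm_nonneg _) h1
    have h3 := hesc _ (hx.trans (h2.trans ih))
    rw [pow_succ]
    show _ ≤ ‖g.eval _‖
    linarith

/-- Balls of radius at least the escape radius are backward invariant. -/
lemma aux_back (g : Polynomial ℂ) (R₀ R : ℝ) (hR : R₀ ≤ R)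
    (hesc : ∀ x : ℂ, R₀ ≤ ‖x‖ → 2 * ‖x‖ ≤ ‖g.eval x‖) (x : ℂ) (n : ℕ)
    (h : ‖(fun y => g.eval y)^[n] x‖ ≤ R) : ‖x‖ ≤ R := by
  by_contra hx
  push Not at hx
  have h1 := aux_grow g R₀ hesc x (by linarith) n
  have h2 : (1:ℝ) ≤ 2 ^ n := one_le_pow₀ (by norm_num)
  have h3 : ‖x‖ ≤ 2 ^ n * ‖x‖ := le_mul_of_one_le_left (norm_nonneg _) h2
  linarith

lemma aux_julia_iter (g : Polynomial ℂ) (z : ℂ) (hz : z ∈ filledJulia g) (n : ℕ) :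
    (fun y => g.eval y)^[n] z ∈ filledJulia g := by
  have hz' : Bornology.IsBounded (Set.range fun n : ℕ => (fun w => g.eval w)^[n] z) := hz
  show Bornology.IsBounded (Set.range fun k : ℕ => (fun w => g.eval w)^[k] ((fun y => g.eval y)^[n] z))
  refine hz'.subset ?_
  rintro _ ⟨k, rfl⟩
  exact ⟨k + n, Function.iterate_add_apply _ k n z⟩

lemma aux_julia_norm (g : Polynomial ℂ) (R₀ : ℝ) (hR₀ : 1 ≤ R₀)
    (hesc : ∀ x : ℂ, R₀ ≤ ‖x‖ → 2 * ‖x‖ ≤ ‖g.eval x‖) (z : ℂ) (hz : z ∈ filledJulia g) :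
    ‖z‖ ≤ R₀ := by
  by_contra hx
  push Not at hx
  have hz' : Bornology.IsBounded (Set.range fun n : ℕ => (fun w => g.eval w)^[n] z) := hz
  obtain ⟨B, hB⟩ := hz'.exists_norm_le
  obtain ⟨n, hn⟩ := pow_unbounded_of_one_lt B (one_lt_two (α := ℝ))
  have h1 := aux_grow g R₀ hesc z hx.le n
  have h2 := hB _ ⟨n, rfl⟩
  have h3 : (2:ℝ) ^ n ≤ 2 ^ n * ‖z‖ := le_mul_of_one_le_right (by positivity) (by linarith)
  simp only at h2
  linarith

/-- Uniform escape time off a neighbourhood of the filled Julia set. -/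
lemma aux_time (f : Polynomial ℂ) (R₀ R η : ℝ) (hR : R₀ ≤ R) (hη : 0 < η)
    (hesc : ∀ x : ℂ, R₀ ≤ ‖x‖ → 2 * ‖x‖ ≤ ‖f.eval x‖) :
    ∃ M : ℕ, ∀ x : ℂ, ‖x‖ ≤ R → (∀ z ∈ filledJulia f, η ≤ dist x z) →
      R < ‖(fun y => f.eval y)^[M] x‖ := by
  set C : Set ℂ := closedBall 0 R ∩ ⋂ z ∈ filledJulia f, {x | η ≤ dist x z} with hC
  have hCc : IsCompact C := by
    refine (isCompact_closedBall (0:ℂ) R).inter_right ?_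
    refine isClosed_biInter fun z _ => ?_
    exact isClosed_le continuous_const (continuous_id.dist continuous_const)
  obtain ⟨M, hM⟩ := hCc.elim_directed_cover
    (fun n : ℕ => {x : ℂ | R < ‖(fun y => f.eval y)^[n] x‖})
    (fun n => isOpen_lt continuous_const (aux_cont f n).norm)
    (by
      intro x hx
      have hxK : x ∉ filledJulia f := by
        intro hxK
        have h1 := hx.2
        simp only [mem_iInter, mem_ofPred_eq] at h1
        have h2 := h1 x hxK
        rw [dist_self] at h2
        linarith
      by_contra hcon
      apply hxK
      refine (Metric.isBounded_closedBall (x := (0:ℂ)) (r := R)).subset ?_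
      rintro _ ⟨n, rfl⟩
      simp only [mem_iUnion, mem_ofPred_eq, not_exists, not_lt] at hcon
      simpa using hcon n)
    (by
      refine directed_of_isDirected_le ?_
      intro a b hab x hx
      simp only [mem_ofPred_eq] at hx ⊢
      by_contra hcon
      push Not at hcon
      obtain ⟨k, rfl⟩ := Nat.exists_eq_add_of_le hab
      rw [add_comm, Function.iterate_add_apply] at hcon
      have := aux_back f R₀ R hR hesc _ k hcon
      linarith)
  refine ⟨M, fun x hx hz => hM ⟨by simpa using hx, ?_⟩⟩
  simpa using hz

/-- Uniform backward stability near an ExpShrink polynomial: if `f` has degree `d ≥ 2`, its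
filled Julia set has empty interior, and `f` satisfies the Exponential Shrinking of components
condition, then for each `ε > 0` there are `d' > 0` and `δ > 0` such that for every polynomial
`g` of degree `d` with coefficients `d'`-close to those of `f`, every `z` in the filled Julia
set of `g` and every `n ≥ 0`, all connected components of `g^{-n}(B(z,δ))` have diameter
less than `ε`. -/
theorem backward_stability_near_expShrink
    (d : ℕ) (hd : 2 ≤ d) (f : Polynomial ℂ) (hdeg : f.natDegree = d)
    (hint : interior (filledJulia f) = ∅)
    (r₀ lam₀ : ℝ) (hr₀ : 0 < r₀) (hlam₀ : 1 < lam₀)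
    (hES : ∀ z ∈ filledJulia f, ∀ n : ℕ,
      ∀ w ∈ (fun y => f.eval y)^[n] ⁻¹' Metric.ball z r₀,
        Metric.diam
          (connectedComponentIn ((fun y => f.eval y)^[n] ⁻¹' Metric.ball z r₀) w)
          < lam₀ ^ (-(n:ℤ))) :
    ∀ ε > (0:ℝ), ∃ d' > (0:ℝ), ∃ δ > (0:ℝ),
      ∀ g : Polynomial ℂ, g.natDegree = d →
        (∀ i ≤ d, ‖f.coeff i - g.coeff i‖ < d') →
        ∀ z ∈ filledJulia g, ∀ n : ℕ,
          ∀ w ∈ (fun y => g.eval y)^[n] ⁻¹' Metric.ball z δ,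
            Metric.diam
              (connectedComponentIn ((fun y => g.eval y)^[n] ⁻¹' Metric.ball z δ) w)
              < ε := by
  intro ε hε
  obtain ⟨R₀, hR₀, d₁, hd₁, hesc⟩ := aux_escape d hd f hdeg
  have hescf := hesc f hdeg (by intro i _; simpa using hd₁)
  set η : ℝ := r₀ / 4 with hη
  have hη0 : 0 < η := by positivity
  set R : ℝ := R₀ + 1 with hR
  obtain ⟨M, hM⟩ := aux_time f R₀ (R + 1) η (by linarith) hη0 hescf
  set κ : ℝ := min η (ε / 2) with hκ
  have hκ0 : 0 < κ := by positivity
  obtain ⟨N', hN'⟩ := exists_pow_lt_of_lt_one hκ0 (inv_lt_one_of_one_lt₀ hlam₀)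
  set N := N' + 1 with hN
  have hlamN : ∀ m ≥ N, lam₀ ^ (-(m:ℤ)) < κ := by
    intro m hm
    rw [zpow_neg, zpow_natCast, ← inv_pow]
    refine lt_of_le_of_lt ?_ hN'
    exact pow_le_pow_of_le_one (by positivity) (inv_le_one_of_one_le₀ hlam₀.le) (by omega)
  obtain ⟨d₂, hd₂, hcl⟩ := aux_close_iter d f hdeg R (max (M + N) (2 * N)) (min (1/3) (η/3))
    (by positivity)
  obtain ⟨δ₁, hδ₁, huM⟩ := aux_unifCont f (M + N) R (1/3) (by norm_num)
  obtain ⟨δ₂, hδ₂, huN⟩ := aux_unifCont f N R (η/3) (by positivity)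
  refine ⟨min d₁ d₂, by positivity, min 1 (min δ₁ δ₂), by positivity, ?_⟩
  intro g hg hclose z hz n w hw
  have hescg := hesc g hg (fun i hi => lt_of_lt_of_le (hclose i hi) (min_le_left _ _))
  have hcl1 := hcl g hg (fun i hi => lt_of_lt_of_le (hclose i hi) (min_le_right _ _))
  clear hcl
  set F : ℂ → ℂ := fun y => f.eval y with hF
  set G : ℂ → ℂ := fun y => g.eval y with hG
  have hcM : ∀ m ≤ M + N, ∀ x : ℂ, ‖x‖ ≤ R → dist (F^[m] x) (G^[m] x) < 1/3 := fun m hm x hx =>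
    lt_of_lt_of_le (hcl1 m (hm.trans (le_max_left _ _)) x hx) (min_le_left _ _)
  have hcN : ∀ m ≤ 2 * N, ∀ x : ℂ, ‖x‖ ≤ R → dist (F^[m] x) (G^[m] x) < η/3 := fun m hm x hx =>
    lt_of_lt_of_le (hcl1 m (hm.trans (le_max_right _ _)) x hx) (min_le_right _ _)
  -- the backward invariant set
  set V : Set ℂ := {x | ‖G^[M] x‖ ≤ R} with hV
  have hVR : ∀ x ∈ V, ‖x‖ ≤ R := fun x hx => aux_back g R₀ R (by linarith) hescg x M hx
  have hVback : ∀ (k : ℕ) (x : ℂ), G^[k] x ∈ V → x ∈ V := by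
    intro k x hx
    simp only [hV, mem_ofPred_eq] at hx ⊢
    rw [← Function.iterate_add_apply, add_comm, Function.iterate_add_apply] at hx
    exact aux_back g R₀ R (by linarith) hescg _ k hx
  have hVnear : ∀ x ∈ V, ∃ z' ∈ filledJulia f, dist x z' < η := by
    intro x hx
    by_contra hcon
    push Not at hcon
    have h1 := hM x (by linarith [hVR x hx]) hcon
    have h2 := hcM M (by omega) x (hVR x hx)
    have h3 := norm_sub_norm_le (F^[M] x) (G^[M] x)
    rw [dist_eq_norm] at h2
    have h4 : ‖G^[M] x‖ ≤ R := hx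
    linarith
  have hzn : ∀ k, ‖G^[k] z‖ ≤ R₀ := fun k =>
    aux_julia_norm g R₀ hR₀ hescg _ (aux_julia_iter g z hz k)
  have hzR : ‖z‖ ≤ R := by
    have := hzn 0
    simp only [Function.iterate_zero, id] at this
    linarith
  have hball : ∀ x ∈ ball z (min 1 (min δ₁ δ₂)), G^[N] x ∈ V ∧ dist (G^[N] x) (G^[N] z) < η := by
    intro x hx
    rw [mem_ball] at hx
    have hx1 := lt_of_lt_of_le hx (min_le_left _ _)
    have hx2 := lt_of_lt_of_le hx ((min_le_right _ _).trans (min_le_left _ _))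
    have hx3 := lt_of_lt_of_le hx ((min_le_right _ _).trans (min_le_right _ _))
    have hxR : ‖x‖ ≤ R := by
      have h1 := norm_sub_norm_le x z
      have := hzn 0
      simp only [Function.iterate_zero, id] at this
      rw [dist_eq_norm] at hx1
      linarith
    constructor
    · have a1 := huM x z hxR hzR hx2
      have a2 := hcM (M + N) le_rfl x hxR
      have a3 := hcM (M + N) le_rfl z hzR
      have a4 := hzn (M + N)
      have a5 : dist (G^[M + N] x) (G^[M + N] z) ≤ dist (F^[M + N] x) (G^[M + N] x) + dist (F^[M + N] x) (F^[M + N] z)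
          + dist (F^[M + N] z) (G^[M + N] z) := by
        rw [dist_comm (F^[M + N] x) (G^[M + N] x)]
        exact dist_triangle4 _ _ _ _
      have a6 := norm_sub_norm_le (G^[M + N] x) (G^[M + N] z)
      rw [← dist_eq_norm] at a6
      show ‖G^[M] (G^[N] x)‖ ≤ R
      rw [← Function.iterate_add_apply]
      linarith
    · have a1 := huN x z hxR hzR hx3
      have a2 := hcN N (by omega) x hxR
      have a3 := hcN N (by omega) z hzR
      have a5 : dist (G^[N] x) (G^[N] z) ≤ dist (F^[N] x) (G^[N] x) + dist (F^[N] x) (F^[N] z)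
          + dist (F^[N] z) (G^[N] z) := by
        rw [dist_comm (F^[N] x) (G^[N] x)]
        exact dist_triangle4 _ _ _ _
      linarith
  -- one block
  have hstep : ∀ m ≥ N, m ≤ 2 * N → ∀ A : Set ℂ, IsPreconnected A → A ⊆ V →
      ∀ c ∈ V, (∀ x ∈ A, dist (G^[m] x) c < η) → ∀ x ∈ A, ∀ y ∈ A, dist x y < κ := by
    intro m hmN hm2 A hA hAV c hc hAc x hx y hy
    obtain ⟨z', hz', hcz⟩ := hVnear c hc
    have hsub : A ⊆ F^[m] ⁻¹' ball z' r₀ := by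
      intro a ha
      rw [mem_preimage, mem_ball]
      have b1 := hcN m hm2 a (hVR a (hAV ha))
      have b2 := hAc a ha
      have b3 := dist_triangle4 (F^[m] a) (G^[m] a) c z'
      linarith
    have hsub2 := hA.subset_connectedComponentIn hx hsub
    have hbdd : Bornology.IsBounded (connectedComponentIn (F^[m] ⁻¹' ball z' r₀) x) := by
      refine (Metric.isBounded_closedBall (x := (0:ℂ)) (r := R₀ + r₀)).subset ?_
      refine (connectedComponentIn_subset _ _).trans ?_
      intro a ha
      rw [mem_preimage, mem_ball] at ha
      rw [mem_closedBall_zero_iff]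
      refine aux_back f R₀ (R₀ + r₀) (by linarith) hescf a m ?_
      have b1 := norm_sub_norm_le (F^[m] a) z'
      rw [← dist_eq_norm] at b1
      have b2 := aux_julia_norm f R₀ hR₀ hescf z' hz'
      show ‖F^[m] a‖ ≤ _
      linarith
    have b1 := dist_le_diam_of_mem hbdd (hsub2 hx) (hsub2 hy)
    have b2 := hES z' hz' m x (hsub hx)
    have b3 := hlamN m hmN
    linarith
  -- induction over blocks
  have hind : ∀ m ≥ N, ∀ A : Set ℂ, IsPreconnected A → (∀ x ∈ A, G^[m] x ∈ V) →
      ∀ c ∈ V, (∀ x ∈ A, dist (G^[m] x) c < η) → ∀ x ∈ A, ∀ y ∈ A, dist x y < κ := by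
    intro m
    induction m using Nat.strong_induction_on with
    | _ m ih =>
      intro hm A hA hAV c hc hAc x hx y hy
      have hAV' : A ⊆ V := fun a ha => hVback m a (hAV a ha)
      rcases Nat.le_total m (2 * N) with h2 | h2
      · exact hstep m hm h2 A hA hAV' c hc hAc x hx y hy
      · have hit : ∀ a, G^[m - N] (G^[N] a) = G^[m] a := by
          intro a
          rw [← Function.iterate_add_apply]
          congr 2
          omega
        have key := ih (m - N) (by omega) (by omega) (G^[N] '' A)
          (hA.image _ (aux_cont g N).continuousOn)
          (by
            rintro _ ⟨a, ha, rfl⟩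
            rw [hit]
            exact hAV a ha)
          c hc
          (by
            rintro _ ⟨a, ha, rfl⟩
            rw [hit]
            exact hAc a ha)
        refine hstep N le_rfl (by omega) A hA hAV' (G^[N] x) ?_ ?_ x hx y hy
        · apply hVback (m - N)
          rw [hit]
          exact hAV x hx
        · intro a ha
          exact lt_of_lt_of_le (key _ ⟨a, ha, rfl⟩ _ ⟨x, hx, rfl⟩) (min_le_left _ _)
  set W := connectedComponentIn (G^[n] ⁻¹' ball z (min 1 (min δ₁ δ₂))) w with hW
  have hWsub : ∀ x ∈ W, G^[n] x ∈ ball z (min 1 (min δ₁ δ₂)) := by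
    intro x hx
    have := connectedComponentIn_subset _ _ hx
    exact this
  have hit : ∀ a, G^[N + n] a = G^[N] (G^[n] a) := fun a => Function.iterate_add_apply _ _ _ _
  have hfin := hind (N + n) (by omega) W isPreconnected_connectedComponentIn
    (fun x hx => by rw [hit]; exact (hball _ (hWsub x hx)).1)
    (G^[N] z)
    (hball z (mem_ball_self (by positivity))).1
    (fun x hx => by rw [hit]; exact (hball _ (hWsub x hx)).2)
  have h1 : diam W ≤ κ := diam_le_of_forall_dist_le hκ0.le (fun x hx y hy => (hfin x hx y hy).le)
  have h2 : κ ≤ ε / 2 := min_le_right _ _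
  linarith
end
end
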